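/- arXiv:1305.6588 — 2 statements merged into one kernel-verified Lean document; each statement's English description precedes it below -/
import Mathlib

section
/- Let 0 < α < β ≤ 1 and p₁, p₂ > 0 with p₁ + p₂ = 1, and let ν be a Borel probability measure on [0,1]×[0,1] that is absolutely continuous with respect to two-dimensional Lebesgue measure and S-invariant. Then for every bounded Borel measurable function φ : [0,1]×[0,1] → ℝ and every Hölder continuous function ψ : [0,1]×[0,1] → ℝ (i.e., there exist K ≥ 0 and s ∈ (0,1] with |ψ(u) − ψ(v)| ≤ K·dist(u,v)^s for all u, v), there exists C > 0 such that for all n ≥ 1, |∫ (φ∘Sⁿ)·ψ dν − (∫ φ dν)·(∫ ψ dν)| ≤ C·n^{1−1/α}. -/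
noncomputable section

open Real MeasureTheory Set Filter



/-- The LSV map `T_γ` on `[0,1]`: `x(1+2^γ x^γ)` on `[0,1/2]`, `2x-1` on `(1/2,1]`. -/
noncomputable def lsv (γ : ℝ) (x : ℝ) : ℝ :=
  if x ≤ 1 / 2 then x * (1 + 2 ^ γ * x ^ γ) else 2 * x - 1

/-- The left branch of the LSV map. -/
noncomputable def lsvLeft (γ : ℝ) (x : ℝ) : ℝ := x * (1 + 2 ^ γ * x ^ γ)

/-- The random parameter selection: `α` for `ω ∈ [0,p₁)`, `β` for `ω ∈ [p₁,1]`. -/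
noncomputable def sel (α β p₁ : ℝ) (ω : ℝ) : ℝ := if ω < p₁ then α else β

/-- The randomizing map `φ` on `[0,1]`. -/
noncomputable def phiMap (p₁ p₂ : ℝ) (ω : ℝ) : ℝ :=
  if ω < p₁ then ω / p₁ else (ω - p₁) / p₂

/-- The skew product `S(x,ω) = (T_{α(ω)}(x), φ(ω))`. -/
noncomputable def skew (α β p₁ p₂ : ℝ) (z : ℝ × ℝ) : ℝ × ℝ :=
  (lsv (sel α β p₁ z.2) z.1, phiMap p₁ p₂ z.2)

/-- Random iterates: `randIter n ω = T_ω^n = T_{α(φ^{n-1}ω)} ∘ ⋯ ∘ T_{α(ω)}`. -/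
noncomputable def randIter (α β p₁ p₂ : ℝ) : ℕ → ℝ → ℝ → ℝ
  | 0, _, x => x
  | n + 1, ω, x => randIter α β p₁ p₂ n (phiMap p₁ p₂ ω) (lsv (sel α β p₁ ω) x)

/-- The deterministic backward orbit `x_n^γ`: `x₀^γ = 1`, `x₁^γ = 1/2`, and for `n ≥ 2`,
`x_n^γ` is the (unique) point of `(0,1/2]` with `T_γ(x_n^γ) = x_{n-1}^γ`. -/
def IsDetBackOrbit (γ : ℝ) (x : ℕ → ℝ) : Prop :=
  x 0 = 1 ∧ x 1 = 1 / 2 ∧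
    ∀ n, 2 ≤ n → x n ∈ Set.Ioc (0 : ℝ) (1 / 2) ∧ lsv γ (x n) = x (n - 1)

/-- The random backward orbit `x_n(ω)`: `x₀(ω) = 1`, `x₁(ω) = 1/2`, and for `n ≥ 2`,
`x_n(ω)` is the (unique) point of `(0,1/2]` with `T_{α(ω)}(x_n(ω)) = x_{n-1}(φω)`. -/
def IsRandBackOrbit (α β p₁ p₂ : ℝ) (X : ℕ → ℝ → ℝ) : Prop :=
  (∀ ω, X 0 ω = 1) ∧ (∀ ω, X 1 ω = 1 / 2) ∧
    ∀ n, 2 ≤ n → ∀ ω, X n ω ∈ Set.Ioc (0 : ℝ) (1 / 2) ∧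
      lsv (sel α β p₁ ω) (X n ω) = X (n - 1) (phiMap p₁ p₂ ω)

/-- The points `x'_n(ω)`: `x'₀(ω) = 1`, `x'₁(ω) = 3/4`, and
`x'_n(ω) = (x_n(φω) + 1)/2` for `n ≥ 2`. -/
def IsRandBackOrbitPrime (p₁ p₂ : ℝ) (X X' : ℕ → ℝ → ℝ) : Prop :=
  (∀ ω, X' 0 ω = 1) ∧ (∀ ω, X' 1 ω = 3 / 4) ∧
    ∀ n, 2 ≤ n → ∀ ω, X' n ω = (X n (phiMap p₁ p₂ ω) + 1) / 2

/-- First return time of `(x,ω)` to `(1/2,1] × [0,1]` under the skew product. -/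
noncomputable def returnTime (α β p₁ p₂ : ℝ) (x ω : ℝ) : ℕ :=
  sInf {k : ℕ | 1 ≤ k ∧ 1 / 2 < randIter α β p₁ p₂ k ω x}


/-! ### Part A: scalar renewal theory -/

/-- The weight `(n+1)^(-κ)`. -/
def wt (κ : ℝ) (n : ℕ) : ℝ := ((n : ℝ) + 1) ^ (-κ)

lemma wt_pos (κ : ℝ) (n : ℕ) : 0 < wt κ n := by
  unfold wt; positivity

lemma wt_summable {κ : ℝ} (hκ : 1 < κ) : Summable (wt κ) := by
  have h := (Real.summable_nat_rpow (p := -κ)).2 (by linarith)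
  have h2 := (summable_nat_add_iff 1).2 h
  refine h2.congr (fun n => ?_)
  simp [wt]

lemma wt_le_one {κ : ℝ} (hκ : 0 ≤ κ) (n : ℕ) : wt κ n ≤ 1 := by
  unfold wt
  apply Real.rpow_le_one_of_one_le_of_nonpos
  · have : (0:ℝ) ≤ n := Nat.cast_nonneg n
    linarith
  · linarith

lemma wt_zero (κ : ℝ) : wt κ 0 = 1 := by simp [wt]

lemma rpow_neg_half_le {κ a b : ℝ} (hκ : 0 ≤ κ) (hb : 0 < b) (h : b / 2 ≤ a) :
    a ^ (-κ) ≤ 2 ^ κ * b ^ (-κ) := by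
  have h1 : a ^ (-κ) ≤ (b / 2) ^ (-κ) :=
    Real.rpow_le_rpow_of_nonpos (by positivity) h (by linarith)
  have h2 : (b / 2) ^ (-κ) = 2 ^ κ * b ^ (-κ) := by
    rw [div_eq_mul_inv, Real.mul_rpow hb.le (by positivity), Real.inv_rpow (by positivity),
      Real.rpow_neg (x := 2) (by positivity), inv_inv, mul_comm]
  linarith

lemma conv_wt {κ : ℝ} (hκ : 1 < κ) (n : ℕ) :
    ∑ p ∈ Finset.HasAntidiagonal.antidiagonal n, wt κ p.1 * wt κ p.2
      ≤ (2 * 2 ^ κ * ∑' i, wt κ i) * wt κ n := by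
  have key : ∀ p ∈ Finset.HasAntidiagonal.antidiagonal n, wt κ p.1 * wt κ p.2
      ≤ 2 ^ κ * wt κ n * (wt κ p.1 + wt κ p.2) := by
    intro p hp
    rw [Finset.HasAntidiagonal.mem_antidiagonal] at hp
    have hn : (n : ℝ) = p.1 + p.2 := by rw [← hp]; push_cast; ring
    have h1 := wt_pos κ p.1
    have h2 := wt_pos κ p.2
    have h3 : 0 < 2 ^ κ * wt κ n := mul_pos (by positivity) (wt_pos κ n)
    have hn0 : (0 : ℝ) < (n : ℝ) + 1 := by positivity
    rcases le_total (p.1 : ℝ) p.2 with h | h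
    · have : wt κ p.2 ≤ 2 ^ κ * wt κ n := by
        unfold wt
        apply rpow_neg_half_le (by linarith) hn0
        linarith
      nlinarith
    · have : wt κ p.1 ≤ 2 ^ κ * wt κ n := by
        unfold wt
        apply rpow_neg_half_le (by linarith) hn0
        linarith
      nlinarith
  have hs := wt_summable hκ
  have e1 : ∑ p ∈ Finset.HasAntidiagonal.antidiagonal n, wt κ p.1 ≤ ∑' i, wt κ i := by
    rw [Finset.Nat.sum_antidiagonal_eq_sum_range_succ_mk]
    exact hs.sum_le_tsum _ (fun i _ => (wt_pos κ i).le)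
  have e2 : ∑ p ∈ Finset.HasAntidiagonal.antidiagonal n, wt κ p.2 ≤ ∑' i, wt κ i := by
    rw [← Finset.Nat.sum_antidiagonal_swap]
    exact e1
  calc _ ≤ ∑ p ∈ Finset.HasAntidiagonal.antidiagonal n, 2 ^ κ * wt κ n * (wt κ p.1 + wt κ p.2) :=
        Finset.sum_le_sum key
    _ = 2 ^ κ * wt κ n * (∑ p ∈ Finset.HasAntidiagonal.antidiagonal n, wt κ p.1
          + ∑ p ∈ Finset.HasAntidiagonal.antidiagonal n, wt κ p.2) := by
        rw [← Finset.mul_sum, Finset.sum_add_distrib]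
    _ ≤ 2 ^ κ * wt κ n * (∑' i, wt κ i + ∑' i, wt κ i) := by
        have h3 : 0 < 2 ^ κ * wt κ n := mul_pos (by positivity) (wt_pos κ n)
        gcongr
    _ = _ := by ring

/-- Power series with coefficients `O((n+1)^(-κ))`. -/
def BigW (κ : ℝ) (f : PowerSeries ℝ) : Prop := ∃ C, ∀ n, |PowerSeries.coeff n f| ≤ C * wt κ n

lemma BigW.mul {κ : ℝ} (hκ : 1 < κ) {f g : PowerSeries ℝ} (hf : BigW κ f) (hg : BigW κ g) :
    BigW κ (f * g) := by
  obtain ⟨C, hC⟩ := hf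
  obtain ⟨D, hD⟩ := hg
  refine ⟨C * D * (2 * 2 ^ κ * ∑' i, wt κ i), fun n => ?_⟩
  have hC0 : 0 ≤ C := by
    have := (abs_nonneg _).trans (hC 0)
    rw [wt_zero] at this; linarith
  have hD0 : 0 ≤ D := by
    have := (abs_nonneg _).trans (hD 0)
    rw [wt_zero] at this; linarith
  rw [PowerSeries.coeff_mul]
  calc _ ≤ ∑ p ∈ Finset.HasAntidiagonal.antidiagonal n, |PowerSeries.coeff p.1 f * PowerSeries.coeff p.2 g| :=
        Finset.abs_sum_le_sum_abs _ _
    _ ≤ ∑ p ∈ Finset.HasAntidiagonal.antidiagonal n, C * D * (wt κ p.1 * wt κ p.2) := by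
        apply Finset.sum_le_sum
        intro p _
        rw [abs_mul]
        calc _ ≤ (C * wt κ p.1) * (D * wt κ p.2) :=
              mul_le_mul (hC _) (hD _) (abs_nonneg _) (mul_nonneg hC0 (wt_pos κ _).le)
          _ = _ := by ring
    _ = C * D * ∑ p ∈ Finset.HasAntidiagonal.antidiagonal n, (wt κ p.1 * wt κ p.2) := by rw [Finset.mul_sum]
    _ ≤ C * D * ((2 * 2 ^ κ * ∑' i, wt κ i) * wt κ n) := by
        have := conv_wt hκ n
        gcongr
    _ = _ := by ring

/-- Kaluza's lemma. -/
lemma kaluza (r : ℕ → ℝ) (r0 : r 0 = 1) (rpos : ∀ n, 0 < r n)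
    (hr : ∀ m n, m ≤ n → r (m + 1) * r n ≤ r (n + 1) * r m) (n : ℕ) :
    |PowerSeries.coeff n (PowerSeries.mk r)⁻¹| ≤ r n := by
  set R := PowerSeries.mk r with hR
  set s : ℕ → ℝ := fun n => PowerSeries.coeff n R⁻¹ with hs
  have hc : PowerSeries.constantCoeff R ≠ 0 := by
    rw [← PowerSeries.coeff_zero_eq_constantCoeff_apply, hR, PowerSeries.coeff_mk, r0]; norm_num
  have hmul : R⁻¹ * R = 1 := PowerSeries.inv_mul_cancel R hc
  have hsum : ∀ n, ∑ k ∈ Finset.range (n + 1), s k * r (n - k) = if n = 0 then 1 else 0 := by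
    intro n
    have := congrArg (PowerSeries.coeff n) hmul
    rw [PowerSeries.coeff_mul, Finset.Nat.sum_antidiagonal_eq_sum_range_succ_mk,
      PowerSeries.coeff_one] at this
    simpa [hs, hR] using this
  have s0 : s 0 = 1 := by
    have := hsum 0
    simpa [r0] using this
  have hneg : ∀ n, s (n + 1) ≤ 0 := by
    intro n
    induction n using Nat.strong_induction_on with
    | _ n ih =>
      have h1 := hsum (n + 1)
      rw [Finset.sum_range_succ, Finset.sum_range_succ'] at h1
      simp only [Nat.sub_self, r0, s0, Nat.sub_zero, Nat.add_eq_zero_iff, one_ne_zero,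
        and_false, if_false, mul_one, one_mul] at h1
      rcases Nat.eq_zero_or_pos n with rfl | hn
      · simp at h1
        have := rpos 1
        simp; linarith
      · have h2 := hsum n
        rw [Finset.sum_range_succ'] at h2
        simp only [s0, Nat.sub_zero, one_mul, hn.ne', if_false] at h2
        have h3 : r (n+1) * (∑ k ∈ Finset.range n, s (k + 1) * r (n - (k + 1)))
            ≤ r n * ∑ k ∈ Finset.range n, s (k + 1) * r (n + 1 - (k + 1)) := by
          rw [Finset.mul_sum, Finset.mul_sum]
          apply Finset.sum_le_sum
          intro k hk
          rw [Finset.mem_range] at hk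
          have e : n + 1 - (k + 1) = n - (k + 1) + 1 := by omega
          rw [e]
          have := hr (n - (k + 1)) n (by omega)
          have h5 := ih k hk
          nlinarith
        have h4 : ∑ k ∈ Finset.range n, s (k + 1) * r (n - (k + 1)) = - r n := by linarith
        rw [h4] at h3
        have h5 := rpos n
        have h6 : ∑ k ∈ Finset.range n, s (k + 1) * r (n + 1 - (k + 1)) ≥ - r (n+1) := by
          by_contra hcon
          push Not at hcon
          nlinarith
        linarith
  rcases n with _ | n
  · change |s 0| ≤ _
    rw [s0, r0]; simp
  · change |s (n+1)| ≤ _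
    rw [abs_of_nonpos (hneg n)]
    have h1 := hsum (n + 1)
    rw [Finset.sum_range_succ, Finset.sum_range_succ'] at h1
    simp only [Nat.sub_self, r0, s0, Nat.sub_zero, Nat.add_eq_zero_iff, one_ne_zero,
      and_false, if_false, mul_one, one_mul] at h1
    have : ∑ k ∈ Finset.range n, s (k + 1) * r (n + 1 - (k + 1)) ≤ 0 :=
      Finset.sum_nonpos (fun k _ => mul_nonpos_of_nonpos_of_nonneg (hneg k) (rpos _).le)
    linarith

/-- The Kaluza sequence `(1+n/H)^(-κ)`. -/
def kz (κ : ℝ) (H : ℕ) (n : ℕ) : ℝ := ((H : ℝ) + 1) ^ κ * ((H : ℝ) + 1 + n) ^ (-κ)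

lemma kz_pos (κ : ℝ) (H n : ℕ) : 0 < kz κ H n := by unfold kz; positivity

lemma kz_zero (κ : ℝ) (H : ℕ) : kz κ H 0 = 1 := by
  unfold kz
  rw [Nat.cast_zero, add_zero, ← Real.rpow_add (by positivity)]; simp

lemma kz_ratio {κ : ℝ} (hκ : 0 ≤ κ) (H m n : ℕ) (h : m ≤ n) :
    kz κ H (m + 1) * kz κ H n ≤ kz κ H (n + 1) * kz κ H m := by
  unfold kz
  have e : ∀ a b : ℕ, ((H : ℝ) + 1) ^ κ * ((H : ℝ) + 1 + a) ^ (-κ) *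
      (((H : ℝ) + 1) ^ κ * ((H : ℝ) + 1 + b) ^ (-κ)) = (((H : ℝ) + 1) ^ κ)^2 *
      (((H : ℝ) + 1 + a) * ((H : ℝ) + 1 + b)) ^ (-κ) := by
    intro a b
    rw [Real.mul_rpow (by positivity) (by positivity)]; ring
  rw [e, e]
  apply mul_le_mul_of_nonneg_left _ (by positivity)
  apply Real.rpow_le_rpow_of_nonpos (by positivity) _ (by linarith)
  have : (m : ℝ) ≤ n := by exact_mod_cast h
  push_cast
  nlinarith

lemma kz_bigW {κ : ℝ} (hκ : 0 ≤ κ) (H n : ℕ) : kz κ H n ≤ ((H : ℝ) + 1) ^ κ * wt κ n := by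
  unfold kz wt
  apply mul_le_mul_of_nonneg_left _ (by positivity)
  apply Real.rpow_le_rpow_of_nonpos (by positivity) _ (by linarith)
  have : (0 : ℝ) ≤ H := Nat.cast_nonneg H
  linarith

lemma kz_diff {κ : ℝ} (hκ : 1 ≤ κ) (H n : ℕ) :
    kz κ H n - kz κ H (n + 1) ≤ κ / ((H : ℝ) + 1) * kz κ H n := by
  have hpos : (0 : ℝ) < (H : ℝ) + 1 + n := by positivity
  have hpos' : (0 : ℝ) < (H : ℝ) + 1 + (n + 1 : ℕ) := by positivity
  set u : ℝ := (H : ℝ) + 1 + (n + 1 : ℕ) with hu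
  have hue : (H : ℝ) + 1 + n = u * (1 + (- (1 / u))) := by
    rw [mul_add, mul_neg, mul_one_div_cancel hpos'.ne', hu]; push_cast; ring
  have hu1 : 1 ≤ u := by
    rw [hu]; push_cast; 
    have : (0 : ℝ) ≤ H := Nat.cast_nonneg H
    have : (0 : ℝ) ≤ n := Nat.cast_nonneg n
    linarith
  have hb := one_add_mul_self_le_rpow_one_add (s := -(1/u))
    (by rw [neg_le_neg_iff, div_le_one (by linarith)]; exact hu1) hκ
  have h1 : kz κ H (n + 1) = kz κ H n * (1 + (-(1/u))) ^ κ := by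
    unfold kz
    have hx : 0 < 1 + (-(1/u)) := by
      by_contra hcon
      push Not at hcon
      nlinarith
    rw [hue, Real.mul_rpow (by positivity) hx.le, mul_assoc, mul_assoc,
      ← Real.rpow_add hx]
    simp [hu]
  rw [h1]
  have h2 := kz_pos κ H n
  have h3 : κ * (1 / u) ≤ κ / ((H : ℝ) + 1) := by
    rw [mul_one_div]
    apply div_le_div_of_nonneg_left (by linarith) (by positivity)
    rw [hu]; have : (0:ℝ) ≤ (n+1 : ℕ) := Nat.cast_nonneg _
    linarith
  nlinarith

/-- tail of the weight series -/
def wtail (κ : ℝ) (k : ℕ) : ℝ := ∑' i, wt κ (i + k)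

lemma wtail_tendsto (κ : ℝ) : Tendsto (wtail κ) atTop (nhds 0) :=
  tendsto_sum_nat_add _

lemma sum_le_wtail {κ : ℝ} (hκ : 1 < κ) (k : ℕ) (s : Finset ℕ) (hs : ∀ i ∈ s, k ≤ i) :
    ∑ i ∈ s, wt κ i ≤ wtail κ k := by
  have hsm : Summable (fun i => wt κ (i + k)) := (summable_nat_add_iff k).2 (wt_summable hκ)
  have : ∑ i ∈ s, wt κ i = ∑ i ∈ s.image (fun i => i - k), wt κ (i + k) := by
    rw [Finset.sum_image]
    · apply Finset.sum_congr rfl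
      intro i hi
      rw [Nat.sub_add_cancel (hs i hi)]
    · intro a ha b hb hab
      have := hs a ha
      have := hs b hb
      simp only at hab
      omega
  rw [this]
  exact hsm.sum_le_tsum _ (fun i _ => (wt_pos κ _).le)

lemma kz_conv {κ : ℝ} (hκ : 1 < κ) (H k n : ℕ) (hH : k ≤ H) :
    ∑ j ∈ (Finset.range (n + 1)).filter (fun j => k ≤ n - j), kz κ H j * wt κ (n - j)
      ≤ 2 * 2 ^ κ * wtail κ k * kz κ H n := by
  have hkz := kz_pos κ H n
  have key : ∀ j ∈ (Finset.range (n + 1)).filter (fun j => k ≤ n - j), kz κ H j * wt κ (n - j)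
      ≤ 2 ^ κ * kz κ H n * (wt κ (n - j) + wt κ (H + j)) := by
    intro j hj
    simp only [Finset.mem_filter, Finset.mem_range] at hj
    have hjn : j ≤ n := by omega
    have hw1 := wt_pos κ (n - j)
    have hw2 := wt_pos κ (H + j)
    have h2k : (0:ℝ) < 2 ^ κ := by positivity
    have hc : ((n - j : ℕ) : ℝ) = n - j := by rw [Nat.cast_sub hjn]
    rcases le_total (((H : ℝ) + 1 + n) / 2) ((H : ℝ) + 1 + j) with h | h
    · have : kz κ H j ≤ 2 ^ κ * kz κ H n := by
        unfold kz
        have := rpow_neg_half_le (κ := κ) (by linarith) (by positivity) h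
        calc _ ≤ ((H : ℝ) + 1) ^ κ * (2 ^ κ * ((H : ℝ) + 1 + n) ^ (-κ)) := by gcongr
          _ = _ := by ring
      have h3 : 0 < 2 ^ κ * kz κ H n * wt κ (H + j) := by positivity
      nlinarith
    · have h5 : wt κ (n - j) ≤ 2 ^ κ * ((H : ℝ) + 1 + n) ^ (-κ) := by
        unfold wt
        apply rpow_neg_half_le (by linarith) (by positivity)
        rw [hc]; linarith
      have h6 : kz κ H j = ((H : ℝ) + 1) ^ κ * wt κ (H + j) := by
        unfold kz wt
        push_cast
        congr 2; ring
      have h7 : kz κ H j * wt κ (n - j) ≤ 2 ^ κ * kz κ H n * wt κ (H + j) := by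
        rw [h6]
        calc _ ≤ ((H : ℝ) + 1) ^ κ * wt κ (H + j) * (2 ^ κ * ((H : ℝ) + 1 + n) ^ (-κ)) := by
              gcongr
          _ = _ := by unfold kz; ring
      have h3 : 0 < 2 ^ κ * kz κ H n * wt κ (n - j) := by positivity
      nlinarith
  have s1 : ∑ j ∈ (Finset.range (n + 1)).filter (fun j => k ≤ n - j), wt κ (n - j)
      ≤ wtail κ k := by
    have : ∑ j ∈ (Finset.range (n + 1)).filter (fun j => k ≤ n - j), wt κ (n - j) =
        ∑ i ∈ ((Finset.range (n + 1)).filter (fun j => k ≤ n - j)).image (fun j => n - j),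
          wt κ i := by
      rw [Finset.sum_image]
      intro a ha b hb hab
      simp at ha hb hab
      omega
    rw [this]
    apply sum_le_wtail hκ
    intro i hi
    simp at hi
    obtain ⟨a, ⟨_, h⟩, rfl⟩ := hi
    exact h
  have s2 : ∑ j ∈ (Finset.range (n + 1)).filter (fun j => k ≤ n - j), wt κ (H + j)
      ≤ wtail κ k := by
    have : ∑ j ∈ (Finset.range (n + 1)).filter (fun j => k ≤ n - j), wt κ (H + j) =
        ∑ i ∈ ((Finset.range (n + 1)).filter (fun j => k ≤ n - j)).image (fun j => H + j),
          wt κ i := by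
      rw [Finset.sum_image]
      intro a ha b hb hab
      simp at hab
      omega
    rw [this]
    apply sum_le_wtail hκ
    intro i hi
    simp at hi
    obtain ⟨a, _, rfl⟩ := hi
    omega
  calc _ ≤ ∑ j ∈ (Finset.range (n + 1)).filter (fun j => k ≤ n - j),
        2 ^ κ * kz κ H n * (wt κ (n - j) + wt κ (H + j)) := Finset.sum_le_sum key
    _ = 2 ^ κ * kz κ H n * (∑ j ∈ (Finset.range (n + 1)).filter (fun j => k ≤ n - j), wt κ (n - j)
        + ∑ j ∈ (Finset.range (n + 1)).filter (fun j => k ≤ n - j), wt κ (H + j)) := by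
        rw [← Finset.mul_sum, Finset.sum_add_distrib]
    _ ≤ 2 ^ κ * kz κ H n * (wtail κ k + wtail κ k) := by gcongr
    _ = _ := by ring


/-- A Wiener lemma for tail sequences. -/
lemma wiener_tail {κ : ℝ} (hκ : 1 < κ) (A : ℕ → ℝ) (A0 : A 0 = 1) (anti : Antitone A)
    (A1 : A 1 < 1) (hpos : ∀ n, 0 ≤ A n) (hA : BigW κ (PowerSeries.mk A)) :
    BigW κ (PowerSeries.mk A)⁻¹ := by
  obtain ⟨C, hC⟩ := hA
  simp only [PowerSeries.coeff_mk] at hC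
  have hC0 : 0 ≤ C := by
    have := (abs_nonneg _).trans (hC 0)
    rw [wt_zero] at this; linarith
  have hC' : ∀ n, A n ≤ C * wt κ n := fun n => (le_abs_self _).trans (hC n)
  have hc : PowerSeries.constantCoeff (PowerSeries.mk A) ≠ 0 := by
    rw [← PowerSeries.coeff_zero_eq_constantCoeff_apply, PowerSeries.coeff_mk, A0]; norm_num
  -- choose k
  obtain ⟨k, hk⟩ : ∃ k, C * (2 * 2 ^ κ * wtail κ k) ≤ 1 / 2 := by
    have h := ((wtail_tendsto κ).const_mul (C * (2 * 2 ^ κ)))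
    rw [mul_zero] at h
    obtain ⟨k, hk⟩ := (h.eventually (ge_mem_nhds (show (0:ℝ) < 1/2 by norm_num))).exists
    exact ⟨k, by linarith⟩
  set a := 1 - A 1 with ha
  have ha0 : 0 < a := by linarith
  have ha1 : a ≤ 1 := by have := hpos 1; linarith
  set B := (2 / a) ^ k * (2 * (k + 1)) with hB
  have hBpos : 0 < B := by positivity
  obtain ⟨H, hHk, hH⟩ : ∃ H : ℕ, k ≤ H ∧ κ / ((H : ℝ) + 1) * B ≤ a / 2 := by
    obtain ⟨H, hH⟩ := exists_nat_ge (κ * B / (a / 2))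
    refine ⟨max k H, le_max_left _ _, ?_⟩
    have h1 : (H : ℝ) ≤ (max k H : ℕ) := by exact_mod_cast le_max_right _ _
    rw [div_le_iff₀ (by positivity)] at hH
    rw [div_mul_eq_mul_div, div_le_iff₀ (by positivity)]
    nlinarith
  set r := kz κ H with hr
  have rpos : ∀ n, 0 < r n := kz_pos κ H
  set Q := PowerSeries.mk r * (PowerSeries.mk A)⁻¹ with hQ
  set q : ℕ → ℝ := fun n => PowerSeries.coeff n Q with hq
  have hQA : Q * PowerSeries.mk A = PowerSeries.mk r := by
    rw [hQ, mul_assoc, PowerSeries.inv_mul_cancel _ hc, mul_one]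
  have hI : ∀ n, ∑ j ∈ Finset.range (n + 1), q j * A (n - j) = r n := by
    intro n
    have := congrArg (PowerSeries.coeff n) hQA
    rw [PowerSeries.coeff_mul, Finset.Nat.sum_antidiagonal_eq_sum_range_succ_mk,
      PowerSeries.coeff_mk] at this
    simpa [hq] using this
  have q0 : q 0 = 1 := by
    have := hI 0
    simpa [A0, hr, kz_zero] using this
  -- main induction
  have main : ∀ n, (∀ j ≤ n, 0 ≤ q j) ∧ (∀ j < n, a / 2 * q j ≤ q (j + 1)) := by
    intro n
    induction n with
    | zero =>
      refine ⟨fun j hj => ?_, fun j hj => by omega⟩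
      have : j = 0 := by omega
      rw [this, q0]; norm_num
    | succ n ih =>
      obtain ⟨ih1, ih2⟩ := ih
      have qle : ∀ j ≤ n, q j ≤ r j := by
        intro j hj
        rw [← hI j, Finset.sum_range_succ]
        simp only [Nat.sub_self, A0, mul_one]
        have : 0 ≤ ∑ x ∈ Finset.range j, q x * A (j - x) :=
          Finset.sum_nonneg (fun i hi => mul_nonneg
            (ih1 i (by rw [Finset.mem_range] at hi; omega)) (hpos _))
        linarith
      have qback : ∀ i ≤ n, q (n - i) ≤ (2 / a) ^ i * q n := by
        intro i
        induction i with
        | zero => intro _; simp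
        | succ i ihi =>
          intro hi
          have h1 := ihi (by omega)
          have h2 := ih2 (n - (i + 1)) (by omega)
          have e : n - (i + 1) + 1 = n - i := by omega
          rw [e] at h2
          have h3 : q (n - (i + 1)) ≤ (2 / a) * q (n - i) := by
            rw [div_mul_eq_mul_div, le_div_iff₀ ha0]; linarith
          calc _ ≤ (2 / a) * q (n - i) := h3
            _ ≤ (2 / a) * ((2 / a) ^ i * q n) := by gcongr
            _ = _ := by ring
      have hrn : r n ≤ B * q n := by
        have h1 := hI n
        rw [← Finset.sum_filter_add_sum_filter_not _ (fun j => k ≤ n - j)] at h1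
        have h2 : ∑ j ∈ (Finset.range (n + 1)).filter (fun j => k ≤ n - j), q j * A (n - j)
            ≤ 1 / 2 * r n := by
          calc _ ≤ ∑ j ∈ (Finset.range (n + 1)).filter (fun j => k ≤ n - j),
                C * (r j * wt κ (n - j)) := by
                apply Finset.sum_le_sum
                intro j hj
                simp only [Finset.mem_filter, Finset.mem_range] at hj
                have g1 := qle j (by omega)
                have g2 := hC' (n - j)
                calc _ ≤ r j * (C * wt κ (n - j)) :=
                      mul_le_mul g1 g2 (hpos _) (rpos _).le
                  _ = _ := by ring
            _ = C * ∑ j ∈ (Finset.range (n + 1)).filter (fun j => k ≤ n - j),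
                r j * wt κ (n - j) := by rw [Finset.mul_sum]
            _ ≤ C * (2 * 2 ^ κ * wtail κ k * r n) := by
                gcongr
                exact kz_conv hκ H k n hHk
            _ = C * (2 * 2 ^ κ * wtail κ k) * r n := by ring
            _ ≤ _ := by
                have := rpos n
                gcongr
        have h3 : ∑ j ∈ (Finset.range (n + 1)).filter (fun j => ¬ k ≤ n - j), q j * A (n - j)
            ≤ (k + 1) * ((2 / a) ^ k * q n) := by
          have hterm : ∀ j ∈ (Finset.range (n + 1)).filter (fun j => ¬ k ≤ n - j),
              q j * A (n - j) ≤ (2 / a) ^ k * q n := by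
            intro j hj
            simp only [Finset.mem_filter, Finset.mem_range] at hj
            have g1 := qback (n - j) (by omega)
            have e : n - (n - j) = j := by omega
            rw [e] at g1
            have g2 : A (n - j) ≤ 1 := by rw [← A0]; exact anti (Nat.zero_le _)
            have g3 : (2 / a) ^ (n - j) ≤ (2 / a) ^ k := by
              apply pow_le_pow_right₀ _ (by omega)
              rw [le_div_iff₀ ha0]; linarith
            have g4 := ih1 n le_rfl
            calc _ ≤ q j * 1 := by
                  have := ih1 j (by omega)
                  gcongr
              _ = q j := mul_one _
              _ ≤ _ := g1
              _ ≤ _ := by gcongr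
          have hcard : ((Finset.range (n + 1)).filter (fun j => ¬ k ≤ n - j)).card ≤ k + 1 := by
            have : (Finset.range (n + 1)).filter (fun j => ¬ k ≤ n - j)
                ⊆ (Finset.range (k + 1)).image (fun i => n - i) := by
              intro j hj
              simp only [Finset.mem_filter, Finset.mem_range, Finset.mem_image] at hj ⊢
              exact ⟨n - j, by omega, by omega⟩
            refine (Finset.card_le_card this).trans ?_
            refine Finset.card_image_le.trans ?_
            simp
          have := Finset.sum_le_card_nsmul _ _ _ hterm
          rw [nsmul_eq_mul] at this
          refine this.trans ?_
          have g4 := ih1 n le_rfl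
          have : (((Finset.range (n + 1)).filter (fun j => ¬ k ≤ n - j)).card : ℝ) ≤ k + 1 := by
            exact_mod_cast hcard
          gcongr
        rw [hB]
        linarith
      -- recursion
      have hrec : q (n + 1) ≥ a * q n - (r n - r (n + 1)) := by
        have h1 := hI (n + 1)
        have h2 := hI n
        rw [Finset.sum_range_succ, Finset.sum_range_succ] at h1
        rw [Finset.sum_range_succ] at h2
        have e1 : n + 1 - n = 1 := by omega
        simp only [Nat.sub_self, A0, mul_one, e1] at h1 h2
        have h3 : ∑ x ∈ Finset.range n, q x * A (n + 1 - x) ≤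
            ∑ x ∈ Finset.range n, q x * A (n - x) := by
          apply Finset.sum_le_sum
          intro i hi
          rw [Finset.mem_range] at hi
          exact mul_le_mul_of_nonneg_left (anti (by omega)) (ih1 i (by omega))
        have : a * q n = q n - q n * A 1 := by rw [ha]; ring
        linarith
      have hstep : a / 2 * q n ≤ q (n + 1) := by
        have h1 := kz_diff hκ.le H n
        have h4 := ih1 n le_rfl
        have h2 : κ / ((H : ℝ) + 1) * r n ≤ a / 2 * q n := by
          calc _ ≤ κ / ((H : ℝ) + 1) * (B * q n) := by
                have : 0 ≤ κ / ((H : ℝ) + 1) := by positivity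
                gcongr
            _ = κ / ((H : ℝ) + 1) * B * q n := by ring
            _ ≤ _ := by gcongr
        linarith
      refine ⟨fun j hj => ?_, fun j hj => ?_⟩
      · rcases Nat.lt_or_ge n j with h | h
        · have : j = n + 1 := by omega
          rw [this]
          have h4 := ih1 n le_rfl
          have : 0 ≤ a / 2 * q n := by positivity
          linarith
        · exact ih1 j h
      · rcases Nat.lt_or_ge j n with h | h
        · exact ih2 j h
        · have : j = n := by omega
          rw [this]; exact hstep
  have qpos : ∀ n, 0 ≤ q n := fun n => (main n).1 n le_rfl
  have qle : ∀ n, q n ≤ r n := by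
    intro j
    rw [← hI j, Finset.sum_range_succ]
    simp only [Nat.sub_self, A0, mul_one]
    have : 0 ≤ ∑ x ∈ Finset.range j, q x * A (j - x) :=
      Finset.sum_nonneg (fun i hi => mul_nonneg (qpos i) (hpos _))
    linarith
  have bQ : BigW κ Q := ⟨((H : ℝ) + 1) ^ κ, fun n => by
    change |q n| ≤ _
    rw [abs_of_nonneg (qpos n)]
    exact (qle n).trans (kz_bigW (by linarith) H n)⟩
  have bR : BigW κ (PowerSeries.mk r)⁻¹ := ⟨((H : ℝ) + 1) ^ κ, fun n =>
    (kaluza r (kz_zero κ H) rpos (kz_ratio (by linarith) H) n).trans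
      (kz_bigW (by linarith) H n)⟩
  have hcr : PowerSeries.constantCoeff (PowerSeries.mk r) ≠ 0 := by
    rw [← PowerSeries.coeff_zero_eq_constantCoeff_apply, PowerSeries.coeff_mk]
    exact (rpos 0).ne'
  have : (PowerSeries.mk A)⁻¹ = Q * (PowerSeries.mk r)⁻¹ := by
    rw [hQ, mul_comm (PowerSeries.mk r), mul_assoc, PowerSeries.mul_inv_cancel _ hcr, mul_one]
  rw [this]
  exact bQ.mul hκ bR

lemma rpow_telescope {κ u : ℝ} (hκ : 1 < κ) (hu : 1 < u) :
    u ^ (-κ) ≤ ((u - 1) ^ (1 - κ) - u ^ (1 - κ)) / (κ - 1) := by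
  rw [le_div_iff₀ (by linarith)]
  -- convexity of x ^ (1 - κ)
  have h1 : (1 - 1 / u) ^ (κ - 1) * (1 + (κ - 1) / u) ≤ 1 := by
    have hx : 0 < 1 - 1 / u := by
      rw [sub_pos, div_lt_one (by linarith)]; exact hu
    have a1 : (1 - 1 / u) ≤ Real.exp (-(1 / u)) := by
      have := Real.add_one_le_exp (-(1/u)); linarith
    have a2 : (1 - 1 / u) ^ (κ - 1) ≤ Real.exp (-(1 / u)) ^ (κ - 1) :=
      Real.rpow_le_rpow hx.le a1 (by linarith)
    rw [← Real.exp_mul] at a2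
    have a3 : 1 + (κ - 1) / u ≤ Real.exp ((κ - 1) / u) := by
      have := Real.add_one_le_exp ((κ - 1) / u); linarith
    calc _ ≤ Real.exp (-(1 / u) * (κ - 1)) * Real.exp ((κ - 1) / u) := by
          apply mul_le_mul a2 a3 _ (Real.exp_pos _).le
          have : 0 < (κ - 1) / u := div_pos (by linarith) (by linarith)
          linarith
      _ = 1 := by
          rw [← Real.exp_add, Real.exp_eq_one_iff]; ring
  have hx : 0 < 1 - 1 / u := by
    rw [sub_pos, div_lt_one (by linarith)]; exact hu
  have h2 : (u - 1) ^ (1 - κ) = u ^ (1 - κ) * ((1 - 1 / u) ^ (κ - 1))⁻¹ := by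
    have : u - 1 = u * (1 - 1 / u) := by
      field_simp
    rw [this, Real.mul_rpow (by linarith) hx.le, ← Real.rpow_neg hx.le]
    congr 2; ring
  have h3 : u ^ (-κ) = u ^ (1 - κ) * (1 / u) := by
    rw [show (1 - κ) = -κ + 1 by ring, Real.rpow_add (by linarith), Real.rpow_one]
    field_simp
  have hp : 0 < (1 - 1 / u) ^ (κ - 1) := Real.rpow_pos_of_pos hx _
  have h4 : 1 + (κ - 1) / u ≤ ((1 - 1 / u) ^ (κ - 1))⁻¹ := by
    rw [le_inv_comm₀ _ hp]
    · rw [← one_div, le_div_iff₀]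
      · exact h1
      · have : 0 < (κ - 1) / u := div_pos (by linarith) (by linarith)
        linarith
    · have : 0 < (κ - 1) / u := div_pos (by linarith) (by linarith)
      linarith
  have hu0 : 0 < u ^ (1 - κ) := Real.rpow_pos_of_pos (by linarith) _
  rw [h2, h3]
  have : u ^ (1 - κ) * (1 / u) * (κ - 1) = u ^ (1 - κ) * ((κ - 1) / u) := by ring
  rw [this]
  nlinarith

/-- tail sums of the weight -/
lemma sum_wt_le {κ : ℝ} (hκ : 1 < κ) (N M : ℕ) :
    ∑ i ∈ Finset.range M, wt κ (N + 1 + i) ≤ (κ - 1)⁻¹ * wt (κ - 1) N := by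
  have h : ∑ i ∈ Finset.range M, wt κ (N + 1 + i) ≤
      (κ - 1)⁻¹ * (wt (κ - 1) N - wt (κ - 1) (N + M)) := by
    induction M with
    | zero => simp
    | succ M ih =>
      rw [Finset.sum_range_succ]
      have h1 : (1 : ℝ) < ((N + 1 + M : ℕ) : ℝ) + 1 := by
        push_cast
        have : (0:ℝ) ≤ N := Nat.cast_nonneg _
        have : (0:ℝ) ≤ M := Nat.cast_nonneg _
        linarith
      have := rpow_telescope hκ h1
      have e1 : wt κ (N + 1 + M) = (((N + 1 + M : ℕ) : ℝ) + 1) ^ (-κ) := rfl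
      have e2 : wt (κ - 1) (N + M) = (((N + 1 + M : ℕ) : ℝ) + 1 - 1) ^ (1 - κ) := by
        unfold wt; push_cast; congr 1 <;> ring
      have e3 : wt (κ - 1) (N + (M + 1)) = (((N + 1 + M : ℕ) : ℝ) + 1) ^ (1 - κ) := by
        unfold wt; push_cast; congr 1 <;> ring
      rw [← e1, ← e2, ← e3, div_eq_inv_mul] at this
      linarith
  have h2 : 0 ≤ (κ - 1)⁻¹ := by
    rw [inv_nonneg]; linarith
  have h3 := wt_pos (κ - 1) (N + M)
  nlinarith

/-- Scalar renewal theorem with polynomial rate. -/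
lemma renewal_limit {κ : ℝ} (hκ : 1 < κ) (A : ℕ → ℝ) (A0 : A 0 = 1) (anti : Antitone A)
    (A1 : A 1 < 1) (hpos : ∀ n, 0 ≤ A n) (C : ℝ) (hA : ∀ n, A n ≤ C * wt κ n)
    (x : ℕ → ℝ) (D : ℝ)
    (hx0 : |x 0| ≤ D)
    (hx : ∀ n, |x (n + 1) - ∑ j ∈ Finset.range (n + 1), (A j - A (j + 1)) * x (n - j)|
      ≤ D * wt κ (n + 1)) :
    ∃ l C', ∀ n, |x n - l| ≤ C' * wt (κ - 1) n := by
  have hAW : BigW κ (PowerSeries.mk A) := ⟨C, fun n => by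
    rw [PowerSeries.coeff_mk, abs_of_nonneg (hpos n)]; exact hA n⟩
  have hB := wiener_tail hκ A A0 anti A1 hpos hAW
  have hc : PowerSeries.constantCoeff (PowerSeries.mk A) ≠ 0 := by
    rw [← PowerSeries.coeff_zero_eq_constantCoeff_apply, PowerSeries.coeff_mk, A0]; norm_num
  set dx : ℕ → ℝ := fun n => x n - (if n = 0 then 0 else x (n - 1)) with hdx
  set E := PowerSeries.mk dx * PowerSeries.mk A with hE
  have hE0 : ∀ n, PowerSeries.coeff (n + 1) E
      = x (n + 1) - ∑ j ∈ Finset.range (n + 1), (A j - A (j + 1)) * x (n - j) := by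
    intro n
    rw [hE, mul_comm, PowerSeries.coeff_mul, Finset.Nat.sum_antidiagonal_eq_sum_range_succ_mk]
    simp only [PowerSeries.coeff_mk, hdx]
    rw [Finset.sum_range_succ]
    simp only [Nat.sub_self, if_true, sub_zero]
    have e1 : ∑ k ∈ Finset.range (n + 1), A k * (x (n + 1 - k) -
        if n + 1 - k = 0 then 0 else x (n + 1 - k - 1)) =
        ∑ k ∈ Finset.range (n + 1), A k * x (n + 1 - k) -
        ∑ k ∈ Finset.range (n + 1), A k * x (n - k) := by
      rw [← Finset.sum_sub_distrib]
      apply Finset.sum_congr rfl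
      intro k hk
      rw [Finset.mem_range] at hk
      have h1 : n + 1 - k ≠ 0 := by omega
      have h2 : n + 1 - k - 1 = n - k := by omega
      rw [if_neg h1, h2]; ring
    rw [e1, Finset.sum_range_succ' (fun k => A k * x (n + 1 - k)) n]
    have e2 : ∑ j ∈ Finset.range (n + 1), (A j - A (j + 1)) * x (n - j)
        = ∑ j ∈ Finset.range (n + 1), A j * x (n - j)
          - ∑ j ∈ Finset.range (n + 1), A (j + 1) * x (n - j) := by
      rw [← Finset.sum_sub_distrib]
      exact Finset.sum_congr rfl (fun _ _ => by ring)
    rw [e2, Finset.sum_range_succ (fun j => A (j + 1) * x (n - j)) n]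
    simp only [Nat.sub_self, Nat.sub_zero, A0, one_mul, Nat.add_sub_add_right]
    ring
  have hEW : BigW κ E := by
    refine ⟨D, fun n => ?_⟩
    rcases n with _ | n
    · have : PowerSeries.coeff 0 E = x 0 := by
        rw [hE, PowerSeries.coeff_mul]; simp [hdx, A0]
      rw [this, wt_zero, mul_one]; exact hx0
    · rw [hE0 n]; exact hx n
  have hdxW : BigW κ (PowerSeries.mk dx) := by
    have : PowerSeries.mk dx = E * (PowerSeries.mk A)⁻¹ := by
      rw [hE, mul_assoc, PowerSeries.mul_inv_cancel _ hc, mul_one]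
    rw [this]; exact hEW.mul hκ hB
  obtain ⟨G, hG⟩ := hdxW
  simp only [PowerSeries.coeff_mk] at hG
  have hG0 : 0 ≤ G := by
    have := (abs_nonneg _).trans (hG 0)
    rw [wt_zero] at this; linarith
  have hstep : ∀ n, |x (n + 1) - x n| ≤ G * wt κ (n + 1) := by
    intro n; have := hG (n + 1); simpa [hdx] using this
  have hdist : ∀ N M, |x (N + M) - x N| ≤ G * ((κ - 1)⁻¹ * wt (κ - 1) N) := by
    intro N M
    have h1 : |x (N + M) - x N| ≤ ∑ i ∈ Finset.range M, G * wt κ (N + 1 + i) := by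
      induction M with
      | zero => simp
      | succ M ih =>
        rw [Finset.sum_range_succ]
        have h2 := hstep (N + M)
        have e : N + M + 1 = N + 1 + M := by ring
        have e' : N + (M + 1) = N + 1 + M := by ring
        rw [e] at h2
        rw [e']
        calc |x (N + 1 + M) - x N| = |(x (N + 1 + M) - x (N + M)) + (x (N + M) - x N)| := by
              congr 1; ring
          _ ≤ |x (N + 1 + M) - x (N + M)| + |x (N + M) - x N| := abs_add_le _ _
          _ ≤ _ := by linarith
    rw [← Finset.mul_sum] at h1
    exact h1.trans (mul_le_mul_of_nonneg_left (sum_wt_le hκ N M) hG0)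
  have hsum : Summable (fun n => x (n + 1) - x n) := by
    apply Summable.of_norm_bounded (g := fun n => G * wt κ (n + 1))
    · exact ((summable_nat_add_iff 1).2 (wt_summable hκ)).mul_left G
    · intro n; rw [Real.norm_eq_abs]; exact hstep n
  have hlim : Tendsto x atTop (nhds (∑' n, (x (n + 1) - x n) + x 0)) := by
    have h1 := hsum.hasSum.tendsto_sum_nat.add_const (x 0)
    refine h1.congr (fun n => ?_)
    rw [Finset.sum_range_sub]; ring
  refine ⟨∑' n, (x (n + 1) - x n) + x 0, G * (κ - 1)⁻¹, fun N => ?_⟩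
  have h2 : Tendsto (fun M => |x (N + M) - x N|) atTop
      (nhds |(∑' n, (x (n + 1) - x n) + x 0) - x N|) := by
    have h3 : Tendsto (fun M => x (N + M)) atTop (nhds (∑' n, (x (n + 1) - x n) + x 0)) := by
      have := (tendsto_add_atTop_iff_nat N).2 hlim
      refine this.congr (fun n => by rw [add_comm])
    exact (h3.sub_const _).abs
  rw [abs_sub_comm]
  have := le_of_tendsto' h2 (hdist N)
  linarith


lemma wt_mono {κ : ℝ} (hκ : 0 ≤ κ) {m n : ℕ} (h : m ≤ n) : wt κ n ≤ wt κ m := by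
  unfold wt
  apply Real.rpow_le_rpow_of_nonpos (by positivity) _ (by linarith)
  have : (m : ℝ) ≤ n := by exact_mod_cast h
  linarith

lemma rpow_neg_scale_le {κ a b q : ℝ} (hκ : 0 ≤ κ) (hb : 0 < b) (hq : 0 < q) (h : q * b ≤ a) :
    a ^ (-κ) ≤ q ^ (-κ) * b ^ (-κ) := by
  rw [← Real.mul_rpow hq.le hb.le]
  exact Real.rpow_le_rpow_of_nonpos (by positivity) h (by linarith)

lemma tail_rec {κ θ C : ℝ} (hκ : 0 < κ) (hθ0 : 0 < θ) (hθ1 : θ < 1) (hC : 0 ≤ C) :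
    ∃ C', 0 ≤ C' ∧ ∀ r : ℕ → ℝ, (∀ n, r n ≤ C) →
      (∀ n m, m ≤ n → r n ≤ (1 - θ) * r (n - m) + C * wt κ m) →
      ∀ n, r n ≤ C' * wt κ n := by
  set q : ℝ := ((1 - θ) / (1 - θ / 2)) ^ (1 / κ) with hq
  have hb0 : 0 < (1 - θ) / (1 - θ / 2) := div_pos (by linarith) (by linarith)
  have hb1 : (1 - θ) / (1 - θ / 2) < 1 := by rw [div_lt_one (by linarith)]; linarith
  have hq0 : 0 < q := Real.rpow_pos_of_pos hb0 _
  have hq1 : q < 1 := Real.rpow_lt_one hb0.le hb1 (by positivity)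
  have hqκ : (1 - θ) * q ^ (-κ) = 1 - θ / 2 := by
    rw [hq, ← Real.rpow_mul hb0.le]
    have : 1 / κ * -κ = -1 := by field_simp
    have h1 : 1 - θ ≠ 0 := by linarith
    have h2 : 1 - θ / 2 ≠ 0 := by linarith
    rw [this, Real.rpow_neg_one, inv_div]
    field_simp
  set w : ℝ := (1 - q) / 2 with hw
  have hw0 : 0 < w := by rw [hw]; linarith
  set E : ℝ := C * w ^ (-κ) with hE
  have hE0 : 0 ≤ E := mul_nonneg hC (by positivity)
  refine ⟨2 * E / θ, by positivity, fun r hr0 hr n => ?_⟩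
  have hCE : E ≤ 2 * E / θ := by
    rw [le_div_iff₀ hθ0]; nlinarith
  induction n using Nat.strong_induction_on with
  | _ n ih =>
    have hn0 : (0:ℝ) ≤ n := Nat.cast_nonneg n
    set m := ⌊(1 - q) * n⌋₊ with hm
    have hm1 : (m : ℝ) ≤ (1 - q) * n := Nat.floor_le (mul_nonneg (by linarith) hn0)
    have hm2 : (1 - q) * n < m + 1 := Nat.lt_floor_add_one _
    have hmn : m ≤ n := by
      have : (m : ℝ) ≤ n := by nlinarith
      exact_mod_cast this
    have hm0 : (0:ℝ) ≤ m := Nat.cast_nonneg m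
    have hwm : C * wt κ m ≤ E * wt κ n := by
      rw [hE, mul_assoc]
      apply mul_le_mul_of_nonneg_left _ hC
      unfold wt
      apply rpow_neg_scale_le hκ.le (by positivity) hw0
      rw [hw]; nlinarith
    rcases Nat.eq_zero_or_pos m with h0 | h0
    · rw [h0] at hwm
      rw [wt_zero, mul_one] at hwm
      calc r n ≤ C := hr0 n
        _ ≤ E * wt κ n := hwm
        _ ≤ _ := by have := wt_pos κ n; gcongr
    · have h1 := hr n m hmn
      have h2 := ih (n - m) (by omega)
      have h3 : wt κ (n - m) ≤ q ^ (-κ) * wt κ n := by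
        unfold wt
        apply rpow_neg_scale_le hκ.le (by positivity) hq0
        rw [Nat.cast_sub hmn]; nlinarith
      have hwn := wt_pos κ n
      calc r n ≤ (1 - θ) * r (n - m) + C * wt κ m := h1
        _ ≤ (1 - θ) * (2 * E / θ * (q ^ (-κ) * wt κ n)) + E * wt κ n := by
            have : r (n - m) ≤ 2 * E / θ * (q ^ (-κ) * wt κ n) :=
              h2.trans (by gcongr)
            have h5 : 0 ≤ 1 - θ := by linarith
            gcongr
        _ = ((1 - θ) * q ^ (-κ)) * (2 * E / θ) * wt κ n + E * wt κ n := by ring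
        _ = 2 * E / θ * wt κ n := by rw [hqκ]; field_simp; ring

lemma final_conv {b C D : ℝ} (hb : 0 ≤ b) (hC : 0 ≤ C) (hD : 0 ≤ D) (r : ℕ → ℝ)
    (anti : Antitone r) (hpos : ∀ n, 0 ≤ r n) (hr : ∀ n, r n ≤ C * wt b n) (n : ℕ) :
    ∑ j ∈ Finset.range n, (r j - r (j + 1)) * (D * wt b (n - j))
      ≤ 2 * C * D * 2 ^ b * wt b n := by
  set h := n / 2 with hh
  obtain ⟨l, hl⟩ : ∃ l, n = h + l := ⟨n - h, by omega⟩
  have hn1 : (0:ℝ) < (n : ℝ) + 1 := by positivity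
  have hsub : ∀ j, 0 ≤ r j - r (j + 1) := fun j => sub_nonneg.2 (anti (Nat.le_succ j))
  have hwn := wt_pos b n
  have p1 : ∑ j ∈ Finset.range h, (r j - r (j + 1)) * (D * wt b (n - j))
      ≤ C * D * 2 ^ b * wt b n := by
    have : ∀ j ∈ Finset.range h, (r j - r (j + 1)) * (D * wt b (n - j)) ≤
        (r j - r (j + 1)) * (D * (2 ^ b * wt b n)) := by
      intro j hj
      rw [Finset.mem_range] at hj
      apply mul_le_mul_of_nonneg_left _ (hsub j)
      apply mul_le_mul_of_nonneg_left _ hD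
      unfold wt
      apply rpow_neg_half_le hb hn1
      have : (n : ℝ) ≤ 2 * (n - j : ℕ) := by
        exact_mod_cast (by omega : n ≤ 2 * (n - j))
      linarith
    refine (Finset.sum_le_sum this).trans ?_
    rw [← Finset.sum_mul, Finset.sum_range_sub']
    have h0 : r 0 - r h ≤ C := by
      have := hr 0; rw [wt_zero] at this; have := hpos h; linarith
    calc _ ≤ C * (D * (2 ^ b * wt b n)) := by gcongr
      _ = _ := by ring
  have p2 : ∑ j ∈ Finset.range l, (r (h + j) - r (h + j + 1)) * (D * wt b (n - (h + j)))
      ≤ C * D * 2 ^ b * wt b n := by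
    have : ∀ j ∈ Finset.range l, (r (h + j) - r (h + j + 1)) * (D * wt b (n - (h + j))) ≤
        (r (h + j) - r (h + j + 1)) * D := by
      intro j hj
      apply mul_le_mul_of_nonneg_left _ (hsub _)
      have := wt_le_one hb (n - (h + j))
      nlinarith
    refine (Finset.sum_le_sum this).trans ?_
    rw [← Finset.sum_mul]
    have e := Finset.sum_range_sub' (fun j => r (h + j)) l
    simp only [← add_assoc] at e
    rw [e]
    have h0 : r (h + 0) - r (h + l) ≤ C * (2 ^ b * wt b n) := by
      have h1 := hr h
      have h2 := hpos (h + l)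
      have h3 : wt b h ≤ 2 ^ b * wt b n := by
        unfold wt
        apply rpow_neg_half_le hb hn1
        have : (n : ℝ) ≤ 2 * (h : ℕ) + 1 := by
          exact_mod_cast (by omega : n ≤ 2 * h + 1)
        linarith
      rw [add_zero]
      have := mul_le_mul_of_nonneg_left h3 hC
      linarith
    calc _ ≤ C * (2 ^ b * wt b n) * D := by gcongr
      _ = _ := by ring
  have e : ∑ j ∈ Finset.range n, (r j - r (j + 1)) * (D * wt b (n - j)) =
      ∑ j ∈ Finset.range h, (r j - r (j + 1)) * (D * wt b (n - j)) +
      ∑ j ∈ Finset.range l, (r (h + j) - r (h + j + 1)) * (D * wt b (n - (h + j))) := by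
    conv_lhs => rw [hl]
    rw [Finset.sum_range_add]
    rw [← hl]
  rw [e]
  linarith


/-! ### Part D: the inverse of the left branch -/

lemma lsvLeft_zero (γ : ℝ) : lsvLeft γ 0 = 0 := by simp [lsvLeft]

lemma lsvLeft_half (γ : ℝ) : lsvLeft γ (1 / 2) = 1 := by
  unfold lsvLeft
  rw [← Real.mul_rpow (by norm_num) (by norm_num)]
  norm_num

lemma lsvLeft_strictMonoOn {γ : ℝ} (hγ : 0 < γ) : StrictMonoOn (lsvLeft γ) (Ici 0) := by
  intro x hx y hy hxy
  have hx' : (0 : ℝ) ≤ x := hx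
  unfold lsvLeft
  have h1 : x ^ γ ≤ y ^ γ := Real.rpow_le_rpow hx' hxy.le hγ.le
  have h2 : (0 : ℝ) < 2 ^ γ := by positivity
  have h3 : (0 : ℝ) ≤ x ^ γ := by positivity
  have h4 : (2 : ℝ) ^ γ * x ^ γ ≤ 2 ^ γ * y ^ γ := by gcongr
  have h5 : (0 : ℝ) ≤ 2 ^ γ * x ^ γ := by positivity
  nlinarith

lemma lsvLeft_continuous {γ : ℝ} (hγ : 0 < γ) : Continuous (lsvLeft γ) := by
  unfold lsvLeft
  have := Real.continuous_rpow_const hγ.le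
  fun_prop

/-- The inverse of the left branch. -/
def gI (γ y : ℝ) : ℝ := sSup {x | x ∈ Icc (0 : ℝ) (1 / 2) ∧ lsvLeft γ x ≤ y}

lemma gI_bdd (γ y : ℝ) : BddAbove {x | x ∈ Icc (0 : ℝ) (1 / 2) ∧ lsvLeft γ x ≤ y} :=
  ⟨1 / 2, fun _ hx => hx.1.2⟩

lemma gI_nonneg (γ y : ℝ) : 0 ≤ gI γ y := Real.sSup_nonneg (fun _ hx => hx.1.1)

lemma gI_le_half (γ y : ℝ) : gI γ y ≤ 1 / 2 :=
  Real.sSup_le (fun _ hx => hx.1.2) (by norm_num)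

lemma gI_mono (γ : ℝ) : Monotone (gI γ) := by
  intro a b hab
  rcases Set.eq_empty_or_nonempty {x | x ∈ Icc (0 : ℝ) (1 / 2) ∧ lsvLeft γ x ≤ a} with h | h
  · have : gI γ a = 0 := by unfold gI; rw [h, Real.sSup_empty]
    rw [this]; exact gI_nonneg _ _
  · exact csSup_le_csSup (gI_bdd _ _) h (fun x hx => ⟨hx.1, hx.2.trans hab⟩)

lemma gI_measurable (γ : ℝ) : Measurable (gI γ) := (gI_mono γ).measurable

lemma gI_lsvLeft {γ : ℝ} (hγ : 0 < γ) {x : ℝ} (h0 : 0 ≤ x) (h1 : x ≤ 1 / 2) :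
    gI γ (lsvLeft γ x) = x := by
  apply IsGreatest.csSup_eq
  refine ⟨⟨⟨h0, h1⟩, le_rfl⟩, fun z hz => ?_⟩
  exact ((lsvLeft_strictMonoOn hγ).le_iff_le hz.1.1 h0).1 hz.2

lemma exists_left {γ : ℝ} (hγ : 0 < γ) {y : ℝ} (h0 : 0 ≤ y) (h1 : y ≤ 1) :
    ∃ x ∈ Icc (0 : ℝ) (1 / 2), lsvLeft γ x = y := by
  have := intermediate_value_Icc (a := (0 : ℝ)) (b := 1 / 2) (by norm_num)
    (lsvLeft_continuous hγ).continuousOn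
  rw [lsvLeft_zero, lsvLeft_half] at this
  exact this ⟨h0, h1⟩

lemma lsvLeft_gI {γ : ℝ} (hγ : 0 < γ) {y : ℝ} (h0 : 0 ≤ y) (h1 : y ≤ 1) :
    lsvLeft γ (gI γ y) = y := by
  obtain ⟨x, hx, rfl⟩ := exists_left hγ h0 h1
  rw [gI_lsvLeft hγ hx.1 hx.2]

lemma gI_pos {γ : ℝ} (hγ : 0 < γ) {y : ℝ} (h0 : 0 < y) (h1 : y ≤ 1) : 0 < gI γ y := by
  rcases (gI_nonneg γ y).lt_or_eq with h | h
  · exact h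
  · have := lsvLeft_gI hγ h0.le h1
    rw [← h, lsvLeft_zero] at this
    linarith

lemma gI_one {γ : ℝ} (hγ : 0 < γ) : gI γ 1 = 1 / 2 := by
  have h := gI_lsvLeft hγ (x := 1 / 2) (by norm_num) le_rfl
  rwa [lsvLeft_half] at h

/-- The Jacobian of the inverse branch. -/
def JI (γ y : ℝ) : ℝ := 1 / (1 + (1 + γ) * (2 ^ γ * (gI γ y) ^ γ))

lemma JI_measurable (γ : ℝ) : Measurable (JI γ) := by
  unfold JI
  have := gI_measurable γ
  fun_prop

lemma JI_nonneg {γ : ℝ} (hγ : 0 < γ) (y : ℝ) : 0 ≤ JI γ y := by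
  have := gI_nonneg γ y
  unfold JI; positivity

lemma JI_le_one {γ : ℝ} (hγ : 0 < γ) (y : ℝ) : JI γ y ≤ 1 := by
  have := gI_nonneg γ y
  unfold JI
  rw [div_le_one (by positivity)]
  have : 0 ≤ (1 + γ) * (2 ^ γ * (gI γ y) ^ γ) := by positivity
  linarith

lemma gI_le_self {γ : ℝ} (hγ : 0 < γ) {y : ℝ} (h0 : 0 ≤ y) (h1 : y ≤ 1) : gI γ y ≤ y := by
  have h := lsvLeft_gI hγ h0 h1
  have h2 := gI_nonneg γ y
  unfold lsvLeft at h
  have : 0 ≤ gI γ y * (2 ^ γ * (gI γ y) ^ γ) := by positivity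
  nlinarith

lemma gI_sub_le {γ : ℝ} (hγ : 0 < γ) {x y : ℝ} (h0 : 0 ≤ x) (hxy : x ≤ y) (h1 : y ≤ 1) :
    gI γ y - gI γ x ≤ y - x := by
  have hx := lsvLeft_gI hγ h0 (hxy.trans h1)
  have hy := lsvLeft_gI hγ (h0.trans hxy) h1
  have h2 := gI_nonneg γ x
  have h3 := gI_mono γ hxy
  have h4 : (gI γ x) ^ γ ≤ (gI γ y) ^ γ := Real.rpow_le_rpow h2 h3 hγ.le
  unfold lsvLeft at hx hy
  have h5 : gI γ x * (2 ^ γ * (gI γ x) ^ γ) ≤ gI γ y * (2 ^ γ * (gI γ y) ^ γ) := by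
    have h6 : 0 ≤ gI γ y := gI_nonneg γ y
    gcongr
  nlinarith

lemma JI_anti {γ : ℝ} (hγ : 0 < γ) : Antitone (JI γ) := by
  intro x y hxy
  have h2 := gI_nonneg γ x
  have h3 := gI_mono γ hxy
  have h4 : (gI γ x) ^ γ ≤ (gI γ y) ^ γ := Real.rpow_le_rpow h2 h3 hγ.le
  unfold JI
  gcongr

lemma JI_dist {γ : ℝ} (hγ : 0 < γ) (hγ1 : γ ≤ 1) {x y : ℝ} (h0 : 0 < x) (hxy : x ≤ y)
    (h1 : y ≤ 1) : (gI γ y / gI γ x) ^ 2 * JI γ x ≤ (y / x) ^ 2 * JI γ y := by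
  have hx := lsvLeft_gI hγ h0.le (hxy.trans h1)
  have hy := lsvLeft_gI hγ (h0.le.trans hxy) h1
  have h2 := gI_pos hγ h0 (hxy.trans h1)
  have h2' := gI_pos hγ (h0.trans_le hxy) h1
  have h3 := gI_mono γ hxy
  have h4 : (gI γ x) ^ γ ≤ (gI γ y) ^ γ := Real.rpow_le_rpow h2.le h3 hγ.le
  have h5 : (2 : ℝ) ^ γ * (gI γ x) ^ γ ≤ 2 ^ γ * (gI γ y) ^ γ := by gcongr
  have h6 : 0 < (2 : ℝ) ^ γ * (gI γ x) ^ γ := by positivity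
  have e1 : y / x = (gI γ y * (1 + 2 ^ γ * (gI γ y) ^ γ)) / (gI γ x * (1 + 2 ^ γ * (gI γ x) ^ γ)) := by
    unfold lsvLeft at hx hy
    rw [hx, hy]
  rw [e1]
  unfold JI
  generalize (2 : ℝ) ^ γ * (gI γ x) ^ γ = a at *
  generalize (2 : ℝ) ^ γ * (gI γ y) ^ γ = b at *
  have hb : 0 < b := h6.trans_le h5
  have key : (1 + a) ^ 2 * (1 + (1 + γ) * b) ≤ (1 + b) ^ 2 * (1 + (1 + γ) * a) := by
    have : (1 + b) ^ 2 * (1 + (1 + γ) * a) - (1 + a) ^ 2 * (1 + (1 + γ) * b)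
      = (b - a) * (2 + a + b - (1 + γ) + (1 + γ) * (a * b)) := by ring
    have h7 : 0 ≤ (b - a) * (2 + a + b - (1 + γ) + (1 + γ) * (a * b)) := by
      apply mul_nonneg (by linarith)
      have : 0 ≤ (1 + γ) * (a * b) := by positivity
      linarith
    linarith
  have key2 : 1 / (1 + (1 + γ) * a) ≤ ((1 + b) / (1 + a)) ^ 2 * (1 / (1 + (1 + γ) * b)) := by
    rw [div_pow, div_mul_div_comm, div_le_div_iff₀ (by positivity) (by positivity)]
    linarith
  calc _ ≤ _ := mul_le_mul_of_nonneg_left key2 (sq_nonneg (gI γ y / gI γ x))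
    _ = _ := by rw [mul_div_mul_comm]; ring

lemma lsvLeft_hasDeriv {γ : ℝ} {x : ℝ} (hx : 0 < x) :
    HasDerivAt (lsvLeft γ) (1 + (1 + γ) * (2 ^ γ * x ^ γ)) x := by
  have h1 : HasDerivAt (fun x : ℝ => x ^ γ) (γ * x ^ (γ - 1)) x :=
    Real.hasDerivAt_rpow_const (Or.inl hx.ne')
  have h2 := (hasDerivAt_id x).mul ((h1.const_mul ((2 : ℝ) ^ γ)).const_add 1)
  have h3 : HasDerivAt (lsvLeft γ) (1 * (1 + 2 ^ γ * x ^ γ) + x * (2 ^ γ * (γ * x ^ (γ - 1)))) x :=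
    h2
  convert h3 using 1
  have : x ^ γ = x * x ^ (γ - 1) := by
    rw [Real.rpow_sub_one hx.ne']; field_simp
  rw [this]; ring

lemma lsvLeft_image {γ : ℝ} (hγ : 0 < γ) {y : ℝ} (h0 : 0 < y) (h1 : y ≤ 1) :
    Set.image (lsvLeft γ) (Ioc 0 (gI γ y)) = Ioc 0 y := by
  ext t
  constructor
  · rintro ⟨x, hx, rfl⟩
    constructor
    · rw [← lsvLeft_zero γ]
      exact lsvLeft_strictMonoOn hγ (by simp) hx.1.le hx.1
    · rw [← lsvLeft_gI hγ h0.le h1]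
      exact (lsvLeft_strictMonoOn hγ).monotoneOn hx.1.le (gI_nonneg _ _) hx.2
  · intro ht
    exact ⟨gI γ t, ⟨gI_pos hγ ht.1 (ht.2.trans h1), gI_mono γ ht.2⟩,
      lsvLeft_gI hγ ht.1.le (ht.2.trans h1)⟩

lemma left_change {γ : ℝ} (hγ : 0 < γ) (F : ℝ → ℝ) {y : ℝ} (h0 : 0 < y) (h1 : y ≤ 1) :
    ∫ t in Ioc 0 y, JI γ t * F (gI γ t) = ∫ x in Ioc 0 (gI γ y), F x := by
  rw [← lsvLeft_image hγ h0 h1]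
  rw [integral_image_eq_integral_abs_deriv_smul measurableSet_Ioc
    (f' := fun x => 1 + (1 + γ) * (2 ^ γ * x ^ γ))]
  · apply setIntegral_congr_fun measurableSet_Ioc
    intro x hx
    have hx' : gI γ (lsvLeft γ x) = x := gI_lsvLeft hγ hx.1.le (hx.2.trans (gI_le_half _ _))
    have hx0 : 0 < x := hx.1
    have hp : 0 < 1 + (1 + γ) * ((2 : ℝ) ^ γ * x ^ γ) := by positivity
    simp only [JI, hx', smul_eq_mul, abs_of_pos hp]
    field_simp
  · intro x hx
    exact (lsvLeft_hasDeriv hx.1).hasDerivWithinAt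
  · exact (lsvLeft_strictMonoOn hγ).injOn.mono (fun x hx => hx.1.le)

lemma gI_neg_pow {γ : ℝ} (hγ : 0 < γ) (hγ1 : γ ≤ 1) {y : ℝ} (h0 : 0 < y) (h1 : y ≤ 1) :
    y ^ (-γ) + γ / 3 ≤ (gI γ y) ^ (-γ) := by
  have hg := gI_pos hγ h0 h1
  have hh := gI_le_half γ y
  have hy := lsvLeft_gI hγ h0.le h1
  set x := gI γ y with hx
  unfold lsvLeft at hy
  set u := (2 : ℝ) ^ γ * x ^ γ with hu
  have hu0 : 0 < u := by positivity
  have hu1 : u ≤ 1 := by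
    rw [hu, ← Real.mul_rpow (by norm_num) hg.le]
    exact Real.rpow_le_one (by positivity) (by linarith) hγ.le
  have hxx : x ^ (-γ) * u = 2 ^ γ := by
    rw [hu, mul_left_comm, ← Real.rpow_add hg]; simp
  have h2 : (1 : ℝ) ≤ 2 ^ γ := Real.one_le_rpow (by norm_num) hγ.le
  have hlog : u / 2 ≤ Real.log (1 + u) := by
    have h3 := Real.one_sub_inv_le_log_of_pos (x := 1 + u) (by positivity)
    have h4 : u / 2 ≤ 1 - (1 + u)⁻¹ := by
      have : 1 - (1 + u)⁻¹ = u / (1 + u) := by field_simp; ring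
      rw [this]
      gcongr
      linarith
    linarith
  have hexp : (1 + u) ^ (-γ) ≤ 1 - γ * u / 3 := by
    rw [Real.rpow_def_of_pos (by positivity)]
    have h5 : Real.exp (Real.log (1 + u) * -γ) ≤ Real.exp (-(γ * u / 2)) := by
      apply Real.exp_le_exp.2
      nlinarith
    refine h5.trans ?_
    rw [Real.exp_neg]
    have h6 := Real.add_one_le_exp (γ * u / 2)
    have h7 : (Real.exp (γ * u / 2))⁻¹ ≤ (γ * u / 2 + 1)⁻¹ := by
      gcongr
    refine h7.trans ?_
    have h8 : γ * u ≤ 1 := by nlinarith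
    have h9 : 0 < γ * u := by positivity
    rw [inv_le_iff_one_le_mul₀ (by positivity)]
    nlinarith
  have e : y ^ (-γ) = x ^ (-γ) * (1 + u) ^ (-γ) := by
    rw [← hy, Real.mul_rpow hg.le (by positivity)]
  rw [e]
  have hxp : 0 < x ^ (-γ) := by positivity
  have := mul_le_mul_of_nonneg_left hexp hxp.le
  nlinarith


/-! ### Part E: transfer operators -/

/-- The parameters of the skew product. -/
structure Par where
  α : ℝ
  β : ℝ
  p₁ : ℝ
  p₂ : ℝ
  hα : 0 < α
  hαβ : α < β
  hβ : β ≤ 1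
  hp₁ : 0 < p₁
  hp₂ : 0 < p₂
  hp : p₁ + p₂ = 1

lemma Par.hβ0 (P : Par) : 0 < P.β := P.hα.trans P.hαβ
lemma Par.hα1 (P : Par) : P.α < 1 := P.hαβ.trans_le P.hβ

/-- The skew product with bundled parameters. -/
def SS (P : Par) : ℝ × ℝ → ℝ × ℝ := skew P.α P.β P.p₁ P.p₂

/-- The domain. -/
def Dm : Set (ℝ × ℝ) := Ioc (0 : ℝ) 1 ×ˢ Ico (0 : ℝ) 1

/-- The reference measure. -/
def mm : Measure (ℝ × ℝ) := volume.restrict Dm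

lemma Dm_meas : MeasurableSet Dm := measurableSet_Ioc.prod measurableSet_Ico

lemma mm_eq : mm = (volume.restrict (Ioc (0 : ℝ) 1)).prod (volume.restrict (Ico (0 : ℝ) 1)) := by
  unfold mm Dm
  rw [Measure.volume_eq_prod, Measure.prod_restrict]

instance : IsProbabilityMeasure (volume.restrict (Ioc (0 : ℝ) 1)) := ⟨by simp⟩
instance : IsProbabilityMeasure (volume.restrict (Ico (0 : ℝ) 1)) := ⟨by simp⟩
instance mm_prob : IsProbabilityMeasure mm := by rw [mm_eq]; infer_instance

/-- Bounded measurable functions. -/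
def BM {X : Type*} [MeasurableSpace X] (f : X → ℝ) : Prop := Measurable f ∧ ∃ M : ℝ, ∀ z, |f z| ≤ M

section BMlemmas
variable {X Y : Type*} [MeasurableSpace X] [MeasurableSpace Y]

lemma BM.integrable {f : X → ℝ} (hf : BM f) (μ : Measure X) [IsFiniteMeasure μ] : Integrable f μ := by
  obtain ⟨h, M, hM⟩ := hf
  exact Integrable.of_bound h.aestronglyMeasurable M (Eventually.of_forall hM)

lemma BM.const (c : ℝ) : BM (fun _ : X => c) := ⟨measurable_const, |c|, fun _ => le_rfl⟩

lemma BM.add {f g : X → ℝ} (hf : BM f) (hg : BM g) : BM (fun z => f z + g z) := by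
  obtain ⟨h, M, hM⟩ := hf
  obtain ⟨h', M', hM'⟩ := hg
  exact ⟨h.add h', M + M', fun z => (abs_add_le _ _).trans (add_le_add (hM z) (hM' z))⟩

lemma BM.mul {f g : X → ℝ} (hf : BM f) (hg : BM g) : BM (fun z => f z * g z) := by
  obtain ⟨h, M, hM⟩ := hf
  obtain ⟨h', M', hM'⟩ := hg
  refine ⟨h.mul h', M * M', fun z => ?_⟩
  rw [abs_mul]
  exact mul_le_mul (hM z) (hM' z) (abs_nonneg _) ((abs_nonneg _).trans (hM z))

lemma BM.const_mul {f : X → ℝ} (hf : BM f) (c : ℝ) : BM (fun z => c * f z) := (BM.const c).mul hf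

lemma BM.sub {f g : X → ℝ} (hf : BM f) (hg : BM g) : BM (fun z => f z - g z) := by
  have := hf.add (hg.const_mul (-1))
  refine ⟨hf.1.sub hg.1, ?_⟩
  obtain ⟨M, hM⟩ := this.2
  exact ⟨M, fun z => by
    have := hM z
    simp only [neg_one_mul, ← sub_eq_add_neg] at this
    exact this⟩

lemma BM.comp {f : Y → ℝ} (hf : BM f) {t : X → Y} (ht : Measurable t) : BM (fun z => f (t z)) :=
  ⟨hf.1.comp ht, hf.2.imp (fun _ h _ => h _)⟩

lemma BM.indicator {f : X → ℝ} (hf : BM f) {s : Set X} (hs : MeasurableSet s) :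
    BM (s.indicator f) := by
  obtain ⟨h, M, hM⟩ := hf
  refine ⟨h.indicator hs, M, fun z => ?_⟩
  by_cases hz : z ∈ s
  · rw [indicator_of_mem hz]; exact hM z
  · rw [indicator_of_notMem hz, abs_zero]; exact (abs_nonneg _).trans (hM z)
end BMlemmas

lemma JI_BM {γ : ℝ} (hγ : 0 < γ) : BM (JI γ) :=
  ⟨JI_measurable γ, 1, fun z => by rw [abs_of_nonneg (JI_nonneg hγ z)]; exact JI_le_one hγ z⟩

/-- Left part of the transfer operator. -/
def opL (P : Par) (f : ℝ × ℝ → ℝ) (z : ℝ × ℝ) : ℝ :=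
  P.p₁ * (JI P.α z.1 * f (gI P.α z.1, P.p₁ * z.2)) +
  P.p₂ * (JI P.β z.1 * f (gI P.β z.1, P.p₁ + P.p₂ * z.2))

/-- Right part of the transfer operator. -/
def opR (P : Par) (f : ℝ × ℝ → ℝ) (z : ℝ × ℝ) : ℝ :=
  P.p₁ * (f ((z.1 + 1) / 2, P.p₁ * z.2) / 2) +
  P.p₂ * (f ((z.1 + 1) / 2, P.p₁ + P.p₂ * z.2) / 2)

/-- The transfer operator. -/
def opP (P : Par) (f : ℝ × ℝ → ℝ) (z : ℝ × ℝ) : ℝ := opL P f z + opR P f z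

lemma opL_BM (P : Par) {f : ℝ × ℝ → ℝ} (hf : BM f) : BM (opL P f) := by
  have m1 : Measurable (fun z : ℝ × ℝ => (gI P.α z.1, P.p₁ * z.2)) := by
    have := gI_measurable P.α; fun_prop
  have m2 : Measurable (fun z : ℝ × ℝ => (gI P.β z.1, P.p₁ + P.p₂ * z.2)) := by
    have := gI_measurable P.β; fun_prop
  exact ((((JI_BM P.hα).comp measurable_fst).mul (hf.comp m1)).const_mul _).add
    ((((JI_BM P.hβ0).comp measurable_fst).mul (hf.comp m2)).const_mul _)

lemma opR_BM (P : Par) {f : ℝ × ℝ → ℝ} (hf : BM f) : BM (opR P f) := by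
  have m1 : Measurable (fun z : ℝ × ℝ => ((z.1 + 1) / 2, P.p₁ * z.2)) := by fun_prop
  have m2 : Measurable (fun z : ℝ × ℝ => ((z.1 + 1) / 2, P.p₁ + P.p₂ * z.2)) := by fun_prop
  exact ((((hf.comp m1).mul (BM.const 2⁻¹))).const_mul _).add
    ((((hf.comp m2).mul (BM.const 2⁻¹))).const_mul _)

lemma opP_BM (P : Par) {f : ℝ × ℝ → ℝ} (hf : BM f) : BM (opP P f) :=
  (opL_BM P hf).add (opR_BM P hf)

lemma lsv_measurable (γ : ℝ) : Measurable (lsv γ) := by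
  unfold lsv
  apply Measurable.ite (measurableSet_le measurable_id measurable_const)
  · fun_prop
  · fun_prop

lemma phiMap_measurable (a b : ℝ) : Measurable (phiMap a b) := by
  unfold phiMap
  apply Measurable.ite (measurableSet_lt measurable_id measurable_const)
  · fun_prop
  · fun_prop

lemma SS_measurable (P : Par) : Measurable (SS P) := by
  have h1 := phiMap_measurable P.p₁ P.p₂
  have h2 : SS P = fun z : ℝ × ℝ => (if z.2 < P.p₁ then lsv P.α z.1 else lsv P.β z.1, phiMap P.p₁ P.p₂ z.2) := by
    funext z
    simp only [SS, skew, sel]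
    split_ifs <;> rfl
  rw [h2]
  refine Measurable.prodMk ?_ (h1.comp measurable_snd)
  exact Measurable.ite (measurableSet_lt measurable_snd measurable_const)
    ((lsv_measurable _).comp measurable_fst) ((lsv_measurable _).comp measurable_fst)

lemma integral_mm {f : ℝ × ℝ → ℝ} (hf : BM f) :
    ∫ z, f z ∂mm = ∫ ω in Ico (0 : ℝ) 1, ∫ x in Ioc (0 : ℝ) 1, f (x, ω) := by
  have := hf.integrable mm
  rw [mm_eq] at this ⊢
  rw [integral_prod_symm _ this]

lemma BM_inner {f : ℝ × ℝ → ℝ} (hf : BM f) : BM (fun ω => ∫ x in Ioc (0 : ℝ) 1, f (x, ω)) := by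
  constructor
  · have := (hf.1.comp measurable_swap).stronglyMeasurable.integral_prod_right'
      (ν := volume.restrict (Ioc (0 : ℝ) 1))
    exact this.measurable
  · obtain ⟨M, hM⟩ := hf.2
    refine ⟨M, fun ω => ?_⟩
    have := norm_integral_le_of_norm_le_const (μ := volume.restrict (Ioc (0 : ℝ) 1))
      (f := fun x => f (x, ω)) (C := M) (Eventually.of_forall (fun x => hM _))
    simpa using this

lemma integral_affine_Ioc (F : ℝ → ℝ) {a b c d : ℝ} (hc : 0 < c) (hab : a ≤ b) :
    ∫ x in Ioc a b, F (c * x + d) = c⁻¹ * ∫ x in Ioc (c * a + d) (c * b + d), F x := by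
  rw [← intervalIntegral.integral_of_le hab, ← intervalIntegral.integral_of_le (by gcongr),
    intervalIntegral.integral_comp_mul_add _ hc.ne', smul_eq_mul]

lemma bernoulli_int (P : Par) {F : ℝ → ℝ} (hF : BM F) :
    ∫ ω in Ico (0 : ℝ) 1, F ω = P.p₁ * (∫ ω in Ico (0 : ℝ) 1, F (P.p₁ * ω)) +
      P.p₂ * ∫ ω in Ico (0 : ℝ) 1, F (P.p₁ + P.p₂ * ω) := by
  simp only [integral_Ico_eq_integral_Ioc]
  have h1 := integral_affine_Ioc F (a := 0) (b := 1) (d := 0) P.hp₁ zero_le_one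
  have h2 := integral_affine_Ioc F (a := 0) (b := 1) (d := P.p₁) P.hp₂ zero_le_one
  simp only [mul_zero, mul_one, add_zero, zero_add, add_comm P.p₂ P.p₁, P.hp] at h1 h2
  simp only [add_comm P.p₁ (P.p₂ * _)]
  rw [h1, h2, mul_inv_cancel_left₀ P.hp₁.ne', mul_inv_cancel_left₀ P.hp₂.ne']
  rw [← Ioc_union_Ioc_eq_Ioc (a := (0 : ℝ)) (b := P.p₁) (c := 1) P.hp₁.le
    (by linarith [P.hp₂, P.hp])]
  rw [setIntegral_union (Ioc_disjoint_Ioc_of_le le_rfl) measurableSet_Ioc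
    (hF.integrable _) (hF.integrable _)]

lemma lsv_dual {γ : ℝ} (hγ : 0 < γ) {u F : ℝ → ℝ} (hu : BM u) (hF : BM F) :
    ∫ x in Ioc (0 : ℝ) 1, u (lsv γ x) * F x =
      ∫ t in Ioc (0 : ℝ) 1, u t * (JI γ t * F (gI γ t) + F ((t + 1) / 2) / 2) := by
  have hbm : BM (fun x => u (lsv γ x) * F x) := (hu.comp (lsv_measurable γ)).mul hF
  rw [← Ioc_union_Ioc_eq_Ioc (a := (0 : ℝ)) (b := 1 / 2) (c := 1) (by norm_num) (by norm_num)]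
  rw [setIntegral_union (Ioc_disjoint_Ioc_of_le le_rfl) measurableSet_Ioc
    (hbm.integrable _) (hbm.integrable _)]
  rw [Ioc_union_Ioc_eq_Ioc (by norm_num) (by norm_num)]
  have e1 : ∫ x in Ioc (0 : ℝ) (1 / 2), u (lsv γ x) * F x =
      ∫ t in Ioc (0 : ℝ) 1, JI γ t * (u t * F (gI γ t)) := by
    have h := left_change hγ (fun x => u (lsv γ x) * F x) (y := 1) one_pos le_rfl
    rw [gI_one hγ] at h
    rw [← h]
    apply setIntegral_congr_fun measurableSet_Ioc
    intro t ht
    have h1 : lsv γ (gI γ t) = t := by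
      have : lsv γ (gI γ t) = lsvLeft γ (gI γ t) := by
        simp only [lsv, lsvLeft]; rw [if_pos (gI_le_half γ t)]
      rw [this, lsvLeft_gI hγ ht.1.le ht.2]
    simp only [h1]
  have e2 : ∫ x in Ioc (1 / 2 : ℝ) 1, u (lsv γ x) * F x =
      ∫ t in Ioc (0 : ℝ) 1, u t * (F ((t + 1) / 2) / 2) := by
    have h := integral_affine_Ioc (fun x => u (lsv γ x) * F x) (a := 0) (b := 1) (c := 1 / 2)
      (d := 1 / 2) (by norm_num) (by norm_num)
    norm_num at h
    have h' : ∫ x in Ioc (1 / 2 : ℝ) 1, u (lsv γ x) * F x =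
      (1 / 2) * ∫ (x : ℝ) in Ioc 0 1, u (lsv γ (1 / 2 * x + 1 / 2)) * F (1 / 2 * x + 1 / 2) := by
      rw [h]; ring
    rw [h', ← integral_const_mul]
    apply setIntegral_congr_fun measurableSet_Ioc
    intro t ht
    have h1 : lsv γ (1 / 2 * t + 1 / 2) = t := by
      simp only [lsv]; rw [if_neg (by have := ht.1; linarith)]; ring
    have h2 : 1 / 2 * t + 1 / 2 = (t + 1) / 2 := by ring
    simp only [h1]
    rw [h2]
    ring
  rw [e1, e2, ← integral_add]
  · apply integral_congr_ae
    refine Eventually.of_forall (fun t => ?_)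
    simp only
    ring
  · exact ((JI_BM hγ).mul (hu.mul (hF.comp (gI_measurable γ)))).integrable _
  · exact (hu.mul ((hF.comp (t := fun t : ℝ => (t + 1) / 2) (by fun_prop)).mul
      (BM.const 2⁻¹))).integrable _

lemma duality (P : Par) {u f : ℝ × ℝ → ℝ} (hu : BM u) (hf : BM f) :
    ∫ z, u (SS P z) * f z ∂mm = ∫ z, u z * opP P f z ∂mm := by
  have h1 : BM (fun z => u (SS P z) * f z) := (hu.comp (SS_measurable P)).mul hf
  have h2 : BM (fun z => u z * opP P f z) := hu.mul (opP_BM P hf)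
  rw [integral_mm h1, integral_mm h2, bernoulli_int P (BM_inner h1)]
  have k1 : ∀ ω ∈ Ico (0 : ℝ) 1, ∫ x in Ioc (0 : ℝ) 1, u (SS P (x, P.p₁ * ω)) * f (x, P.p₁ * ω)
      = ∫ t in Ioc (0 : ℝ) 1, u (t, ω) * (JI P.α t * f (gI P.α t, P.p₁ * ω) +
        f ((t + 1) / 2, P.p₁ * ω) / 2) := by
    intro ω hω
    have hlt : P.p₁ * ω < P.p₁ := by nlinarith [P.hp₁, hω.2]
    have : ∀ x, SS P (x, P.p₁ * ω) = (lsv P.α x, ω) := by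
      intro x
      simp only [SS, skew, sel, phiMap, if_pos hlt]
      rw [mul_div_cancel_left₀ _ P.hp₁.ne']
    simp only [this]
    exact lsv_dual P.hα (u := fun t => u (t, ω)) (F := fun x => f (x, P.p₁ * ω))
      (hu.comp measurable_prodMk_right) (hf.comp measurable_prodMk_right)
  have k2 : ∀ ω ∈ Ico (0 : ℝ) 1, ∫ x in Ioc (0 : ℝ) 1,
      u (SS P (x, P.p₁ + P.p₂ * ω)) * f (x, P.p₁ + P.p₂ * ω)
      = ∫ t in Ioc (0 : ℝ) 1, u (t, ω) * (JI P.β t * f (gI P.β t, P.p₁ + P.p₂ * ω) +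
        f ((t + 1) / 2, P.p₁ + P.p₂ * ω) / 2) := by
    intro ω hω
    have hlt : ¬ (P.p₁ + P.p₂ * ω < P.p₁) := by
      have := mul_nonneg P.hp₂.le hω.1
      linarith
    have : ∀ x, SS P (x, P.p₁ + P.p₂ * ω) = (lsv P.β x, ω) := by
      intro x
      simp only [SS, skew, sel, phiMap, if_neg hlt]
      rw [add_sub_cancel_left, mul_div_cancel_left₀ _ P.hp₂.ne']
    simp only [this]
    exact lsv_dual P.hβ0 (u := fun t => u (t, ω)) (F := fun x => f (x, P.p₁ + P.p₂ * ω))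
      (hu.comp measurable_prodMk_right) (hf.comp measurable_prodMk_right)
  rw [setIntegral_congr_fun measurableSet_Ico k1, setIntegral_congr_fun measurableSet_Ico k2]
  have b1 : BM (fun z : ℝ × ℝ => u z * (JI P.α z.1 * f (gI P.α z.1, P.p₁ * z.2) +
        f ((z.1 + 1) / 2, P.p₁ * z.2) / 2)) := by
    have m1 : Measurable (fun z : ℝ × ℝ => (gI P.α z.1, P.p₁ * z.2)) := by
      have := gI_measurable P.α; fun_prop
    have m2 : Measurable (fun z : ℝ × ℝ => ((z.1 + 1) / 2, P.p₁ * z.2)) := by fun_prop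
    exact hu.mul ((((JI_BM P.hα).comp measurable_fst).mul (hf.comp m1)).add
      ((hf.comp m2).mul (BM.const 2⁻¹)))
  have b2 : BM (fun z : ℝ × ℝ => u z * (JI P.β z.1 * f (gI P.β z.1, P.p₁ + P.p₂ * z.2) +
        f ((z.1 + 1) / 2, P.p₁ + P.p₂ * z.2) / 2)) := by
    have m1 : Measurable (fun z : ℝ × ℝ => (gI P.β z.1, P.p₁ + P.p₂ * z.2)) := by
      have := gI_measurable P.β; fun_prop
    have m2 : Measurable (fun z : ℝ × ℝ => ((z.1 + 1) / 2, P.p₁ + P.p₂ * z.2)) := by fun_prop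
    exact hu.mul ((((JI_BM P.hβ0).comp measurable_fst).mul (hf.comp m1)).add
      ((hf.comp m2).mul (BM.const 2⁻¹)))
  rw [← integral_const_mul, ← integral_const_mul, ← integral_add
    (((BM_inner b1).const_mul _).integrable _) (((BM_inner b2).const_mul _).integrable _)]
  apply integral_congr_ae
  refine Eventually.of_forall (fun ω => ?_)
  simp only
  rw [← integral_const_mul, ← integral_const_mul, ← integral_add]
  · apply integral_congr_ae
    refine Eventually.of_forall (fun t => ?_)
    simp only [opP, opL, opR]
    ring
  · exact ((b1.comp (t := fun x : ℝ => (x, ω)) measurable_prodMk_right).const_mul _).integrable _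
  · exact ((b2.comp (t := fun x : ℝ => (x, ω)) measurable_prodMk_right).const_mul _).integrable _

lemma duality_iter (P : Par) {u f : ℝ × ℝ → ℝ} (hu : BM u) (hf : BM f) (n : ℕ) :
    ∫ z, u ((SS P)^[n] z) * f z ∂mm = ∫ z, u z * (opP P)^[n] f z ∂mm := by
  induction n generalizing f with
  | zero => rfl
  | succ n ih =>
    have h := duality P (u := fun z => u ((SS P)^[n] z))
      (hu.comp ((SS_measurable P).iterate n)) hf
    simp only [Function.iterate_succ, Function.comp]
    rw [h, ih (opP_BM P hf)]

lemma opP_int (P : Par) {f : ℝ × ℝ → ℝ} (hf : BM f) : ∫ z, opP P f z ∂mm = ∫ z, f z ∂mm := by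
  have := duality P (u := fun _ => 1) (BM.const 1) hf
  simpa using this.symm

/-- The right half. -/
def Yh : Set (ℝ × ℝ) := {z | 1 / 2 < z.1}

lemma Yh_meas : MeasurableSet Yh := measurableSet_lt measurable_const measurable_fst

lemma int_congr_Dm {f g : ℝ × ℝ → ℝ} (h : ∀ z ∈ Dm, f z = g z) : ∫ z, f z ∂mm = ∫ z, g z ∂mm :=
  setIntegral_congr_fun Dm_meas h

lemma int_mono_Dm {f g : ℝ × ℝ → ℝ} (hf : BM f) (hg : BM g) (h : ∀ z ∈ Dm, f z ≤ g z) :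
    ∫ z, f z ∂mm ≤ ∫ z, g z ∂mm :=
  setIntegral_mono_on (hf.integrable mm) (hg.integrable mm) Dm_meas h

lemma opL_int (P : Par) {f : ℝ × ℝ → ℝ} (hf : BM f) :
    ∫ z, opL P f z ∂mm = ∫ z, Yhᶜ.indicator f z ∂mm := by
  rw [← opP_int P (hf.indicator Yh_meas.compl)]
  apply int_congr_Dm
  intro z hz
  have hz1 : 0 < z.1 := hz.1.1
  have a1 : ∀ γ w, (gI γ z.1, w) ∈ Yhᶜ := fun γ w => by
    have := gI_le_half γ z.1
    simp only [Yh, mem_compl_iff, mem_ofPred_eq, not_lt]; exact this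
  have a2 : ∀ w : ℝ, ((z.1 + 1) / 2, w) ∉ Yhᶜ := fun w => by
    simp only [Yh, mem_compl_iff, mem_ofPred_eq, not_not]; linarith
  simp only [opP, opL, opR, indicator_of_mem (a1 _ _), indicator_of_notMem (a2 _)]
  ring

lemma opR_int (P : Par) {f : ℝ × ℝ → ℝ} (hf : BM f) :
    ∫ z, opR P f z ∂mm = ∫ z, Yh.indicator f z ∂mm := by
  rw [← opP_int P (hf.indicator Yh_meas)]
  apply int_congr_Dm
  intro z hz
  have hz1 : 0 < z.1 := hz.1.1
  have a1 : ∀ γ w, (gI γ z.1, w) ∉ Yh := fun γ w => by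
    have := gI_le_half γ z.1
    simp only [Yh, mem_ofPred_eq, not_lt]; exact this
  have a2 : ∀ w : ℝ, ((z.1 + 1) / 2, w) ∈ Yh := fun w => by
    simp only [Yh, mem_ofPred_eq]; linarith
  simp only [opP, opL, opR, indicator_of_notMem (a1 _ _), indicator_of_mem (a2 _)]
  ring


/-! ### Part F: tails of the left excursions -/

/-- The one dimensional densities `L^k 1`. -/
def lk (P : Par) : ℕ → ℝ → ℝ
  | 0, _ => 1
  | k + 1, x => P.p₁ * (JI P.α x * lk P k (gI P.α x)) + P.p₂ * (JI P.β x * lk P k (gI P.β x))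

lemma opL_iter_one (P : Par) (k : ℕ) (z : ℝ × ℝ) : (opL P)^[k] (fun _ => 1) z = lk P k z.1 := by
  induction k generalizing z with
  | zero => rfl
  | succ k ih =>
    rw [Function.iterate_succ_apply']
    simp only [opL, ih, lk]

lemma lk_BM (P : Par) (k : ℕ) : BM (lk P k) := by
  induction k with
  | zero => exact BM.const 1
  | succ k ih =>
    exact (((JI_BM P.hα).mul (ih.comp (gI_measurable _))).const_mul _).add
      (((JI_BM P.hβ0).mul (ih.comp (gI_measurable _))).const_mul _)

lemma lk_int_rec (P : Par) (k : ℕ) {y : ℝ} (h0 : 0 < y) (h1 : y ≤ 1) :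
    ∫ x in Ioc 0 y, lk P (k + 1) x = P.p₁ * (∫ x in Ioc 0 (gI P.α y), lk P k x) +
      P.p₂ * ∫ x in Ioc 0 (gI P.β y), lk P k x := by
  rw [← left_change P.hα (lk P k) h0 h1, ← left_change P.hβ0 (lk P k) h0 h1]
  rw [← integral_const_mul, ← integral_const_mul, ← integral_add]
  · rfl
  · exact (((JI_BM P.hα).mul ((lk_BM P k).comp (gI_measurable _))).const_mul _).integrable _
  · exact (((JI_BM P.hβ0).mul ((lk_BM P k).comp (gI_measurable _))).const_mul _).integrable _

lemma delta_exists {p₁ p₂ c κ : ℝ} (hp₁ : 0 < p₁) (hp₂ : 0 < p₂) (hp : p₁ + p₂ = 1) (hc : 0 < c)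
    (hκ : 0 < κ) : ∃ δ, 0 < δ ∧ ∀ s : ℝ, 1 ≤ s →
      p₁ * (s + c) ^ (-κ) + p₂ * s ^ (-κ) ≤ (s + δ) ^ (-κ) := by
  set W := κ * c / (1 + c) with hW
  have hW0 : 0 < W := by positivity
  refine ⟨p₁ * (W / (1 + W)) / κ, by positivity, fun s hs => ?_⟩
  set δ := p₁ * (W / (1 + W)) / κ with hδ
  have hδ0 : 0 < δ := by positivity
  have hs0 : 0 < s := by linarith
  set u := s⁻¹ with hu
  have hu0 : 0 < u := by positivity
  have hu1 : u ≤ 1 := inv_le_one_of_one_le₀ hs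
  have e : ∀ a : ℝ, 0 < a → (s + a) ^ (-κ) = s ^ (-κ) * (1 + a * u) ^ (-κ) := by
    intro a ha
    rw [← Real.mul_rpow hs0.le (by positivity)]
    congr 1
    rw [hu]; field_simp
  have l1 : 1 - κ * (δ * u) ≤ (1 + δ * u) ^ (-κ) := by
    rw [Real.rpow_def_of_pos (by positivity)]
    have h1 := Real.log_le_sub_one_of_pos (x := 1 + δ * u) (by positivity)
    have h2 := Real.add_one_le_exp (Real.log (1 + δ * u) * -κ)
    nlinarith
  have l2 : (1 + c * u) ^ (-κ) ≤ 1 - (W / (1 + W)) * u := by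
    rw [Real.rpow_def_of_pos (by positivity)]
    have h1 := Real.one_sub_inv_le_log_of_pos (x := 1 + c * u) (by positivity)
    have h4 : c * u / (1 + c) ≤ 1 - (1 + c * u)⁻¹ := by
      have : 1 - (1 + c * u)⁻¹ = c * u / (1 + c * u) := by field_simp; ring
      rw [this]
      gcongr
      nlinarith
    have h5 : Real.exp (Real.log (1 + c * u) * -κ) ≤ Real.exp (-(W * u)) := by
      apply Real.exp_le_exp.2
      have : W * u = κ * (c * u / (1 + c)) := by rw [hW]; ring
      rw [this]
      nlinarith
    refine h5.trans ?_
    rw [Real.exp_neg]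
    have h6 := Real.add_one_le_exp (W * u)
    have h7 : (Real.exp (W * u))⁻¹ ≤ (W * u + 1)⁻¹ := by gcongr
    refine h7.trans ?_
    have h8 : (W * u + 1)⁻¹ = 1 - W * u / (W * u + 1) := by field_simp; ring
    rw [h8]
    have h9 : W / (1 + W) * u ≤ W * u / (W * u + 1) := by
      rw [div_mul_eq_mul_div]
      exact div_le_div_of_nonneg_left (by positivity) (by positivity) (by nlinarith)
    linarith
  rw [e c hc, e δ hδ0]
  have hsp : 0 < s ^ (-κ) := by positivity
  have : p₁ * (1 + c * u) ^ (-κ) + p₂ ≤ (1 + δ * u) ^ (-κ) := by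
    have h1 := mul_le_mul_of_nonneg_left l2 hp₁.le
    have h2 : κ * (δ * u) = p₁ * (W / (1 + W) * u) := by rw [hδ]; field_simp
    rw [h2] at l1
    nlinarith
  calc _ = s ^ (-κ) * (p₁ * (1 + c * u) ^ (-κ) + p₂) := by ring
    _ ≤ _ := mul_le_mul_of_nonneg_left this hsp.le

lemma lk_tail (P : Par) : ∃ δ, 0 < δ ∧ ∀ k : ℕ, ∀ y : ℝ, 0 < y → y ≤ 1 →
    ∫ x in Ioc 0 y, lk P k x ≤ (y ^ (-P.α) + δ * k) ^ (-(1 / P.α)) := by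
  have hα := P.hα
  obtain ⟨δ, hδ, hd⟩ := delta_exists P.hp₁ P.hp₂ P.hp (c := P.α / 3) (κ := 1 / P.α)
    (by positivity) (by positivity)
  refine ⟨δ, hδ, fun k => ?_⟩
  induction k with
  | zero =>
    intro y h0 h1
    have : ∫ x in Ioc 0 y, lk P 0 x = y := by simp [lk, h0.le]
    rw [this]
    simp only [Nat.cast_zero, mul_zero, add_zero]
    rw [← Real.rpow_mul h0.le]
    have : -P.α * -(1 / P.α) = 1 := by field_simp
    rw [this, Real.rpow_one]
  | succ k ih =>
    intro y h0 h1
    rw [lk_int_rec P k h0 h1]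
    have y1 : 1 ≤ y ^ (-P.α) := Real.one_le_rpow_of_pos_of_le_one_of_nonpos h0 h1 (by linarith)
    set s := y ^ (-P.α) + δ * k with hs
    have hs1 : 1 ≤ s := by
      have : 0 ≤ δ * k := by positivity
      linarith
    have hs0 : 0 < s := by linarith
    have i1 := ih _ (gI_pos P.hα h0 h1) ((gI_le_half _ _).trans (by norm_num))
    have i2 := ih _ (gI_pos P.hβ0 h0 h1) ((gI_le_half _ _).trans (by norm_num))
    have j1 : (gI P.α y ^ (-P.α) + δ * k) ^ (-(1 / P.α)) ≤ (s + P.α / 3) ^ (-(1 / P.α)) := by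
      apply Real.rpow_le_rpow_of_nonpos (by positivity)
      · have := gI_neg_pow P.hα P.hα1.le h0 h1
        linarith
      · have : 0 < 1 / P.α := by positivity
        linarith
    have j2 : (gI P.β y ^ (-P.α) + δ * k) ^ (-(1 / P.α)) ≤ s ^ (-(1 / P.α)) := by
      apply Real.rpow_le_rpow_of_nonpos hs0
      · have : y ^ (-P.α) ≤ gI P.β y ^ (-P.α) := by
          apply Real.rpow_le_rpow_of_nonpos (gI_pos P.hβ0 h0 h1) (gI_le_self P.hβ0 h0.le h1)
          linarith
        linarith
      · have : 0 < 1 / P.α := by positivity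
        linarith
    have := hd s hs1
    have e : y ^ (-P.α) + δ * ((k + 1 : ℕ) : ℝ) = s + δ := by rw [hs]; push_cast; ring
    rw [e]
    refine le_trans ?_ this
    have := P.hp₁
    have := P.hp₂
    gcongr
    · exact i1.trans j1
    · exact i2.trans j2

/-- Left excursion tails. -/
def hk (P : Par) (k : ℕ) (f : ℝ × ℝ → ℝ) : ℝ := ∫ z, (opL P)^[k] f z ∂mm

lemma hk_one_le (P : Par) : ∃ C, 0 < C ∧ ∀ k, hk P k (fun _ => 1) ≤ C * wt (1 / P.α) k := by
  have hα := P.hα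
  obtain ⟨δ, hδ, h⟩ := lk_tail P
  set d := min 1 δ with hd
  have hd0 : 0 < d := lt_min one_pos hδ
  refine ⟨d ^ (-(1 / P.α)), by positivity, fun k => ?_⟩
  have e : hk P k (fun _ => 1) = ∫ x in Ioc (0 : ℝ) 1, lk P k x := by
    unfold hk
    simp only [opL_iter_one]
    rw [integral_mm ((lk_BM P k).comp measurable_fst)]
    simp
  rw [e]
  refine (h k 1 one_pos le_rfl).trans ?_
  unfold wt
  rw [← Real.mul_rpow hd0.le (by positivity)]
  apply Real.rpow_le_rpow_of_nonpos (by positivity)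
  · rw [Real.one_rpow, mul_add, mul_one, add_comm]
    have h1 : d ≤ 1 := min_le_left _ _
    have h2 : d ≤ δ := min_le_right _ _
    gcongr
  · have : 0 < 1 / P.α := by positivity
    linarith


/-! ### Part G: cones of densities -/

/-- The cone of densities with controlled distortion. -/
def Cone (s K : ℝ) (f : ℝ × ℝ → ℝ) : Prop :=
  (∀ z ∈ Dm, 0 ≤ f z) ∧ ∀ u ∈ Dm, ∀ v ∈ Dm, u.1 ≤ v.1 →
    f u ≤ exp (K * dist u v ^ s) * (v.1 / u.1) ^ 2 * f v ∧ f v ≤ exp (K * dist u v ^ s) * f u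

/-- Regularity on the right half. -/
def YReg (s K : ℝ) (f : ℝ × ℝ → ℝ) : Prop :=
  (∀ z ∈ Dm, z ∈ Yh → 0 ≤ f z) ∧ ∀ u ∈ Dm, ∀ v ∈ Dm, u ∈ Yh → v ∈ Yh →
    f u ≤ exp (K * dist u v ^ s) * f v

/-- The contraction rate. -/
def Par.lam (P : Par) : ℝ := max (1 / 2) (max P.p₁ P.p₂)

lemma Par.p₁_lt (P : Par) : P.p₁ < 1 := by linarith [P.hp, P.hp₂]
lemma Par.p₂_lt (P : Par) : P.p₂ < 1 := by linarith [P.hp, P.hp₁]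
lemma Par.lam_lt (P : Par) : P.lam < 1 := by
  unfold Par.lam
  exact max_lt (by norm_num) (max_lt P.p₁_lt P.p₂_lt)
lemma Par.lam_pos (P : Par) : 0 < P.lam := lt_of_lt_of_le (by norm_num) (le_max_left _ _)

lemma dist_le_of {a b c d : ℝ} {u v : ℝ × ℝ} {l : ℝ}
    (h1 : |a - b| ≤ l * |u.1 - v.1|) (h2 : |c - d| ≤ l * |u.2 - v.2|) (hl : 0 ≤ l) :
    dist ((a, c) : ℝ × ℝ) (b, d) ≤ l * dist u v := by
  rw [Prod.dist_eq, Prod.dist_eq]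
  simp only [Real.dist_eq]
  apply max_le
  · exact h1.trans (mul_le_mul_of_nonneg_left (le_max_left _ _) hl)
  · exact h2.trans (mul_le_mul_of_nonneg_left (le_max_right _ _) hl)

lemma dist_le_one_of_Dm {u v : ℝ × ℝ} (hu : u ∈ Dm) (hv : v ∈ Dm) : dist u v ≤ 1 := by
  rw [Prod.dist_eq]
  simp only [Real.dist_eq]
  have a1 := hu.1.1
  have a2 := hu.1.2
  have a3 := hu.2.1
  have a4 := hu.2.2
  have b1 := hv.1.1
  have b2 := hv.1.2
  have b3 := hv.2.1
  have b4 := hv.2.2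
  apply max_le <;> rw [abs_le] <;> constructor <;> linarith

lemma mem_Dm {x w : ℝ} : (x, w) ∈ Dm ↔ (0 < x ∧ x ≤ 1) ∧ (0 ≤ w ∧ w < 1) := by
  simp [Dm, mem_prod]

lemma Par.b1 (P : Par) {w : ℝ} (h : 0 ≤ w ∧ w < 1) : 0 ≤ P.p₁ * w ∧ P.p₁ * w < 1 := by
  have := P.hp₁
  have := P.p₁_lt
  constructor
  · exact mul_nonneg P.hp₁.le h.1
  · nlinarith [h.1, h.2]

lemma Par.b2 (P : Par) {w : ℝ} (h : 0 ≤ w ∧ w < 1) :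
    0 ≤ P.p₁ + P.p₂ * w ∧ P.p₁ + P.p₂ * w < 1 := by
  have h1 := P.hp₁
  have h2 := P.hp₂
  have h3 := P.hp
  have h4 := mul_nonneg h2.le h.1
  constructor
  · linarith
  · nlinarith [h.1, h.2]

lemma left_mem {γ : ℝ} (hγ : 0 < γ) {z : ℝ × ℝ} (hz : z ∈ Dm) {w : ℝ} (hw : 0 ≤ w ∧ w < 1) :
    (gI γ z.1, w) ∈ Dm :=
  mem_Dm.2 ⟨⟨gI_pos hγ hz.1.1 hz.1.2, (gI_le_half _ _).trans (by norm_num)⟩, hw⟩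

lemma right_mem {z : ℝ × ℝ} (hz : z ∈ Dm) {w : ℝ} (hw : 0 ≤ w ∧ w < 1) :
    ((z.1 + 1) / 2, w) ∈ Dm := by
  have h1 := hz.1.1
  have h2 := hz.1.2
  exact mem_Dm.2 ⟨⟨by linarith, by linarith⟩, hw⟩

lemma right_memY {z : ℝ × ℝ} (hz : z ∈ Dm) {w : ℝ} : ((z.1 + 1) / 2, w) ∈ Yh := by
  have h1 := hz.1.1
  simp only [Yh, mem_ofPred_eq]; linarith

lemma opL_nonneg (P : Par) {f : ℝ × ℝ → ℝ} (hf : ∀ z ∈ Dm, 0 ≤ f z) : ∀ z ∈ Dm, 0 ≤ opL P f z := by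
  intro z hz
  have h1 := hf _ (left_mem P.hα hz (P.b1 hz.2))
  have h2 := hf _ (left_mem P.hβ0 hz (P.b2 hz.2))
  have h3 := JI_nonneg P.hα z.1
  have h4 := JI_nonneg P.hβ0 z.1
  have h5 := P.hp₁
  have h6 := P.hp₂
  unfold opL
  positivity

lemma opR_nonneg (P : Par) {f : ℝ × ℝ → ℝ} (hf : ∀ z ∈ Dm, z ∈ Yh → 0 ≤ f z) :
    ∀ z ∈ Dm, 0 ≤ opR P f z := by
  intro z hz
  have h1 := hf _ (right_mem hz (P.b1 hz.2)) (right_memY hz)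
  have h2 := hf _ (right_mem hz (P.b2 hz.2)) (right_memY hz)
  have h5 := P.hp₁
  have h6 := P.hp₂
  unfold opR
  positivity

lemma opL_mono (P : Par) {f g : ℝ × ℝ → ℝ} (h : ∀ z ∈ Dm, f z ≤ g z) :
    ∀ z ∈ Dm, opL P f z ≤ opL P g z := by
  intro z hz
  have := opL_nonneg P (f := fun z => g z - f z) (fun z hz => sub_nonneg.2 (h z hz)) z hz
  unfold opL at this ⊢
  simp only at this
  linarith

lemma opL_iter_mono (P : Par) (k : ℕ) {f g : ℝ × ℝ → ℝ} (h : ∀ z ∈ Dm, f z ≤ g z) :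
    ∀ z ∈ Dm, (opL P)^[k] f z ≤ (opL P)^[k] g z := by
  induction k with
  | zero => exact h
  | succ k ih =>
    rw [Function.iterate_succ_apply', Function.iterate_succ_apply']
    exact opL_mono P ih

lemma opL_iter_smul (P : Par) (k : ℕ) (c : ℝ) (f : ℝ × ℝ → ℝ) (z : ℝ × ℝ) :
    (opL P)^[k] (fun z => c * f z) z = c * (opL P)^[k] f z := by
  induction k generalizing z with
  | zero => rfl
  | succ k ih =>
    rw [Function.iterate_succ_apply', Function.iterate_succ_apply']
    unfold opL at ih ⊢
    rw [ih, ih]; ring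

lemma opL_iter_add (P : Par) (k : ℕ) (f g : ℝ × ℝ → ℝ) (z : ℝ × ℝ) :
    (opL P)^[k] (fun z => f z + g z) z = (opL P)^[k] f z + (opL P)^[k] g z := by
  induction k generalizing z with
  | zero => rfl
  | succ k ih =>
    rw [Function.iterate_succ_apply', Function.iterate_succ_apply', Function.iterate_succ_apply']
    unfold opL at ih ⊢
    rw [ih, ih]; ring

lemma opL_iter_BM (P : Par) (k : ℕ) {f : ℝ × ℝ → ℝ} (hf : BM f) : BM ((opL P)^[k] f) := by
  induction k with
  | zero => exact hf
  | succ k ih => rw [Function.iterate_succ_apply']; exact opL_BM P ih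

lemma opP_iter_BM (P : Par) (k : ℕ) {f : ℝ × ℝ → ℝ} (hf : BM f) : BM ((opP P)^[k] f) := by
  induction k with
  | zero => exact hf
  | succ k ih => rw [Function.iterate_succ_apply']; exact opP_BM P ih

lemma cone_step {J1 J2 E Q A B p : ℝ} (hp : 0 ≤ p) (hE : 0 ≤ E) (hB : 0 ≤ B) (hJ1 : 0 ≤ J1)
    {q : ℝ} (hA : A ≤ E * q * B) (hJ : q * J1 ≤ Q * J2) :
    p * (J1 * A) ≤ E * Q * (p * (J2 * B)) := by
  have h1 : J1 * A ≤ J1 * (E * q * B) := mul_le_mul_of_nonneg_left hA hJ1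
  have h2 : (q * J1) * (E * B) ≤ (Q * J2) * (E * B) := mul_le_mul_of_nonneg_right hJ (by positivity)
  have h3 : J1 * A ≤ (Q * J2) * (E * B) := by linarith
  have := mul_le_mul_of_nonneg_left h3 hp
  linarith

lemma abs_sub_aff (a b p : ℝ) (hp : 0 ≤ p) : |p * a - p * b| = p * |a - b| := by
  rw [← mul_sub, abs_mul, abs_of_nonneg hp]

lemma abs_sub_aff' (a b c p : ℝ) (hp : 0 ≤ p) : |(c + p * a) - (c + p * b)| = p * |a - b| := by
  rw [add_sub_add_left_eq_sub, abs_sub_aff _ _ _ hp]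

lemma exp_dist_le {s K l : ℝ} (hs : 0 < s) (hK : 0 ≤ K) (hl : 0 ≤ l) {u v u' v' : ℝ × ℝ}
    (h : dist u' v' ≤ l * dist u v) :
    exp (K * dist u' v' ^ s) ≤ exp (K * l ^ s * dist u v ^ s) := by
  apply Real.exp_le_exp.2
  rw [mul_assoc, ← Real.mul_rpow hl dist_nonneg]
  gcongr

lemma opL_cone (P : Par) {s K : ℝ} (hs : 0 < s) (hK : 0 ≤ K) {f : ℝ × ℝ → ℝ} (hf : Cone s K f) :
    Cone s K (opL P f) := by
  refine ⟨opL_nonneg P hf.1, fun u hu v hv huv => ?_⟩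
  have aux : ∀ γ, 0 < γ → γ ≤ 1 → ∀ p w w' : ℝ, 0 ≤ p → |w - w'| ≤ 1 * |u.2 - v.2| →
      (0 ≤ w ∧ w < 1) → (0 ≤ w' ∧ w' < 1) →
      p * (JI γ u.1 * f (gI γ u.1, w)) ≤ exp (K * dist u v ^ s) * (v.1 / u.1) ^ 2 *
        (p * (JI γ v.1 * f (gI γ v.1, w'))) ∧
      p * (JI γ v.1 * f (gI γ v.1, w')) ≤ exp (K * dist u v ^ s) * 1 *
        (p * (JI γ u.1 * f (gI γ u.1, w))) := by
    intro γ hγ hγ1 p w w' hp hww hw hw'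
    have m1 := left_mem hγ hu hw
    have m2 := left_mem hγ hv hw'
    have hd : dist ((gI γ u.1, w) : ℝ × ℝ) (gI γ v.1, w') ≤ 1 * dist u v := by
      apply dist_le_of _ hww zero_le_one
      have h1 := gI_sub_le hγ hu.1.1.le huv hv.1.2
      have h2 := gI_mono γ huv
      rw [abs_sub_comm, abs_sub_comm u.1, abs_of_nonneg (by linarith), abs_of_nonneg (by linarith)]
      linarith
    have he := exp_dist_le hs hK zero_le_one hd
    rw [Real.one_rpow, mul_one] at he
    obtain ⟨c1, c2⟩ := hf.2 _ m1 _ m2 (gI_mono γ huv)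
    simp only at c1 c2
    have f1 := hf.1 _ m1
    have f2 := hf.1 _ m2
    constructor
    · apply cone_step hp (exp_pos _).le f2 (JI_nonneg hγ _) (q := (gI γ v.1 / gI γ u.1) ^ 2) _
        (JI_dist hγ hγ1 hu.1.1 huv hv.1.2)
      refine c1.trans ?_
      gcongr
    · apply cone_step hp (exp_pos _).le f1 (JI_nonneg hγ _) (q := 1) _
      · rw [one_mul, one_mul]; exact JI_anti hγ huv
      · rw [mul_one]
        refine c2.trans ?_
        gcongr
  have a1 := aux P.α P.hα P.hα1.le P.p₁ (P.p₁ * u.2) (P.p₁ * v.2) P.hp₁.le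
    (by rw [abs_sub_aff _ _ _ P.hp₁.le]; gcongr; exact P.p₁_lt.le) (P.b1 hu.2) (P.b1 hv.2)
  have a2 := aux P.β P.hβ0 P.hβ P.p₂ (P.p₁ + P.p₂ * u.2) (P.p₁ + P.p₂ * v.2) P.hp₂.le
    (by rw [abs_sub_aff' _ _ _ _ P.hp₂.le]; gcongr; exact P.p₂_lt.le) (P.b2 hu.2) (P.b2 hv.2)
  unfold opL
  constructor
  · linarith [a1.1, a2.1]
  · linarith [a1.2, a2.2]

lemma right_dist (P : Par) (u v : ℝ × ℝ) :
    dist (((u.1 + 1) / 2, P.p₁ * u.2) : ℝ × ℝ) ((v.1 + 1) / 2, P.p₁ * v.2) ≤ P.lam * dist u v ∧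
    dist (((u.1 + 1) / 2, P.p₁ + P.p₂ * u.2) : ℝ × ℝ) ((v.1 + 1) / 2, P.p₁ + P.p₂ * v.2)
      ≤ P.lam * dist u v := by
  have h0 : |(u.1 + 1) / 2 - (v.1 + 1) / 2| ≤ P.lam * |u.1 - v.1| := by
    have : (u.1 + 1) / 2 - (v.1 + 1) / 2 = (1 / 2) * (u.1 - v.1) := by ring
    rw [this, abs_mul, abs_of_nonneg (by norm_num : (0 : ℝ) ≤ 1 / 2)]
    gcongr
    exact le_max_left _ _
  constructor
  · apply dist_le_of h0 _ P.lam_pos.le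
    rw [abs_sub_aff _ _ _ P.hp₁.le]
    gcongr
    exact (le_max_left _ _).trans (le_max_right _ _)
  · apply dist_le_of h0 _ P.lam_pos.le
    rw [abs_sub_aff' _ _ _ _ P.hp₂.le]
    gcongr
    exact (le_max_right _ _).trans (le_max_right _ _)

lemma one_le_ratio {u v : ℝ × ℝ} (hu : u ∈ Dm) (huv : u.1 ≤ v.1) : 1 ≤ (v.1 / u.1) ^ 2 := by
  have h : 1 ≤ v.1 / u.1 := (one_le_div hu.1.1).2 huv
  nlinarith

lemma opR_of_yreg (P : Par) {s K : ℝ} (hs : 0 < s) (hK : 0 ≤ K) {f : ℝ × ℝ → ℝ} (hf : YReg s K f) :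
    Cone s (K * P.lam ^ s) (opR P f) := by
  have hn := opR_nonneg P hf.1
  have key : ∀ u ∈ Dm, ∀ v ∈ Dm, opR P f u ≤ exp (K * P.lam ^ s * dist u v ^ s) * opR P f v := by
    intro u hu v hv
    obtain ⟨d1, d2⟩ := right_dist P u v
    have e1 := exp_dist_le hs hK P.lam_pos.le d1
    have e2 := exp_dist_le hs hK P.lam_pos.le d2
    have n1 := hf.1 _ (right_mem hv (P.b1 hv.2)) (right_memY hv)
    have n2 := hf.1 _ (right_mem hv (P.b2 hv.2)) (right_memY hv)
    have f1 := (hf.2 _ (right_mem hu (P.b1 hu.2)) _ (right_mem hv (P.b1 hv.2))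
      (right_memY hu) (right_memY hv)).trans (mul_le_mul_of_nonneg_right e1 n1)
    have f2 := (hf.2 _ (right_mem hu (P.b2 hu.2)) _ (right_mem hv (P.b2 hv.2))
      (right_memY hu) (right_memY hv)).trans (mul_le_mul_of_nonneg_right e2 n2)
    have g1 := mul_le_mul_of_nonneg_left f1 P.hp₁.le
    have g2 := mul_le_mul_of_nonneg_left f2 P.hp₂.le
    unfold opR
    linarith
  refine ⟨hn, fun u hu v hv huv => ⟨?_, ?_⟩⟩
  · have h1 := key u hu v hv
    have h2 := one_le_ratio hu huv
    have h3 : 0 ≤ exp (K * P.lam ^ s * dist u v ^ s) * opR P f v :=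
      mul_nonneg (exp_pos _).le (hn v hv)
    nlinarith
  · rw [dist_comm]; exact key v hv u hu

lemma opR_cone (P : Par) {s K : ℝ} (hs : 0 < s) (hK : 0 ≤ K) {f : ℝ × ℝ → ℝ} (hf : Cone s K f) :
    Cone s K (opR P f) := by
  refine ⟨opR_nonneg P (fun z hz _ => hf.1 z hz), fun u hu v hv huv => ?_⟩
  have hle : exp (K * P.lam ^ s * dist u v ^ s) ≤ exp (K * dist u v ^ s) := by
    apply Real.exp_le_exp.2
    have : P.lam ^ s ≤ 1 := Real.rpow_le_one P.lam_pos.le P.lam_lt.le hs.le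
    have h2 : 0 ≤ K * dist u v ^ s := by positivity
    nlinarith
  obtain ⟨d1, d2⟩ := right_dist P u v
  have hq : (((v.1 + 1) / 2) / ((u.1 + 1) / 2)) ^ 2 ≤ (v.1 / u.1) ^ 2 := by
    have hu1 : 0 < u.1 := hu.1.1
    have hv1 : 0 < v.1 := hv.1.1
    have : ((v.1 + 1) / 2) / ((u.1 + 1) / 2) ≤ v.1 / u.1 := by
      rw [div_le_div_iff₀ (by positivity) (by positivity)]
      nlinarith
    gcongr
  have aux : ∀ p w w' : ℝ, 0 ≤ p →
      dist (((u.1 + 1) / 2, w) : ℝ × ℝ) ((v.1 + 1) / 2, w') ≤ P.lam * dist u v →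
      (0 ≤ w ∧ w < 1) → (0 ≤ w' ∧ w' < 1) →
      p * (f ((u.1 + 1) / 2, w) / 2) ≤ exp (K * dist u v ^ s) * (v.1 / u.1) ^ 2 *
        (p * (f ((v.1 + 1) / 2, w') / 2)) ∧
      p * (f ((v.1 + 1) / 2, w') / 2) ≤ exp (K * dist u v ^ s) *
        (p * (f ((u.1 + 1) / 2, w) / 2)) := by
    intro p w w' hp hd hw hw'
    have m1 := right_mem hu hw
    have m2 := right_mem hv hw'
    have he := (exp_dist_le hs hK P.lam_pos.le hd).trans hle
    obtain ⟨c1, c2⟩ := hf.2 _ m1 _ m2 (by simp only; linarith)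
    simp only at c1 c2
    have f1 := hf.1 _ m1
    have f2 := hf.1 _ m2
    constructor
    · have : f ((u.1 + 1) / 2, w) ≤ exp (K * dist u v ^ s) * (v.1 / u.1) ^ 2 * f ((v.1 + 1) / 2, w') := by
        refine c1.trans ?_
        gcongr
      have := mul_le_mul_of_nonneg_left this hp
      linarith
    · have : f ((v.1 + 1) / 2, w') ≤ exp (K * dist u v ^ s) * f ((u.1 + 1) / 2, w) := by
        refine c2.trans ?_
        gcongr
      have := mul_le_mul_of_nonneg_left this hp
      linarith
  have a1 := aux _ _ _ P.hp₁.le d1 (P.b1 hu.2) (P.b1 hv.2)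
  have a2 := aux _ _ _ P.hp₂.le d2 (P.b2 hu.2) (P.b2 hv.2)
  unfold opR
  constructor
  · linarith [a1.1, a2.1]
  · linarith [a1.2, a2.2]

lemma Cone.add {s K : ℝ} {f g : ℝ × ℝ → ℝ} (hf : Cone s K f) (hg : Cone s K g) :
    Cone s K (fun z => f z + g z) := by
  refine ⟨fun z hz => add_nonneg (hf.1 z hz) (hg.1 z hz), fun u hu v hv huv => ?_⟩
  have a := hf.2 u hu v hv huv
  have b := hg.2 u hu v hv huv
  constructor
  · linarith [a.1, b.1]
  · linarith [a.2, b.2]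

lemma Cone.mono {s K K' : ℝ} (h : K ≤ K') {f : ℝ × ℝ → ℝ} (hf : Cone s K f) : Cone s K' f := by
  refine ⟨hf.1, fun u hu v hv huv => ?_⟩
  have a := hf.2 u hu v hv huv
  have f1 := hf.1 u hu
  have f2 := hf.1 v hv
  have he : exp (K * dist u v ^ s) ≤ exp (K' * dist u v ^ s) := by
    apply Real.exp_le_exp.2
    gcongr
  constructor
  · refine a.1.trans ?_
    gcongr
  · refine a.2.trans ?_
    gcongr

lemma Cone.congr {s K : ℝ} {f g : ℝ × ℝ → ℝ} (hf : Cone s K f) (h : ∀ z ∈ Dm, f z = g z) :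
    Cone s K g := by
  refine ⟨fun z hz => by rw [← h z hz]; exact hf.1 z hz, fun u hu v hv huv => ?_⟩
  rw [← h u hu, ← h v hv]
  exact hf.2 u hu v hv huv

lemma opP_cone (P : Par) {s K : ℝ} (hs : 0 < s) (hK : 0 ≤ K) {f : ℝ × ℝ → ℝ} (hf : Cone s K f) :
    Cone s K (opP P f) := (opL_cone P hs hK hf).add (opR_cone P hs hK hf)

lemma cone_one (s : ℝ) : Cone s 0 (fun _ => 1) := by
  refine ⟨fun z hz => zero_le_one, fun u hu v hv huv => ?_⟩
  simp only [zero_mul, exp_zero, mul_one, le_refl, and_true, one_mul]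
  exact one_le_ratio hu huv

lemma cone_iter_one (P : Par) {s : ℝ} (hs : 0 < s) (N : ℕ) :
    Cone s 0 ((opP P)^[N] (fun _ => 1)) := by
  induction N with
  | zero => exact cone_one s
  | succ N ih => rw [Function.iterate_succ_apply']; exact opP_cone P hs le_rfl ih

lemma cone_mul {s K : ℝ} {f g : ℝ × ℝ → ℝ} (hg0 : ∀ z ∈ Dm, 0 ≤ g z)
    (hg : ∀ u ∈ Dm, ∀ v ∈ Dm, g u ≤ exp (K * dist u v ^ s) * g v) (hf : Cone s 0 f) :
    Cone s K (fun z => g z * f z) := by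
  refine ⟨fun z hz => mul_nonneg (hg0 z hz) (hf.1 z hz), fun u hu v hv huv => ?_⟩
  have a := hf.2 u hu v hv huv
  simp only [zero_mul, exp_zero, one_mul] at a
  have f1 := hf.1 u hu
  have f2 := hf.1 v hv
  have g1 := hg u hu v hv
  have g2 := hg v hv u hu
  rw [dist_comm] at g2
  have k1 := hg0 u hu
  have k2 := hg0 v hv
  constructor
  · calc g u * f u ≤ (exp (K * dist u v ^ s) * g v) * ((v.1 / u.1) ^ 2 * f v) := by
          apply mul_le_mul g1 a.1 f1 (by positivity)
      _ = _ := by ring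
  · calc g v * f v ≤ (exp (K * dist u v ^ s) * g u) * f u := by
          apply mul_le_mul g2 a.2 f2 (by positivity)
      _ = _ := by ring

lemma Cone.yreg {s K : ℝ} (hs : 0 < s) (hs1 : s ≤ 1) {f : ℝ × ℝ → ℝ} (hf : Cone s K f) :
    YReg s (K + 4) f := by
  refine ⟨fun z hz _ => hf.1 z hz, ?_⟩
  have main : ∀ u ∈ Dm, ∀ v ∈ Dm, u ∈ Yh → u.1 ≤ v.1 →
      f u ≤ exp ((K + 4) * dist u v ^ s) * f v ∧ f v ≤ exp ((K + 4) * dist u v ^ s) * f u := by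
    intro u hu v hv huY huv
    have a := hf.2 u hu v hv huv
    have f1 := hf.1 u hu
    have f2 := hf.1 v hv
    have hd1 : dist u v ≤ dist u v ^ s := by
      rcases (dist_nonneg (x := u) (y := v)).eq_or_lt with h | h
      · rw [← h, Real.zero_rpow hs.ne']
      · have := Real.rpow_le_rpow_of_exponent_ge h (dist_le_one_of_Dm hu hv) hs1
        rwa [Real.rpow_one] at this
    have hY : 1 / 2 < u.1 := huY
    have hxy : v.1 - u.1 ≤ dist u v := by
      rw [Prod.dist_eq, Real.dist_eq]
      refine le_trans ?_ (le_max_left _ _)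
      rw [abs_sub_comm]; exact le_abs_self _
    have hr : (v.1 / u.1) ^ 2 ≤ exp (4 * dist u v ^ s) := by
      have h1 : v.1 / u.1 ≤ exp (2 * dist u v ^ s) := by
        have h2 := Real.add_one_le_exp (2 * dist u v ^ s)
        refine le_trans ?_ h2
        rw [div_le_iff₀ (by linarith)]
        have : 0 ≤ dist u v ^ s := by positivity
        nlinarith
      have h0 : 0 ≤ v.1 / u.1 := div_nonneg hv.1.1.le hu.1.1.le
      calc (v.1 / u.1) ^ 2 ≤ (exp (2 * dist u v ^ s)) ^ 2 := by gcongr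
        _ = exp (4 * dist u v ^ s) := by rw [← Real.exp_nat_mul]; congr 1; push_cast; ring
    have hee : exp ((K + 4) * dist u v ^ s) = exp (K * dist u v ^ s) * exp (4 * dist u v ^ s) := by
      rw [← Real.exp_add]; congr 1; ring
    constructor
    · refine a.1.trans ?_
      rw [hee]
      gcongr
    · refine a.2.trans ?_
      gcongr
      linarith
  intro u hu v hv huY hvY
  rcases le_total u.1 v.1 with h | h
  · exact (main u hu v hv huY h).1
  · rw [dist_comm]; exact (main v hv u hu hvY h).2


/-! ### Part H: subtraction of the reference density and the iteration -/

/-- The reference density on the right half. -/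
def ee : ℝ × ℝ → ℝ := Yh.indicator (fun _ => 2)

lemma ee_BM : BM ee := (BM.const 2).indicator Yh_meas

lemma half_mass (c : ℝ) : ∫ z, Yh.indicator (fun _ => c) z ∂mm = c / 2 := by
  have P : Par := ⟨1 / 2, 1, 1 / 2, 1 / 2, by norm_num, by norm_num, by norm_num, by norm_num,
    by norm_num, by norm_num⟩
  rw [← opR_int P (BM.const c)]
  have : opR P (fun _ => c) = fun _ => c / 2 := by
    funext z
    have := P.hp
    unfold opR
    rw [← add_mul, this, one_mul]
  rw [this]; simp

lemma ee_int : ∫ z, ee z ∂mm = 1 := by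
  unfold ee; rw [half_mass]; norm_num

lemma ee_Y (z : ℝ × ℝ) : Yh.indicator ee z = ee z := by
  unfold ee; rw [Set.indicator_indicator, Set.inter_self]

/-- Mass of the right half. -/
def yM (f : ℝ × ℝ → ℝ) : ℝ := ∫ z, Yh.indicator f z ∂mm

lemma yM_nonneg {f : ℝ × ℝ → ℝ} (hf : ∀ z ∈ Dm, 0 ≤ f z) : 0 ≤ yM f := by
  unfold yM
  apply setIntegral_nonneg Dm_meas
  intro z hz
  by_cases h : z ∈ Yh
  · rw [indicator_of_mem h]; exact hf z hz
  · rw [indicator_of_notMem h]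

lemma yM_le {f : ℝ × ℝ → ℝ} (hb : BM f) (hf : ∀ z ∈ Dm, 0 ≤ f z) : yM f ≤ ∫ z, f z ∂mm := by
  unfold yM
  apply int_mono_Dm (hb.indicator Yh_meas) hb
  intro z hz
  by_cases h : z ∈ Yh
  · rw [indicator_of_mem h]
  · rw [indicator_of_notMem h]; exact hf z hz

lemma exp_bd {s K : ℝ} (hs : 0 < s) (hK : 0 ≤ K) {u v : ℝ × ℝ} (hu : u ∈ Dm) (hv : v ∈ Dm) :
    exp (K * dist u v ^ s) ≤ exp K := by
  apply Real.exp_le_exp.2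
  have := Real.rpow_le_one dist_nonneg (dist_le_one_of_Dm hu hv) hs.le
  nlinarith

lemma yM_upper {s K : ℝ} (hs : 0 < s) (hK : 0 ≤ K) {f : ℝ × ℝ → ℝ} (hb : BM f) (hf : YReg s K f)
    {u : ℝ × ℝ} (hu : u ∈ Dm) (huY : u ∈ Yh) : 2 * yM f ≤ exp K * f u := by
  have : yM f ≤ (exp K * f u) / 2 := by
    rw [← half_mass]
    apply int_mono_Dm (hb.indicator Yh_meas) ((BM.const _).indicator Yh_meas)
    intro z hz
    by_cases h : z ∈ Yh
    · rw [indicator_of_mem h, indicator_of_mem h]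
      refine (hf.2 z hz u hu h huY).trans ?_
      exact mul_le_mul_of_nonneg_right (exp_bd hs hK hz hu) (hf.1 u hu huY)
    · rw [indicator_of_notMem h, indicator_of_notMem h]
  linarith

lemma yM_lower {s K : ℝ} (hs : 0 < s) (hK : 0 ≤ K) {f : ℝ × ℝ → ℝ} (hb : BM f) (hf : YReg s K f)
    {u : ℝ × ℝ} (hu : u ∈ Dm) (huY : u ∈ Yh) : f u ≤ 2 * exp K * yM f := by
  have : f u / 2 ≤ exp K * yM f := by
    rw [← half_mass]
    unfold yM
    rw [← integral_const_mul]
    apply int_mono_Dm ((BM.const _).indicator Yh_meas) ((hb.indicator Yh_meas).const_mul _)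
    intro z hz
    by_cases h : z ∈ Yh
    · rw [indicator_of_mem h, indicator_of_mem h]
      refine (hf.2 u hu z hz huY h).trans ?_
      exact mul_le_mul_of_nonneg_right (exp_bd hs hK hu hz) (hf.1 z hz h)
    · rw [indicator_of_notMem h, indicator_of_notMem h, mul_zero]
  linarith

/-- The fraction subtracted at each step. -/
def thet (K : ℝ) : ℝ := exp (-(K + (K + 1))) / (K + 1)

lemma thet_pos {K : ℝ} (hK : 0 ≤ K) : 0 < thet K := by unfold thet; positivity

lemma thet_lt {K : ℝ} (hK : 0 ≤ K) : thet K < 1 := by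
  unfold thet
  rw [div_lt_one (by linarith)]
  have : exp (-(K + (K + 1))) < 1 := by rw [Real.exp_lt_one_iff]; linarith
  linarith

/-- Subtraction of the reference density. -/
def qs (K : ℝ) (f : ℝ × ℝ → ℝ) (z : ℝ × ℝ) : ℝ := f z - (thet K * yM f) * ee z

lemma qs_BM {K : ℝ} {f : ℝ × ℝ → ℝ} (hb : BM f) : BM (qs K f) := hb.sub (ee_BM.const_mul _)

lemma qs_Y {K : ℝ} {f : ℝ × ℝ → ℝ} {z : ℝ × ℝ} (h : z ∈ Yh) :
    qs K f z = f z - thet K * (2 * yM f) := by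
  unfold qs ee
  rw [indicator_of_mem h]; ring

lemma qs_notY {K : ℝ} {f : ℝ × ℝ → ℝ} {z : ℝ × ℝ} (h : z ∉ Yh) : qs K f z = f z := by
  unfold qs ee
  rw [indicator_of_notMem h]; ring

lemma thet_exp {K d : ℝ} (hK : 0 ≤ K) (h0 : 0 ≤ d) (h1 : d ≤ 1) :
    thet K * exp K * (exp ((K + 1) * d) - 1) ≤ exp ((K + 1) * d) - exp (K * d) := by
  have e1 : thet K * exp K = exp (-(K + 1)) / (K + 1) := by
    unfold thet
    rw [div_mul_eq_mul_div, ← Real.exp_add]; congr 2; ring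
  have h2 : exp ((K + 1) * d) - 1 ≤ (K + 1) * d * exp (K + 1) := by
    have h3 := Real.add_one_le_exp (-((K + 1) * d))
    have h4 : exp ((K + 1) * d) * exp (-((K + 1) * d)) = 1 := by rw [← Real.exp_add]; simp
    have h5 : exp ((K + 1) * d) ≤ exp (K + 1) := Real.exp_le_exp.2 (by nlinarith)
    have h6 := exp_pos ((K + 1) * d)
    have h7 : 0 ≤ (K + 1) * d := by positivity
    nlinarith
  have h3 : d ≤ exp ((K + 1) * d) - exp (K * d) := by
    have e : exp ((K + 1) * d) = exp (K * d) * exp d := by rw [← Real.exp_add]; congr 1; ring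
    rw [e]
    have h4 := Real.add_one_le_exp d
    have h5 : 1 ≤ exp (K * d) := Real.one_le_exp (by positivity)
    nlinarith
  refine le_trans ?_ h3
  rw [e1]
  calc exp (-(K + 1)) / (K + 1) * (exp ((K + 1) * d) - 1)
      ≤ exp (-(K + 1)) / (K + 1) * ((K + 1) * d * exp (K + 1)) := by gcongr
    _ = d * (exp (-(K + 1)) * exp (K + 1)) := by field_simp
    _ = d := by rw [← Real.exp_add]; simp

lemma qs_nonneg {s K : ℝ} (hs : 0 < s) (hK : 0 ≤ K) {f : ℝ × ℝ → ℝ} (hb : BM f)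
    (h0 : ∀ z ∈ Dm, 0 ≤ f z) (hf : YReg s K f) : ∀ z ∈ Dm, 0 ≤ qs K f z := by
  intro z hz
  by_cases h : z ∈ Yh
  · rw [qs_Y h]
    have h1 := yM_upper hs hK hb hf hz h
    have h2 : thet K * exp K ≤ 1 := by
      have e1 : thet K * exp K = exp (-(K + 1)) / (K + 1) := by
        unfold thet
        rw [div_mul_eq_mul_div, ← Real.exp_add]; congr 2; ring
      rw [e1, div_le_one (by linarith)]
      have : exp (-(K + 1)) < 1 := by rw [Real.exp_lt_one_iff]; linarith
      linarith
    have h3 := mul_le_mul_of_nonneg_left h1 (thet_pos hK).le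
    have h4 := h0 z hz
    nlinarith
  · rw [qs_notY h]; exact h0 z hz

lemma qs_yreg {s K : ℝ} (hs : 0 < s) (hK : 0 ≤ K) {f : ℝ × ℝ → ℝ} (hb : BM f)
    (h0 : ∀ z ∈ Dm, 0 ≤ f z) (hf : YReg s K f) : YReg s (K + 1) (qs K f) := by
  refine ⟨fun z hz _ => qs_nonneg hs hK hb h0 hf z hz, fun u hu v hv huY hvY => ?_⟩
  rw [qs_Y huY, qs_Y hvY]
  have h1 := yM_upper hs hK hb hf hv hvY
  have h2 := hf.2 u hu v hv huY hvY
  have hd0 : 0 ≤ dist u v ^ s := by positivity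
  have hd1 : dist u v ^ s ≤ 1 := Real.rpow_le_one dist_nonneg (dist_le_one_of_Dm hu hv) hs.le
  set d := dist u v ^ s
  have h3 := thet_exp hK hd0 hd1
  have h4 := mul_le_mul_of_nonneg_left h1 (thet_pos hK).le
  have h5 : 0 ≤ exp ((K + 1) * d) - 1 := by
    have := Real.one_le_exp (x := (K + 1) * d) (by positivity)
    linarith
  have h6 := mul_le_mul_of_nonneg_right h4 h5
  have h7 := mul_le_mul_of_nonneg_right h3 (h0 v hv)
  nlinarith

lemma qs_yM {K : ℝ} {f : ℝ × ℝ → ℝ} (hb : BM f) : yM (qs K f) = (1 - thet K) * yM f := by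
  have e : Yh.indicator (qs K f) = fun z => Yh.indicator f z - (thet K * yM f) * ee z := by
    funext z
    by_cases h : z ∈ Yh
    · rw [indicator_of_mem h, indicator_of_mem h, qs]
    · rw [indicator_of_notMem h, indicator_of_notMem h, ee, indicator_of_notMem h]; ring
  have : yM (qs K f) = yM f - (thet K * yM f) * 1 := by
    rw [← ee_int, ← integral_const_mul]
    unfold yM
    rw [e, integral_sub ((hb.indicator Yh_meas).integrable mm)
      ((ee_BM.const_mul _).integrable mm)]
    rfl
  rw [this]; ring

lemma qs_int {K : ℝ} {f : ℝ × ℝ → ℝ} (hb : BM f) :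
    ∫ z, qs K f z ∂mm = (∫ z, f z ∂mm) - thet K * yM f := by
  unfold qs
  rw [integral_sub (hb.integrable mm) ((ee_BM.const_mul _).integrable mm), integral_const_mul,
    ee_int, mul_one]

lemma opL_qs (P : Par) {K : ℝ} {f : ℝ × ℝ → ℝ} (z : ℝ × ℝ) : opL P (qs K f) z = opL P f z := by
  have a1 : ∀ γ w, (gI γ z.1, w) ∉ Yh := fun γ w => by
    have := gI_le_half γ z.1
    simp only [Yh, mem_ofPred_eq, not_lt]; exact this
  simp only [opL, qs_notY (a1 _ _)]

/-- One step of the iteration. -/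
def stp (P : Par) (K0 : ℝ) (f : ℝ × ℝ → ℝ) : ℝ × ℝ → ℝ := opP P (qs (K0 + 4) f)

/-- Admissible cone constant. -/
def GoodK (P : Par) (s K0 : ℝ) : Prop := 0 ≤ K0 ∧ (K0 + 5) * P.lam ^ s ≤ K0

lemma goodK_exists (P : Par) {s : ℝ} (hs : 0 < s) (K : ℝ) : ∃ K0, K ≤ K0 ∧ GoodK P s K0 := by
  have hl : P.lam ^ s < 1 := Real.rpow_lt_one P.lam_pos.le P.lam_lt hs
  have hl0 : 0 < P.lam ^ s := Real.rpow_pos_of_pos P.lam_pos s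
  set l := P.lam ^ s with hll
  refine ⟨max K (5 * l / (1 - l)), le_max_left _ _, ?_, ?_⟩
  · exact le_trans (div_nonneg (by positivity) (by linarith)) (le_max_right _ _)
  · have h1 : 5 * l / (1 - l) ≤ max K (5 * l / (1 - l)) := le_max_right _ _
    rw [div_le_iff₀ (by linarith)] at h1
    rw [← hll]
    linarith

section iteration
variable (P : Par) {s K0 : ℝ}

lemma stp_BM {f : ℝ × ℝ → ℝ} (hb : BM f) : BM (stp P K0 f) := opP_BM P (qs_BM hb)

lemma stp_cone (hs : 0 < s) (hs1 : s ≤ 1) (hK : GoodK P s K0) {f : ℝ × ℝ → ℝ} (hb : BM f)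
    (hf : Cone s K0 f) : Cone s K0 (stp P K0 f) := by
  have hY := hf.yreg hs hs1
  have hK4 : 0 ≤ K0 + 4 := by linarith [hK.1]
  have hq := qs_yreg hs hK4 hb hf.1 hY
  have h1 : Cone s K0 (opL P (qs (K0 + 4) f)) :=
    (opL_cone P hs hK.1 hf).congr (fun z _ => (opL_qs P z).symm)
  have h2 : Cone s K0 (opR P (qs (K0 + 4) f)) := by
    refine (opR_of_yreg P hs (by linarith) hq).mono ?_
    have := hK.2
    have e : K0 + 4 + 1 = K0 + 5 := by ring
    rw [e]; exact this
  exact h1.add h2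

lemma stp_iter (hs : 0 < s) (hs1 : s ≤ 1) (hK : GoodK P s K0) {f : ℝ × ℝ → ℝ} (hb : BM f)
    (hf : Cone s K0 f) (n : ℕ) : BM ((stp P K0)^[n] f) ∧ Cone s K0 ((stp P K0)^[n] f) := by
  induction n with
  | zero => exact ⟨hb, hf⟩
  | succ n ih =>
    rw [Function.iterate_succ_apply']
    exact ⟨stp_BM P ih.1, stp_cone P hs hs1 hK ih.1 ih.2⟩

/-- Remaining mass after `n` steps. -/
def rn (K0 : ℝ) (f : ℝ × ℝ → ℝ) (n : ℕ) : ℝ := ∫ z, (stp P K0)^[n] f z ∂mm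

/-- Mass subtracted at step `n`. -/
def cn (K0 : ℝ) (f : ℝ × ℝ → ℝ) (n : ℕ) : ℝ := thet (K0 + 4) * yM ((stp P K0)^[n] f)

lemma rn_nonneg (hs : 0 < s) (hs1 : s ≤ 1) (hK : GoodK P s K0) {f : ℝ × ℝ → ℝ} (hb : BM f)
    (hf : Cone s K0 f) (n : ℕ) : 0 ≤ rn P K0 f n :=
  setIntegral_nonneg Dm_meas (stp_iter P hs hs1 hK hb hf n).2.1

lemma rn_succ (hs : 0 < s) (hs1 : s ≤ 1) (hK : GoodK P s K0) {f : ℝ × ℝ → ℝ} (hb : BM f)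
    (hf : Cone s K0 f) (n : ℕ) : rn P K0 f (n + 1) = rn P K0 f n - cn P K0 f n := by
  unfold rn cn
  rw [Function.iterate_succ_apply']
  have h := (stp_iter P hs hs1 hK hb hf n).1
  rw [stp, opP_int P (qs_BM h), qs_int h]

lemma cn_nonneg (hs : 0 < s) (hs1 : s ≤ 1) (hK : GoodK P s K0) {f : ℝ × ℝ → ℝ} (hb : BM f)
    (hf : Cone s K0 f) (n : ℕ) : 0 ≤ cn P K0 f n :=
  mul_nonneg (thet_pos (by linarith [hK.1])).le (yM_nonneg (stp_iter P hs hs1 hK hb hf n).2.1)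

lemma cn_le (hs : 0 < s) (hs1 : s ≤ 1) (hK : GoodK P s K0) {f : ℝ × ℝ → ℝ} (hb : BM f)
    (hf : Cone s K0 f) (n : ℕ) : cn P K0 f n ≤ rn P K0 f n := by
  have h := rn_nonneg P hs hs1 hK hb hf (n + 1)
  rw [rn_succ P hs hs1 hK hb hf] at h
  linarith

lemma rn_anti (hs : 0 < s) (hs1 : s ≤ 1) (hK : GoodK P s K0) {f : ℝ × ℝ → ℝ} (hb : BM f)
    (hf : Cone s K0 f) : Antitone (rn P K0 f) := by
  apply antitone_nat_of_succ_le
  intro n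
  rw [rn_succ P hs hs1 hK hb hf]
  linarith [cn_nonneg P hs hs1 hK hb hf n]

/-- Decomposition of correlations. -/
lemma corr_decomp (hs : 0 < s) (hs1 : s ≤ 1) (hK : GoodK P s K0) {f : ℝ × ℝ → ℝ} (hb : BM f)
    (hf : Cone s K0 f) {u : ℝ × ℝ → ℝ} (hu : BM u) (n : ℕ) :
    ∫ z, u ((SS P)^[n] z) * f z ∂mm = (∫ z, u z * (stp P K0)^[n] f z ∂mm) +
      ∑ j ∈ Finset.range n, cn P K0 f j * ∫ z, u ((SS P)^[n - j] z) * ee z ∂mm := by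
  have key : ∀ k ≤ n, ∫ z, u ((SS P)^[n] z) * f z ∂mm =
      (∫ z, u ((SS P)^[n - k] z) * (stp P K0)^[k] f z ∂mm) +
      ∑ j ∈ Finset.range k, cn P K0 f j * ∫ z, u ((SS P)^[n - j] z) * ee z ∂mm := by
    intro k
    induction k with
    | zero => intro _; simp
    | succ k ih =>
      intro hk
      rw [ih (by omega), Finset.sum_range_succ]
      have hbk := (stp_iter P hs hs1 hK hb hf k).1
      obtain ⟨m, hm⟩ : ∃ m, n - k = m + 1 := ⟨n - k - 1, by omega⟩
      have hm' : n - (k + 1) = m := by omega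
      rw [hm, hm', Function.iterate_succ_apply' (stp P K0)]
      have hbu : ∀ j, BM (fun z => u ((SS P)^[j] z)) :=
        fun j => hu.comp ((SS_measurable P).iterate j)
      have d := duality P (hbu m) (qs_BM (K := K0 + 4) hbk)
      have estp : ∀ g, stp P K0 g = opP P (qs (K0 + 4) g) := fun _ => rfl
      rw [estp ((stp P K0)^[k] f), ← d]
      have e : ∀ z, u ((SS P)^[m + 1] z) * (stp P K0)^[k] f z =
          u ((SS P)^[m] (SS P z)) * qs (K0 + 4) ((stp P K0)^[k] f) z +
          cn P K0 f k * (u ((SS P)^[m + 1] z) * ee z) := by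
        intro z
        rw [← Function.iterate_succ_apply]
        unfold qs cn
        ring
      have e2 : ∫ z, u ((SS P)^[m + 1] z) * (stp P K0)^[k] f z ∂mm =
          (∫ z, u ((SS P)^[m] (SS P z)) * qs (K0 + 4) ((stp P K0)^[k] f) z ∂mm) +
          cn P K0 f k * ∫ z, u ((SS P)^[m + 1] z) * ee z ∂mm := by
        rw [← integral_const_mul, ← integral_add]
        · exact integral_congr_ae (Eventually.of_forall e)
        · exact (((hbu m).comp (SS_measurable P)).mul (qs_BM hbk)).integrable mm
        · exact (((hbu (m + 1)).mul ee_BM).const_mul _).integrable mm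
      rw [e2]; ring
  have := key n le_rfl
  simpa using this

lemma corr_rem (hs : 0 < s) (hs1 : s ≤ 1) (hK : GoodK P s K0) {f : ℝ × ℝ → ℝ} (hb : BM f)
    (hf : Cone s K0 f) {u : ℝ × ℝ → ℝ} (hu : BM u) {M : ℝ} (hM : ∀ z, |u z| ≤ M) (n : ℕ) :
    |∫ z, u z * (stp P K0)^[n] f z ∂mm| ≤ M * rn P K0 f n := by
  obtain ⟨h1, h2⟩ := stp_iter P hs hs1 hK hb hf n
  refine abs_integral_le_integral_abs.trans ?_
  unfold rn
  rw [← integral_const_mul]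
  have hb' : BM (fun z => |u z * (stp P K0)^[n] f z|) := by
    have := hu.mul h1
    exact ⟨this.1.abs, this.2.imp (fun _ h z => by rw [abs_abs]; exact h z)⟩
  apply int_mono_Dm hb' (h1.const_mul _)
  intro z hz
  rw [abs_mul, abs_of_nonneg (h2.1 z hz)]
  exact mul_le_mul_of_nonneg_right (hM z) (h2.1 z hz)

end iteration


/-! ### Part I: tail bounds and limits -/

lemma wt_anti {κ : ℝ} (hκ : 0 ≤ κ) {m n : ℕ} (h : m ≤ n) : wt κ n ≤ wt κ m := by
  unfold wt
  apply Real.rpow_le_rpow_of_nonpos (by positivity) _ (by linarith)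
  have : (m : ℝ) ≤ n := by exact_mod_cast h
  linarith

lemma wt_exp_anti {κ κ' : ℝ} (h : κ' ≤ κ) (n : ℕ) : wt κ n ≤ wt κ' n := by
  unfold wt
  apply Real.rpow_le_rpow_of_exponent_le _ (by linarith)
  have : (0 : ℝ) ≤ n := by positivity
  linarith

lemma wt_succ_le {κ : ℝ} (hκ : 0 ≤ κ) (n : ℕ) : wt κ n ≤ 2 ^ κ * wt κ (n + 1) := by
  unfold wt
  have h2 : (2 : ℝ) ^ κ = (1 / 2) ^ (-κ) := by
    rw [one_div, Real.inv_rpow (by norm_num), Real.rpow_neg (by norm_num), inv_inv]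
  rw [h2, ← Real.mul_rpow (by norm_num) (by positivity)]
  apply Real.rpow_le_rpow_of_nonpos (by positivity) _ (by linarith)
  push_cast
  have : (0 : ℝ) ≤ n := by positivity
  linarith

lemma hk_add (P : Par) (k : ℕ) {f g : ℝ × ℝ → ℝ} (hf : BM f) (hg : BM g) :
    hk P k (fun z => f z + g z) = hk P k f + hk P k g := by
  unfold hk
  rw [← integral_add ((opL_iter_BM P k hf).integrable mm) ((opL_iter_BM P k hg).integrable mm)]
  exact integral_congr_ae (Eventually.of_forall (opL_iter_add P k f g))

lemma hk_smul (P : Par) (k : ℕ) (c : ℝ) (f : ℝ × ℝ → ℝ) :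
    hk P k (fun z => c * f z) = c * hk P k f := by
  unfold hk
  rw [← integral_const_mul]
  exact integral_congr_ae (Eventually.of_forall (opL_iter_smul P k c f))

lemma hk_mono (P : Par) (k : ℕ) {f g : ℝ × ℝ → ℝ} (hf : BM f) (hg : BM g)
    (h : ∀ z ∈ Dm, f z ≤ g z) : hk P k f ≤ hk P k g :=
  int_mono_Dm (opL_iter_BM P k hf) (opL_iter_BM P k hg) (opL_iter_mono P k h)

lemma opL_iter_nonneg (P : Par) (k : ℕ) {f : ℝ × ℝ → ℝ} (hf : ∀ z ∈ Dm, 0 ≤ f z) :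
    ∀ z ∈ Dm, 0 ≤ (opL P)^[k] f z := by
  induction k with
  | zero => exact hf
  | succ k ih => rw [Function.iterate_succ_apply']; exact opL_nonneg P ih

lemma hk_nonneg (P : Par) (k : ℕ) {f : ℝ × ℝ → ℝ} (hf : ∀ z ∈ Dm, 0 ≤ f z) : 0 ≤ hk P k f :=
  setIntegral_nonneg Dm_meas (opL_iter_nonneg P k hf)

lemma hk_le (P : Par) (k : ℕ) {f : ℝ × ℝ → ℝ} (hb : BM f) (hf : ∀ z ∈ Dm, 0 ≤ f z) :
    hk P k f ≤ ∫ z, f z ∂mm := by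
  induction k with
  | zero => exact le_rfl
  | succ k ih =>
    refine le_trans ?_ ih
    unfold hk
    rw [Function.iterate_succ_apply', opL_int P (opL_iter_BM P k hb)]
    apply int_mono_Dm ((opL_iter_BM P k hb).indicator Yh_meas.compl) (opL_iter_BM P k hb)
    intro z hz
    by_cases h : z ∈ Yhᶜ
    · rw [indicator_of_mem h]
    · rw [indicator_of_notMem h]; exact opL_iter_nonneg P k hf z hz

lemma opR_le_of {P : Par} {f : ℝ × ℝ → ℝ} {c : ℝ} (h : ∀ z ∈ Dm, z ∈ Yh → f z ≤ c) :
    ∀ z ∈ Dm, opR P f z ≤ c / 2 := by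
  intro z hz
  have h1 := h _ (right_mem hz (P.b1 hz.2)) (right_memY hz)
  have h2 := h _ (right_mem hz (P.b2 hz.2)) (right_memY hz)
  have h3 := P.hp
  have h4 := mul_le_mul_of_nonneg_left h1 P.hp₁.le
  have h5 := mul_le_mul_of_nonneg_left h2 P.hp₂.le
  have h6 : P.p₁ * c + P.p₂ * c = c := by rw [← add_mul, h3, one_mul]
  unfold opR
  linarith

lemma tail_bound (P : Par) {s K0 : ℝ} (hs : 0 < s) (hs1 : s ≤ 1) (hK : GoodK P s K0) {κ' T : ℝ}
    (hκ : 0 < κ') (hκ' : κ' ≤ 1 / P.α) (hT : 0 ≤ T) :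
    ∃ C', 0 ≤ C' ∧ ∀ f : ℝ × ℝ → ℝ, BM f → Cone s K0 f → (∀ n, hk P n f ≤ T * wt κ' n) →
      ∀ n, rn P K0 f n ≤ C' * wt κ' n := by
  obtain ⟨C2, hC2, hone⟩ := hk_one_le P
  have hK4 : 0 ≤ K0 + 4 := by linarith [hK.1]
  set θ := thet (K0 + 4) with hθ
  have hθ0 : 0 < θ := thet_pos hK4
  have hθ1 : θ < 1 := thet_lt hK4
  set C1 := exp (K0 + 4 + 1) with hC1
  have hC10 : 0 < C1 := exp_pos _
  set C := T + C1 * C2 * T with hC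
  have hC0 : 0 ≤ C := by positivity
  obtain ⟨C', hC', h⟩ := tail_rec hκ hθ0 hθ1 hC0
  refine ⟨C', hC', fun f hb hf ht => h _ ?_ ?_⟩
  · intro n
    have h1 := rn_anti P hs hs1 hK hb hf (Nat.zero_le n)
    have h2 := ht 0
    rw [wt_zero, mul_one] at h2
    have h3 : rn P K0 f 0 = hk P 0 f := rfl
    have : 0 ≤ C1 * C2 * T := by positivity
    linarith
  · intro n m hmn
    set q := fun j => qs (K0 + 4) ((stp P K0)^[j] f) with hq
    set w := fun j => yM ((stp P K0)^[j] f) with hw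
    have hqb : ∀ j, BM (opR P (q j)) := fun j =>
      opR_BM P (qs_BM (stp_iter P hs hs1 hK hb hf j).1)
    have hqY : ∀ j, YReg s (K0 + 4 + 1) (q j) := fun j => by
      have hj := stp_iter P hs hs1 hK hb hf j
      exact qs_yreg hs hK4 hj.1 hj.2.1 (hj.2.yreg hs hs1)
    have hq0 : ∀ j, ∀ z ∈ Dm, 0 ≤ opR P (q j) z := fun j => opR_nonneg P (hqY j).1
    have hqM : ∀ j, yM (q j) = (1 - θ) * w j := fun j =>
      qs_yM (stp_iter P hs hs1 hK hb hf j).1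
    have hw0 : ∀ j, 0 ≤ w j := fun j => yM_nonneg (stp_iter P hs hs1 hK hb hf j).2.1
    have hcw : ∀ j, θ * w j = rn P K0 f j - rn P K0 f (j + 1) := fun j => by
      rw [rn_succ P hs hs1 hK hb hf]; simp only [cn, hw, hθ]; ring
    -- recursion for excursions
    have rec1 : ∀ k j, hk P k ((stp P K0)^[j + 1] f) =
        hk P (k + 1) ((stp P K0)^[j] f) + hk P k (opR P (q j)) := by
      intro k j
      rw [Function.iterate_succ_apply']
      have e : stp P K0 ((stp P K0)^[j] f) =
          fun z => opL P ((stp P K0)^[j] f) z + opR P (q j) z := by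
        funext z
        rw [← opL_qs P (K := K0 + 4) z]
        rfl
      rw [e, hk_add P k (opL_BM P (stp_iter P hs hs1 hK hb hf j).1) (hqb j)]
      rfl
    have rec2 : ∀ j k, hk P k ((stp P K0)^[j] f) = hk P (k + j) f +
        ∑ i ∈ Finset.range j, hk P (k + (j - 1 - i)) (opR P (q i)) := by
      intro j
      induction j with
      | zero => intro k; simp
      | succ j ih =>
        intro k
        rw [rec1, ih (k + 1), Finset.sum_range_succ]
        have e1 : k + 1 + j = k + (j + 1) := by ring
        have e2 : k + (j + 1 - 1 - j) = k := by omega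
        rw [e1, e2, add_assoc]
        congr 2
        apply Finset.sum_congr rfl
        intro i hi
        rw [Finset.mem_range] at hi
        congr 1
        omega
    have hr : rn P K0 f n = hk P n f + ∑ i ∈ Finset.range n, hk P (n - 1 - i) (opR P (q i)) := by
      have := rec2 n 0
      simp only [zero_add] at this
      exact this
    have bd1 : ∀ i k, hk P k (opR P (q i)) ≤ (1 - θ) * w i := by
      intro i k
      refine (hk_le P k (hqb i) (hq0 i)).trans ?_
      rw [opR_int P (qs_BM (stp_iter P hs hs1 hK hb hf i).1), ← hqM]
      exact le_rfl
    have bd2 : ∀ i k, m ≤ k → hk P k (opR P (q i)) ≤ C1 * C2 * wt κ' m * ((1 - θ) * w i) := by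
      intro i k hmk
      have hup : ∀ z ∈ Dm, opR P (q i) z ≤ (C1 * ((1 - θ) * w i)) * 1 := by
        intro z hz
        have := opR_le_of (P := P) (f := q i) (c := 2 * C1 * ((1 - θ) * w i)) (fun z hz hzY => by
          rw [← hqM]
          exact yM_lower hs (by linarith) (qs_BM (stp_iter P hs hs1 hK hb hf i).1) (hqY i) hz hzY) z hz
        linarith
      have h1 := hk_mono P k (hqb i) ((BM.const 1).const_mul _) hup
      rw [hk_smul] at h1
      have h2 := hone k
      have h3 : wt (1 / P.α) k ≤ wt κ' m := (wt_exp_anti hκ' k).trans (wt_anti hκ.le hmk)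
      have h4 : 0 ≤ (1 - θ) * w i := mul_nonneg (by linarith) (hw0 i)
      calc _ ≤ _ := h1
        _ ≤ C1 * ((1 - θ) * w i) * (C2 * wt κ' m) := by gcongr; exact h2.trans (by gcongr)
        _ = _ := by ring
    have split : ∑ i ∈ Finset.range n, hk P (n - 1 - i) (opR P (q i)) ≤
        C1 * C2 * wt κ' m * ((1 - θ) * ∑ i ∈ Finset.range (n - m), w i) +
        (1 - θ) * ∑ i ∈ Finset.range m, w (n - m + i) := by
      have hn : n = (n - m) + m := by omega
      conv_lhs => rw [hn]
      rw [Finset.sum_range_add, Finset.mul_sum, Finset.mul_sum, Finset.mul_sum]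
      apply add_le_add
      · apply Finset.sum_le_sum
        intro i hi
        rw [Finset.mem_range] at hi
        exact bd2 i _ (by omega)
      · apply Finset.sum_le_sum
        intro i hi
        exact bd1 _ _
    have s1 : θ * ∑ i ∈ Finset.range (n - m), w i = rn P K0 f 0 - rn P K0 f (n - m) := by
      rw [Finset.mul_sum]
      simp only [hcw]
      rw [Finset.sum_range_sub']
    have s2 : θ * ∑ i ∈ Finset.range m, w (n - m + i) = rn P K0 f (n - m) - rn P K0 f n := by
      rw [Finset.mul_sum]
      simp only [hcw]
      have h := Finset.sum_range_sub' (fun i => rn P K0 f (n - m + i)) m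
      have e : n - m + m = n := by omega
      simp only [← add_assoc, add_zero, e] at h
      exact h
    have hr0 : rn P K0 f 0 ≤ T := by
      have h2 := ht 0
      rw [wt_zero, mul_one] at h2
      exact h2
    have hrm := rn_nonneg P hs hs1 hK hb hf (n - m)
    have ht' : hk P n f ≤ T * wt κ' m :=
      (ht n).trans (mul_le_mul_of_nonneg_left (wt_anti hκ.le hmn) hT)
    have hwm := wt_pos κ' m
    have tot : θ * rn P K0 f n ≤ θ * (T * wt κ' m) + C1 * C2 * wt κ' m * ((1 - θ) * T) +
        (1 - θ) * (rn P K0 f (n - m) - rn P K0 f n) := by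
      have h1 : rn P K0 f n ≤ T * wt κ' m + (C1 * C2 * wt κ' m * ((1 - θ) * ∑ i ∈ Finset.range (n - m), w i) +
        (1 - θ) * ∑ i ∈ Finset.range m, w (n - m + i)) := by
        rw [hr]; exact add_le_add ht' split
      have h2 := mul_le_mul_of_nonneg_left h1 hθ0.le
      have h3 : θ * (T * wt κ' m + (C1 * C2 * wt κ' m * ((1 - θ) * ∑ i ∈ Finset.range (n - m), w i) +
        (1 - θ) * ∑ i ∈ Finset.range m, w (n - m + i))) = θ * (T * wt κ' m) +
        C1 * C2 * wt κ' m * ((1 - θ) * (θ * ∑ i ∈ Finset.range (n - m), w i)) +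
        (1 - θ) * (θ * ∑ i ∈ Finset.range m, w (n - m + i)) := by ring
      rw [h3, s1, s2] at h2
      refine h2.trans ?_
      have : 0 ≤ 1 - θ := by linarith
      gcongr
      linarith
    have f1 : θ * (T * wt κ' m) ≤ T * wt κ' m := by
      have : 0 ≤ T * wt κ' m := by positivity
      nlinarith
    have f2 : C1 * C2 * wt κ' m * ((1 - θ) * T) ≤ C1 * C2 * T * wt κ' m := by
      have : 0 ≤ C1 * C2 * T * wt κ' m := by positivity
      nlinarith
    have f3 : C * wt κ' m = T * wt κ' m + C1 * C2 * T * wt κ' m := by rw [hC]; ring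
    rw [f3]
    linarith

/-- Correlations against the reference density. -/
def xn (P : Par) (u : ℝ × ℝ → ℝ) (n : ℕ) : ℝ := ∫ z, u ((SS P)^[n] z) * ee z ∂mm

lemma opP_ee (P : Par) : ∀ z ∈ Dm, opP P ee z = 1 := by
  intro z hz
  have a1 : ∀ γ w, (gI γ z.1, w) ∉ Yh := fun γ w => by
    have := gI_le_half γ z.1
    simp only [Yh, mem_ofPred_eq, not_lt]; exact this
  have a2 : ∀ w : ℝ, ((z.1 + 1) / 2, w) ∈ Yh := fun w => right_memY hz
  have := P.hp
  simp only [opP, opL, opR, ee, indicator_of_notMem (a1 _ _), indicator_of_mem (a2 _)]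
  linarith

lemma Par.kappa (P : Par) : 1 < 1 / P.α := by
  rw [lt_div_iff₀ P.hα]; linarith [P.hα1]

lemma xn_bd (P : Par) {u : ℝ × ℝ → ℝ} (hu : BM u) {M : ℝ} (hM : ∀ z, |u z| ≤ M) (n : ℕ) :
    |xn P u n| ≤ M := by
  have hb : BM (fun z => u ((SS P)^[n] z) * ee z) :=
    (hu.comp ((SS_measurable P).iterate n)).mul ee_BM
  refine abs_integral_le_integral_abs.trans ?_
  have e : M = ∫ z, M * ee z ∂mm := by rw [integral_const_mul, ee_int, mul_one]
  rw [e]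
  apply integral_mono (hb.integrable mm).abs ((ee_BM.const_mul _).integrable mm)
  intro z
  have : 0 ≤ ee z := by
    unfold ee; exact indicator_nonneg (fun _ _ => by norm_num) z
  simp only
  rw [abs_mul, abs_of_nonneg this]
  exact mul_le_mul_of_nonneg_right (hM _) this

lemma xn_limit (P : Par) {u : ℝ × ℝ → ℝ} (hu : BM u) :
    ∃ l D : ℝ, ∀ n, |xn P u n - l| ≤ D * wt (1 / P.α - 1) n := by
  obtain ⟨M, hM⟩ := hu.2
  have hM0 : 0 ≤ M := (abs_nonneg _).trans (hM (0, 0))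
  have hκ := P.kappa
  obtain ⟨K0, -, hK⟩ := goodK_exists P (s := 1) one_pos 0
  have hb : BM (fun _ : ℝ × ℝ => (1 : ℝ)) := BM.const 1
  have hf : Cone 1 K0 (fun _ => 1) := (cone_one 1).mono hK.1
  obtain ⟨C2, hC2, hone⟩ := hk_one_le P
  obtain ⟨C', hC', htail⟩ := tail_bound P one_pos le_rfl hK (κ' := 1 / P.α) (T := C2)
    (by linarith) le_rfl hC2.le
  have hr := htail _ hb hf hone
  have hK4 : 0 ≤ K0 + 4 := by linarith [hK.1]
  set A := rn P K0 (fun _ => 1) with hA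
  have A0 : A 0 = 1 := by simp [hA, rn]
  have hsucc := rn_succ P one_pos le_rfl hK hb hf
  set D := M + 2 * M * (C' * 2 ^ (1 / P.α)) with hD
  refine renewal_limit hκ A A0 (rn_anti P one_pos le_rfl hK hb hf) ?_
    (rn_nonneg P one_pos le_rfl hK hb hf) C' hr (xn P u) D ?_ ?_
  · have h1 : A 1 = A 0 - cn P K0 (fun _ => 1) 0 := hsucc 0
    rw [h1, A0]
    have h2 : cn P K0 (fun _ => 1) 0 = thet (K0 + 4) * (1 / 2) := by
      simp only [cn, Function.iterate_zero, id_eq, yM, half_mass]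
    rw [h2]
    have := thet_pos hK4
    linarith
  · refine (xn_bd P hu hM 0).trans ?_
    have : 0 ≤ 2 * M * (C' * 2 ^ (1 / P.α)) := by positivity
    linarith
  · intro n
    have e1 : xn P u (n + 1) = ∫ z, u ((SS P)^[n] z) * 1 ∂mm := by
      have d := duality P (u := fun z => u ((SS P)^[n] z))
        (hu.comp ((SS_measurable P).iterate n)) ee_BM
      unfold xn
      simp only [Function.iterate_succ, Function.comp]
      rw [d]
      apply int_congr_Dm
      intro z hz
      rw [opP_ee P z hz]
    have e2 := corr_decomp P one_pos le_rfl hK hb hf hu n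
    rw [e1, e2, Finset.sum_range_succ]
    have e3 : ∀ j, A j - A (j + 1) = cn P K0 (fun _ => 1) j := fun j => by
      rw [hA, hsucc]; ring
    simp only [e3, Nat.sub_self]
    have e4 : ∀ j, ∫ z, u ((SS P)^[n - j] z) * ee z ∂mm = xn P u (n - j) := fun j => rfl
    simp only [e4]
    have h1 := corr_rem P one_pos le_rfl hK hb hf hu hM n
    have h2 := xn_bd P hu hM 0
    have h3 := cn_nonneg P one_pos le_rfl hK hb hf n
    have h4 := cn_le P one_pos le_rfl hK hb hf n
    have h5 : |cn P K0 (fun _ => 1) n * xn P u 0| ≤ M * A n := by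
      rw [abs_mul, abs_of_nonneg h3]
      calc _ ≤ A n * M := mul_le_mul h4 h2 (abs_nonneg _) (h3.trans h4)
        _ = _ := by ring
    have h6 : A n ≤ C' * (2 ^ (1 / P.α) * wt (1 / P.α) (n + 1)) :=
      (hr n).trans (mul_le_mul_of_nonneg_left (wt_succ_le (by linarith) n) hC')
    have h7 : 0 ≤ M * wt (1 / P.α) (n + 1) := mul_nonneg hM0 (wt_pos _ _).le
    have h8 := mul_le_mul_of_nonneg_left h6 hM0
    generalize (∫ z, u z * (stp P K0)^[n] (fun _ => 1) z ∂mm) = I at *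
    generalize (∑ x ∈ Finset.range n, cn P K0 (fun _ => 1) x * xn P u (n - x)) = Sg at *
    have h9 : I + Sg - (Sg + cn P K0 (fun _ => 1) n * xn P u 0) =
      I - cn P K0 (fun _ => 1) n * xn P u 0 := by ring
    rw [h9]
    refine (abs_sub _ _).trans ?_
    rw [hD]
    nlinarith

lemma corr_limit (P : Par) {s K0 : ℝ} (hs : 0 < s) (hs1 : s ≤ 1) (hK : GoodK P s K0)
    {f : ℝ × ℝ → ℝ} (hb : BM f) (hf : Cone s K0 f) {u : ℝ × ℝ → ℝ} (hu : BM u) {M : ℝ}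
    (hM : ∀ z, |u z| ≤ M) {l D C : ℝ} (hC : 0 ≤ C) (hD : 0 ≤ D)
    (hl : ∀ n, |xn P u n - l| ≤ D * wt (1 / P.α - 1) n)
    (hr : ∀ n, rn P K0 f n ≤ C * wt (1 / P.α - 1) n) (n : ℕ) :
    |(∫ z, u ((SS P)^[n] z) * f z ∂mm) - l * ∫ z, f z ∂mm| ≤
      ((M + |l|) * C + 2 * C * D * 2 ^ (1 / P.α - 1)) * wt (1 / P.α - 1) n := by
  have hκ := P.kappa
  have hM0 : 0 ≤ M := (abs_nonneg _).trans (hM (0, 0))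
  have hsucc := rn_succ P hs hs1 hK hb hf
  have hcn : ∀ j, cn P K0 f j = rn P K0 f j - rn P K0 f (j + 1) := fun j => by
    rw [hsucc]; ring
  have e0 : ∫ z, f z ∂mm = rn P K0 f n + ∑ j ∈ Finset.range n, cn P K0 f j := by
    simp only [hcn]
    rw [Finset.sum_range_sub']
    unfold rn; simp
  rw [corr_decomp P hs hs1 hK hb hf hu n, e0]
  have e4 : ∀ j, ∫ z, u ((SS P)^[n - j] z) * ee z ∂mm = xn P u (n - j) := fun j => rfl
  simp only [e4]
  have e5 : (∫ z, u z * (stp P K0)^[n] f z ∂mm) + ∑ j ∈ Finset.range n, cn P K0 f j * xn P u (n - j)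
      - l * (rn P K0 f n + ∑ j ∈ Finset.range n, cn P K0 f j) =
      (∫ z, u z * (stp P K0)^[n] f z ∂mm) - l * rn P K0 f n +
      ∑ j ∈ Finset.range n, cn P K0 f j * (xn P u (n - j) - l) := by
    simp only [mul_sub, Finset.sum_sub_distrib, ← Finset.sum_mul]
    ring
  rw [e5]
  have h1 := corr_rem P hs hs1 hK hb hf hu hM n
  have hrn := rn_nonneg P hs hs1 hK hb hf n
  have h2 : |l * rn P K0 f n| = |l| * rn P K0 f n := by rw [abs_mul, abs_of_nonneg hrn]
  have h3 : |∑ j ∈ Finset.range n, cn P K0 f j * (xn P u (n - j) - l)| ≤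
      2 * C * D * 2 ^ (1 / P.α - 1) * wt (1 / P.α - 1) n := by
    refine le_trans ?_ (final_conv (b := 1 / P.α - 1) (by linarith) hC hD (rn P K0 f)
      (rn_anti P hs hs1 hK hb hf) (rn_nonneg P hs hs1 hK hb hf) hr n)
    refine (Finset.abs_sum_le_sum_abs _ _).trans (Finset.sum_le_sum (fun j _ => ?_))
    rw [abs_mul, abs_of_nonneg (cn_nonneg P hs hs1 hK hb hf j), ← hcn]
    exact mul_le_mul_of_nonneg_left (hl _) (cn_nonneg P hs hs1 hK hb hf j)
  have h4 := mul_le_mul_of_nonneg_left (hr n) (add_nonneg hM0 (abs_nonneg l))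
  refine (abs_add_le _ _).trans ?_
  have h5 := abs_sub (∫ z, u z * (stp P K0)^[n] f z ∂mm) (l * rn P K0 f n)
  rw [h2] at h5
  nlinarith


/-! ### Part J: uniform bounds -/

lemma opP_iter_int (P : Par) (N : ℕ) : ∫ z, (opP P)^[N] (fun _ => 1) z ∂mm = 1 := by
  induction N with
  | zero => simp
  | succ N ih =>
    rw [Function.iterate_succ_apply', opP_int P (opP_iter_BM P N (BM.const 1))]
    exact ih

lemma hk_iter_le (P : Par) : ∃ C : ℝ, 0 ≤ C ∧
    ∀ N n, hk P n ((opP P)^[N] (fun _ => 1)) ≤ C * wt (1 / P.α - 1) n := by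
  obtain ⟨C2, hC2, hone⟩ := hk_one_le P
  have hκ := P.kappa
  set κ := 1 / P.α with hκd
  set E := exp (0 + 4) with hE
  have hE0 : 0 < E := exp_pos _
  have hB : ∀ N, BM ((opP P)^[N] (fun _ => 1)) := fun N => opP_iter_BM P N (BM.const 1)
  have hcl : ∀ N n, hk P n ((opP P)^[N] (fun _ => 1)) ≤
      hk P (n + N) (fun _ => 1) + E * ∑ j ∈ Finset.range N, hk P (n + j) (fun _ => 1) := by
    intro N
    induction N with
    | zero => intro n; simp
    | succ N ih =>
      intro n
      have e : hk P n ((opP P)^[N + 1] (fun _ => 1)) =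
          hk P (n + 1) ((opP P)^[N] (fun _ => 1)) + hk P n (opR P ((opP P)^[N] (fun _ => 1))) := by
        rw [Function.iterate_succ_apply']
        exact hk_add P n (opL_BM P (hB N)) (opR_BM P (hB N))
      have hc := cone_iter_one P one_pos N
      have h1 : hk P n (opR P ((opP P)^[N] (fun _ => 1))) ≤ E * hk P n (fun _ => 1) := by
        rw [← hk_smul]
        apply hk_mono P n (opR_BM P (hB N)) ((BM.const 1).const_mul _)
        intro z hz
        have := opR_le_of (P := P) (f := (opP P)^[N] (fun _ => 1)) (c := 2 * E) (fun z hz hzY => by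
          have a := yM_lower one_pos (by norm_num) (hB N) (hc.yreg one_pos le_rfl) hz hzY
          have b := yM_le (hB N) hc.1
          rw [opP_iter_int] at b
          refine a.trans ?_
          have : 0 ≤ 2 * exp (0 + 4) := by positivity
          nlinarith) z hz
        linarith
      have h2 := ih (n + 1)
      rw [e, Finset.sum_range_succ']
      have e1 : n + 1 + N = n + (N + 1) := by ring
      have e2 : ∀ j, n + 1 + j = n + (j + 1) := fun j => by ring
      simp only [e1, e2] at h2
      simp only [add_zero]
      linarith
  refine ⟨C2 + E * (C2 * 2 ^ κ * (κ - 1)⁻¹), ?_, fun N n => ?_⟩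
  · have : 0 < (κ - 1)⁻¹ := inv_pos.2 (by linarith)
    positivity
  · refine (hcl N n).trans ?_
    have h1 : hk P (n + N) (fun _ => 1) ≤ C2 * wt (κ - 1) n := by
      refine (hone _).trans (mul_le_mul_of_nonneg_left ?_ hC2.le)
      exact (wt_anti (by linarith) (Nat.le_add_right n N)).trans (wt_exp_anti (by linarith) n)
    have h2 : ∑ j ∈ Finset.range N, hk P (n + j) (fun _ => 1) ≤
        C2 * 2 ^ κ * ((κ - 1)⁻¹ * wt (κ - 1) n) := by
      refine le_trans ?_ (mul_le_mul_of_nonneg_left (sum_wt_le hκ n N) (by positivity))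
      rw [Finset.mul_sum]
      apply Finset.sum_le_sum
      intro j _
      refine (hone _).trans ?_
      rw [mul_assoc]
      apply mul_le_mul_of_nonneg_left _ hC2.le
      have := wt_succ_le (κ := κ) (by linarith) (n + j)
      have e : n + 1 + j = n + j + 1 := by ring
      rw [e]; exact this
    have h3 := mul_le_mul_of_nonneg_left h2 hE0.le
    calc _ ≤ _ := add_le_add h1 h3
      _ = _ := by ring

lemma uniform_bound (P : Par) {s K : ℝ} (hs : 0 < s) (hs1 : s ≤ 1) {g : ℝ × ℝ → ℝ} (hgb : BM g)
    (hg0 : ∀ z ∈ Dm, 0 ≤ g z)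
    (hg : ∀ u ∈ Dm, ∀ v ∈ Dm, g u ≤ exp (K * dist u v ^ s) * g v)
    {u : ℝ × ℝ → ℝ} (hu : BM u) {l D : ℝ} (hl : ∀ n, |xn P u n - l| ≤ D * wt (1 / P.α - 1) n) :
    ∃ C, 0 ≤ C ∧ ∀ N n,
      |(∫ z, u ((SS P)^[n] z) * (g z * (opP P)^[N] (fun _ => 1) z) ∂mm) -
        l * ∫ z, g z * (opP P)^[N] (fun _ => 1) z ∂mm| ≤ C * wt (1 / P.α - 1) n := by
  obtain ⟨M, hM⟩ := hu.2
  obtain ⟨B, hB⟩ := hgb.2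
  have hM0 : 0 ≤ M := (abs_nonneg _).trans (hM (0, 0))
  have hB0 : 0 ≤ B := (abs_nonneg _).trans (hB (0, 0))
  have hκ := P.kappa
  obtain ⟨K0, hKK, hK⟩ := goodK_exists P (s := s) hs K
  obtain ⟨C3, hC3, hit⟩ := hk_iter_le P
  obtain ⟨C', hC', htail⟩ := tail_bound P hs hs1 hK (κ' := 1 / P.α - 1) (T := B * C3)
    (by linarith) (by linarith) (by positivity)
  have hD : 0 ≤ D := by
    have := (abs_nonneg _).trans (hl 0)
    rwa [wt_zero, mul_one] at this
  refine ⟨(M + |l|) * C' + 2 * C' * D * 2 ^ (1 / P.α - 1), by positivity, fun N n => ?_⟩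
  have hN : BM ((opP P)^[N] (fun _ => 1)) := opP_iter_BM P N (BM.const 1)
  have hc := cone_iter_one P hs N
  have hcone : Cone s K0 (fun z => g z * (opP P)^[N] (fun _ => 1) z) :=
    (cone_mul hg0 hg hc).mono hKK
  refine corr_limit P hs hs1 hK (hgb.mul hN) hcone hu hM hC' hD hl
    (htail _ (hgb.mul hN) hcone fun n => ?_) n
  have h1 := hk_mono P n (hgb.mul hN) (hN.const_mul B) (fun z hz =>
    mul_le_mul_of_nonneg_right ((le_abs_self _).trans (hB z)) (hc.1 z hz))
  rw [hk_smul] at h1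
  refine h1.trans ?_
  rw [mul_assoc]
  exact mul_le_mul_of_nonneg_left (hit N n) hB0

/-- A positive Hölder function has the right log-regularity. -/
lemma holder_log {s K a b d : ℝ} (hb : 1 ≤ b) (h : |a - b| ≤ K * d ^ s) :
    a ≤ exp (K * d ^ s) * b := by
  have h1 := le_abs_self (a - b)
  have h2 := Real.add_one_le_exp (K * d ^ s)
  have h3 : 0 ≤ K * d ^ s := (abs_nonneg _).trans h
  nlinarith

lemma wt_tendsto {κ : ℝ} (hκ : 0 < κ) : Tendsto (wt κ) atTop (nhds 0) := by
  have h := (tendsto_rpow_neg_atTop hκ).comp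
    (tendsto_atTop_add_const_right atTop (1 : ℝ) (tendsto_natCast_atTop_atTop (R := ℝ)))
  exact h


/-! ### Part K: identification of the invariant density -/

lemma lip_approx {h : ℝ × ℝ → ℝ} (hh : Integrable h mm) {ε : ℝ} (hε : 0 < ε) :
    ∃ f : ℝ × ℝ → ℝ, BM f ∧ (∃ K, ∀ u v, |f u - f v| ≤ K * dist u v) ∧
      ∫ z, |h z - f z| ∂mm ≤ ε := by
  obtain ⟨g, hg1, hg2, hg3⟩ := (memLp_one_iff_integrable.2 hh).exist_eLpNorm_sub_le
    ENNReal.one_ne_top le_rfl hε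
  obtain ⟨K, hK⟩ := hg2.lipschitzWith_of_hasCompactSupport hg1 (by simp)
  obtain ⟨M, hM⟩ := hg2.continuous.bounded_above_of_compact_support hg1
  have hb : BM g := ⟨hg2.continuous.measurable, M, hM⟩
  refine ⟨g, hb, ⟨K, fun u v => hK.dist_le_mul u v⟩, ?_⟩
  rw [eLpNorm_one_eq_lintegral_enorm,
    ← ofReal_integral_norm_eq_lintegral_enorm (hh.sub (hb.integrable mm)),
    ENNReal.ofReal_le_ofReal_iff hε.le] at hg3
  exact hg3

lemma invariant_iter {S : ℝ × ℝ → ℝ × ℝ} (hS : Measurable S) {ν : Measure (ℝ × ℝ)}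
    (hinv : ∀ A, MeasurableSet A → ν (S ⁻¹' A) = ν A) (n : ℕ) {g : ℝ × ℝ → ℝ} (hg : Measurable g) :
    ∫ z, g (S^[n] z) ∂ν = ∫ z, g z ∂ν := by
  have hmp : MeasurePreserving S ν ν := ⟨hS, by
    ext A hA; rw [Measure.map_apply hS hA, hinv A hA]⟩
  have h := hmp.iterate n
  conv_rhs => rw [← h.map_eq]
  rw [integral_map h.measurable.aemeasurable hg.aestronglyMeasurable]

lemma dens_limit (P : Par) {u : ℝ × ℝ → ℝ} (hu : BM u) {l D : ℝ}
    (hl : ∀ n, |xn P u n - l| ≤ D * wt (1 / P.α - 1) n) {f : ℝ × ℝ → ℝ} (hf : BM f)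
    (hlip : ∃ K, ∀ u v, |f u - f v| ≤ K * dist u v) :
    Tendsto (fun n => ∫ z, u ((SS P)^[n] z) * f z ∂mm) atTop (nhds (l * ∫ z, f z ∂mm)) := by
  obtain ⟨K, hK⟩ := hlip
  obtain ⟨M, hM⟩ := hf.2
  have hκ := P.kappa
  have hw := wt_tendsto (κ := 1 / P.α - 1) (by linarith)
  have h1 : ∀ z, 1 ≤ f z + (M + 1) := fun z => by linarith [neg_le_of_abs_le (hM z)]
  have hf1 := hf.add (BM.const (M + 1))
  obtain ⟨C, hC, hc⟩ := uniform_bound P one_pos le_rfl hf1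
    (fun z _ => by linarith [h1 z]) (K := K) (fun u _ v _ => by
      refine holder_log (h1 v) ?_
      rw [add_sub_add_right_eq_sub, Real.rpow_one]; exact hK u v) hu hl
  obtain ⟨C', hC', hc'⟩ := uniform_bound P one_pos le_rfl (BM.const (M + 1))
    (fun z _ => by have := (abs_nonneg _).trans (hM z); linarith) (K := 0)
    (fun u _ v _ => by simp) hu hl
  have key : ∀ (a : ℕ → ℝ) (b C : ℝ), (∀ n, |a n - b| ≤ C * wt (1 / P.α - 1) n) →
      Tendsto a atTop (nhds b) := by
    intro a b C h
    rw [tendsto_iff_dist_tendsto_zero]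
    refine squeeze_zero (fun _ => dist_nonneg) h ?_
    simpa using hw.const_mul C
  have t1 := key _ _ _ (hc 0)
  have t2 := key _ _ _ (hc' 0)
  have t3 := t1.sub t2
  simp only [Function.iterate_zero, id_eq, mul_one] at t3
  have hbu : ∀ n, BM (fun z => u ((SS P)^[n] z)) := fun n => hu.comp ((SS_measurable P).iterate n)
  convert t3 using 1
  · funext n
    rw [← integral_sub (((hbu n).mul hf1).integrable mm) (((hbu n).mul (BM.const _)).integrable mm)]
    congr 1; funext z; ring
  · rw [← mul_sub, ← integral_sub (hf1.integrable mm) ((BM.const _).integrable mm)]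
    congr 3; funext z; ring

lemma dens_ident (P : Par) {ν : Measure (ℝ × ℝ)} [IsProbabilityMeasure ν] (hac : ν ≪ mm)
    (hinv : ∀ A, MeasurableSet A → ν (SS P ⁻¹' A) = ν A) {u : ℝ × ℝ → ℝ} (hu : BM u) {l D : ℝ}
    (hl : ∀ n, |xn P u n - l| ≤ D * wt (1 / P.α - 1) n) : ∫ z, u z ∂ν = l := by
  obtain ⟨M, hM⟩ := hu.2
  have hM0 : 0 ≤ M := (abs_nonneg _).trans (hM (0, 0))
  set h : ℝ × ℝ → ℝ := fun z => (ν.rnDeriv mm z).toReal with hh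
  have hhi : Integrable h mm := Measure.integrable_toReal_rnDeriv
  have hνg : ∀ g : ℝ × ℝ → ℝ, ∫ z, g z ∂ν = ∫ z, g z * h z ∂mm := fun g => by
    rw [← integral_rnDeriv_smul hac]
    congr 1; funext z; simp only [smul_eq_mul, hh]; ring
  have hbu : ∀ n, BM (fun z => u ((SS P)^[n] z)) := fun n => hu.comp ((SS_measurable P).iterate n)
  have h1 : ∫ z, h z ∂mm = 1 := by
    have := hνg (fun _ => 1)
    simpa using this.symm
  have main : ∀ ε > 0, |(∫ z, u z ∂ν) - l| ≤ (M + |l|) * ε := by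
    intro ε hε
    obtain ⟨f, hf, hlip, hfe⟩ := lip_approx hhi hε
    have hfi := hf.integrable mm
    have hsub : Integrable (fun z => |h z - f z|) mm := (hhi.sub hfi).abs
    have t := dens_limit P hu hl hf hlip
    have t' := (t.const_sub (∫ z, u z ∂ν)).abs
    have b1 : |(∫ z, u z ∂ν) - l * ∫ z, f z ∂mm| ≤ M * ε := by
      apply le_of_tendsto t'
      refine Eventually.of_forall fun n => ?_
      rw [← invariant_iter (SS_measurable P) hinv n hu.1, hνg]
      have i1 : Integrable (fun z => u ((SS P)^[n] z) * h z) mm :=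
        hhi.bdd_mul (hbu n).1.aestronglyMeasurable (Eventually.of_forall fun z => hM _)
      rw [← integral_sub i1 (((hbu n).mul hf).integrable mm)]
      refine abs_integral_le_integral_abs.trans ?_
      refine le_trans ?_ (mul_le_mul_of_nonneg_left hfe hM0)
      rw [← integral_const_mul]
      apply integral_mono (i1.sub (((hbu n).mul hf).integrable mm)).abs (hsub.const_mul M)
      intro z
      change |u ((SS P)^[n] z) * h z - u ((SS P)^[n] z) * f z| ≤ M * |h z - f z|
      rw [← mul_sub, abs_mul]
      exact mul_le_mul_of_nonneg_right (hM _) (abs_nonneg _)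
    have b2 : |(∫ z, f z ∂mm) - 1| ≤ ε := by
      rw [← h1, ← integral_sub hfi hhi]
      refine abs_integral_le_integral_abs.trans (le_trans (le_of_eq ?_) hfe)
      congr 1; funext z; exact abs_sub_comm _ _
    have b3 : |l * (∫ z, f z ∂mm) - l| ≤ |l| * ε := by
      have : l * (∫ z, f z ∂mm) - l = l * ((∫ z, f z ∂mm) - 1) := by ring
      rw [this, abs_mul]
      exact mul_le_mul_of_nonneg_left b2 (abs_nonneg _)
    have := abs_sub_le (∫ z, u z ∂ν) (l * ∫ z, f z ∂mm) l
    linarith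
  have z0 : |(∫ z, u z ∂ν) - l| ≤ 0 := by
    apply le_of_forall_pos_le_add
    intro ε hε
    have hp : 0 < M + |l| + 1 := by positivity
    have := main (ε / (M + |l| + 1)) (by positivity)
    refine this.trans ?_
    rw [zero_add, mul_div_assoc', div_le_iff₀ hp]
    nlinarith
  linarith [abs_nonpos_iff.1 z0]

/-- Integrals against the iterated density converge to the integral against `ν`. -/
lemma iter_limit (P : Par) {ν : Measure (ℝ × ℝ)} [IsProbabilityMeasure ν] (hac : ν ≪ mm)
    (hinv : ∀ A, MeasurableSet A → ν (SS P ⁻¹' A) = ν A) {g : ℝ × ℝ → ℝ} (hg : BM g) :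
    Tendsto (fun N => ∫ z, g z * (opP P)^[N] (fun _ => 1) z ∂mm) atTop (nhds (∫ z, g z ∂ν)) := by
  obtain ⟨l, D, hl⟩ := xn_limit P hg
  have t := dens_limit P hg hl (BM.const 1) ⟨0, fun u v => by simp⟩
  rw [dens_ident P hac hinv hg hl]
  simp only [duality_iter P hg (BM.const 1)] at t
  simpa using t

lemma main_bound (P : Par) {ν : Measure (ℝ × ℝ)} [IsProbabilityMeasure ν] (hac : ν ≪ mm)
    (hinv : ∀ A, MeasurableSet A → ν (SS P ⁻¹' A) = ν A) {s K : ℝ} (hs : 0 < s) (hs1 : s ≤ 1)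
    {g : ℝ × ℝ → ℝ} (hgb : BM g) (hg0 : ∀ z ∈ Dm, 0 ≤ g z)
    (hg : ∀ u ∈ Dm, ∀ v ∈ Dm, g u ≤ exp (K * dist u v ^ s) * g v)
    {u : ℝ × ℝ → ℝ} (hu : BM u) : ∃ C, 0 ≤ C ∧ ∀ n,
      |(∫ z, u ((SS P)^[n] z) * g z ∂ν) - (∫ z, u z ∂ν) * ∫ z, g z ∂ν| ≤
        C * wt (1 / P.α - 1) n := by
  obtain ⟨l, D, hl⟩ := xn_limit P hu
  obtain ⟨C, hC, hc⟩ := uniform_bound P hs hs1 hgb hg0 hg hu hl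
  refine ⟨C, hC, fun n => ?_⟩
  have hbu : BM (fun z => u ((SS P)^[n] z)) := hu.comp ((SS_measurable P).iterate n)
  have t1 := iter_limit P hac hinv (hbu.mul hgb)
  have t2 := iter_limit P hac hinv hgb
  rw [dens_ident P hac hinv hu hl]
  have t := (t1.sub (t2.const_mul l)).abs
  apply le_of_tendsto t
  refine Eventually.of_forall fun N => ?_
  have := hc N n
  simp only [mul_assoc]
  exact this

lemma ac_mm {ν : Measure (ℝ × ℝ)}
    (hac : ν ≪ volume.restrict (Set.Icc (0 : ℝ) 1 ×ˢ Set.Icc (0 : ℝ) 1)) : ν ≪ mm := by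
  have e : (volume : Measure (ℝ × ℝ)).restrict (Set.Icc (0 : ℝ) 1 ×ˢ Set.Icc (0 : ℝ) 1) = mm := by
    rw [mm_eq, Measure.volume_eq_prod, ← Measure.prod_restrict,
      Measure.restrict_congr_set Ioc_ae_eq_Icc, Measure.restrict_congr_set Ico_ae_eq_Icc]
  rwa [e] at hac

lemma decay_final (P : Par) {ν : Measure (ℝ × ℝ)} [IsProbabilityMeasure ν] (hac : ν ≪ mm)
    (hinv : ∀ A, MeasurableSet A → ν (SS P ⁻¹' A) = ν A) {u ψ : ℝ × ℝ → ℝ} (hu : BM u)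
    {s K : ℝ} (hs : 0 < s) (hs1 : s ≤ 1) (hK : 0 ≤ K)
    (hψ : ∀ u v : ℝ × ℝ, |ψ u - ψ v| ≤ K * dist u v ^ s) : ∃ C, 0 < C ∧ ∀ n : ℕ, 1 ≤ n →
      |(∫ z, u ((SS P)^[n] z) * ψ z ∂ν) - (∫ z, u z ∂ν) * ∫ z, ψ z ∂ν| ≤
        C * (n : ℝ) ^ ((1 : ℝ) - 1 / P.α) := by
  have hcont : Continuous ψ := by
    rw [continuous_iff_continuousAt]
    intro v
    rw [ContinuousAt, tendsto_iff_dist_tendsto_zero]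
    refine squeeze_zero (fun _ => dist_nonneg) (fun u => hψ u v) ?_
    have : Tendsto (fun u => K * dist u v ^ s) (nhds v) (nhds (K * dist v v ^ s)) :=
      (((continuous_id.dist continuous_const).rpow_const (fun _ => Or.inr hs.le)).const_mul K).tendsto v
    simpa [Real.zero_rpow hs.ne'] using this
  set z0 : ℝ × ℝ := (1, 0) with hz0
  have hz0D : z0 ∈ Dm := by simp [hz0, Dm]
  set A := |ψ z0| + K + 1 with hA
  have hA0 : 0 < A := by positivity
  have hbd : ∀ z ∈ Dm, |ψ z| ≤ |ψ z0| + K := by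
    intro z hz
    have h1 := hψ z z0
    have h2 : dist z z0 ^ s ≤ 1 := Real.rpow_le_one dist_nonneg (dist_le_one_of_Dm hz hz0D) hs.le
    have h3 := mul_le_mul_of_nonneg_left h2 hK
    have h4 := abs_sub_abs_le_abs_sub (ψ z) (ψ z0)
    linarith
  set psiD := Dm.indicator ψ with hpsi
  have hpsib : BM psiD := by
    refine ⟨hcont.measurable.indicator Dm_meas, |ψ z0| + K, fun z => ?_⟩
    by_cases h : z ∈ Dm
    · rw [hpsi, indicator_of_mem h]; exact hbd z h
    · rw [hpsi, indicator_of_notMem h, abs_zero]; positivity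
  have hin : ∀ z ∈ Dm, psiD z = ψ z := fun z hz => indicator_of_mem hz ψ
  have h1 : ∀ z ∈ Dm, 1 ≤ psiD z + A := fun z hz => by
    rw [hin z hz]; linarith [neg_le_of_abs_le (hbd z hz)]
  obtain ⟨C, hC, hc⟩ := main_bound P hac hinv hs hs1 (hpsib.add (BM.const A))
    (fun z hz => by linarith [h1 z hz]) (K := K) (fun u hu v hv => by
      refine holder_log (h1 v hv) ?_
      rw [add_sub_add_right_eq_sub, hin u hu, hin v hv]; exact hψ u v) hu
  refine ⟨C + 1, by linarith, fun n hn => ?_⟩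
  have hae : ∀ᵐ z ∂ν, ψ z = psiD z := by
    have : ∀ᵐ z ∂mm, ψ z = psiD z := by
      filter_upwards [ae_restrict_mem Dm_meas] with z hz
      exact (hin z hz).symm
    exact hac.ae_le this
  have e1 : ∫ z, u ((SS P)^[n] z) * ψ z ∂ν = ∫ z, u ((SS P)^[n] z) * psiD z ∂ν :=
    integral_congr_ae (by filter_upwards [hae] with z hz; rw [hz])
  have e2 : ∫ z, ψ z ∂ν = ∫ z, psiD z ∂ν := integral_congr_ae hae
  have hbu : BM (fun z => u ((SS P)^[n] z)) := hu.comp ((SS_measurable P).iterate n)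
  have e3 : ∫ z, u ((SS P)^[n] z) * (psiD z + A) ∂ν =
      (∫ z, u ((SS P)^[n] z) * psiD z ∂ν) + (∫ z, u z ∂ν) * A := by
    rw [← invariant_iter (SS_measurable P) hinv n hu.1, ← integral_mul_const,
      ← integral_add ((hbu.mul hpsib).integrable ν) ((hbu.mul (BM.const A)).integrable ν)]
    congr 1; funext z; ring
  have e4 : ∫ z, (psiD z + A) ∂ν = (∫ z, psiD z ∂ν) + A := by
    rw [integral_add (hpsib.integrable ν) ((BM.const A).integrable ν)]; simp
  have hb := hc n
  rw [e3, e4] at hb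
  rw [e1, e2]
  have e5 : (∫ z, u ((SS P)^[n] z) * psiD z ∂ν) + (∫ z, u z ∂ν) * A -
      (∫ z, u z ∂ν) * ((∫ z, psiD z ∂ν) + A) =
      (∫ z, u ((SS P)^[n] z) * psiD z ∂ν) - (∫ z, u z ∂ν) * ∫ z, psiD z ∂ν := by ring
  rw [e5] at hb
  refine hb.trans ?_
  have hκ := P.kappa
  have hn0 : (0 : ℝ) < n := by exact_mod_cast hn
  have hw : wt (1 / P.α - 1) n ≤ (n : ℝ) ^ ((1 : ℝ) - 1 / P.α) := by
    unfold wt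
    rw [neg_sub]
    exact Real.rpow_le_rpow_of_nonpos hn0 (by linarith) (by linarith)
  have := wt_pos (1 / P.α - 1) n
  calc _ ≤ C * (n : ℝ) ^ ((1 : ℝ) - 1 / P.α) := mul_le_mul_of_nonneg_left hw hC
    _ ≤ _ := mul_le_mul_of_nonneg_right (by linarith) (Real.rpow_nonneg hn0.le _)

theorem skew_decay_of_correlations (α β p₁ p₂ : ℝ) (hα : 0 < α) (hαβ : α < β) (hβ : β ≤ 1)
    (hp₁ : 0 < p₁) (hp₂ : 0 < p₂) (hp : p₁ + p₂ = 1)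
    (ν : Measure (ℝ × ℝ)) (hν : IsProbabilityMeasure ν)
    (hac : ν ≪ volume.restrict (Set.Icc (0 : ℝ) 1 ×ˢ Set.Icc (0 : ℝ) 1))
    (hinv : ∀ A : Set (ℝ × ℝ), MeasurableSet A → ν (skew α β p₁ p₂ ⁻¹' A) = ν A)
    (φ ψ : ℝ × ℝ → ℝ) (hφmeas : Measurable φ) (hφbdd : ∃ M : ℝ, ∀ z, |φ z| ≤ M)
    (hψ : ∃ K : ℝ, 0 ≤ K ∧ ∃ s ∈ Set.Ioc (0 : ℝ) 1,
      ∀ u v : ℝ × ℝ, |ψ u - ψ v| ≤ K * dist u v ^ s) :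
    ∃ C : ℝ, 0 < C ∧ ∀ n : ℕ, 1 ≤ n →
      |(∫ z, φ ((skew α β p₁ p₂)^[n] z) * ψ z ∂ν) -
        (∫ z, φ z ∂ν) * (∫ z, ψ z ∂ν)| ≤ C * (n : ℝ) ^ ((1 : ℝ) - 1 / α) := by
  obtain ⟨K, hK, s, hs, hψ⟩ := hψ
  exact decay_final ⟨α, β, p₁, p₂, hα, hαβ, hβ, hp₁, hp₂, hp⟩ (ac_mm hac) hinv ⟨hφmeas, hφbdd⟩
    hs.1 hs.2 hK hψ
end
end

section
/- Let 0 < α < β ≤ 1 and p₁, p₂ > 0 with p₁ + p₂ = 1. Then there exists a constant C > 0 such that for every n ≥ 1, every ω ∈ [0,1], and all x, y in the interior of J_n(ω): the map T_ω^n is differentiable at x and at y with strictly positive derivatives, and |(T_ω^n)'(x)/(T_ω^n)'(y) − 1| ≤ C·|T_ω^n(x) − T_ω^n(y)|. -/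
noncomputable section

open Real MeasureTheory Set Filter

theorem sel_mem (α β p₁ ω : ℝ) (hα : 0 < α) (hαβ : α < β) (hβ : β ≤ 1) :
    0 < sel α β p₁ ω ∧ sel α β p₁ ω ≤ 1 := by
  unfold sel
  split_ifs <;> constructor <;> linarith

theorem lsv_eq (γ x : ℝ) (hx0 : 0 < x) (hx : x ≤ 1 / 2) :
    lsv γ x = x * (1 + (2 * x) ^ γ) := by
  unfold lsv
  rw [if_pos hx, Real.mul_rpow (by norm_num) hx0.le]

theorem lsv_half (γ : ℝ) : lsv γ (1 / 2) = 1 := by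
  rw [lsv_eq γ _ (by norm_num) le_rfl]
  norm_num

theorem lsv_lt (γ x y : ℝ) (hγ : 0 < γ) (hx0 : 0 < x) (hxy : x < y) (hy : y ≤ 1 / 2) :
    lsv γ x < lsv γ y := by
  rw [lsv_eq γ x hx0 (by linarith), lsv_eq γ y (by linarith) hy]
  have h1 : (2 * x) ^ γ ≤ (2 * y) ^ γ :=
    Real.rpow_le_rpow (by linarith) (by linarith) hγ.le
  have h2 : 0 < (2 * x) ^ γ := Real.rpow_pos_of_pos (by linarith) γ
  apply mul_lt_mul hxy (by linarith) (by linarith) (by linarith)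

theorem lsv_hasDerivAt (γ x : ℝ) (hx0 : 0 < x) (hx : x < 1 / 2) :
    HasDerivAt (lsv γ) (1 + (1 + γ) * (2 * x) ^ γ) x := by
  have h1 : HasDerivAt (fun z : ℝ => (2 * z) ^ γ) (2 * γ * (2 * x) ^ (γ - 1)) x := by
    have h := ((hasDerivAt_id x).const_mul 2).rpow_const (p := γ)
      (Or.inl (by simp; linarith))
    simpa using h
  have h2 := (hasDerivAt_id x).mul (h1.const_add 1)
  have h3 : (2 * x) ^ γ = (2 * x) ^ (γ - 1) * (2 * x) := by
    rw [← Real.rpow_add_one (by linarith)]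
    congr 1
    ring
  have h4 : HasDerivAt (fun z : ℝ => z * (1 + (2 * z) ^ γ)) (1 + (1 + γ) * (2 * x) ^ γ) x := by
    have e : 1 * (1 + (2 * x) ^ γ) + id x * (2 * γ * (2 * x) ^ (γ - 1))
        = 1 + (1 + γ) * (2 * x) ^ γ := by
      rw [h3, id_eq]
      ring
    rw [e] at h2
    exact h2
  apply h4.congr_of_eventuallyEq
  filter_upwards [Ioo_mem_nhds hx0 hx] with z hz
  exact lsv_eq γ z hz.1 hz.2.le

theorem lsv_hasDerivAt_right (γ x : ℝ) (hx : 1 / 2 < x) :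
    HasDerivAt (lsv γ) 2 x := by
  have h4 : HasDerivAt (fun z : ℝ => 2 * z - 1) 2 x := by
    simpa using ((hasDerivAt_id x).const_mul 2).sub_const 1
  apply h4.congr_of_eventuallyEq
  filter_upwards [Ioi_mem_nhds hx] with z hz
  unfold lsv
  rw [if_neg (not_le.mpr hz)]

/-- `T'(x) x² / T(x)²` is nonincreasing on the left branch. -/
theorem lsv_ratio (s t γ : ℝ) (hγ0 : 0 < γ) (hγ : γ ≤ 1) (hs : 0 < s) (hst : s ≤ t) :
    (1 + (1 + γ) * t) * (1 + s) ^ 2 ≤ (1 + (1 + γ) * s) * (1 + t) ^ 2 := by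
  have h : (1 + (1 + γ) * s) * (1 + t) ^ 2 - (1 + (1 + γ) * t) * (1 + s) ^ 2
      = (t - s) * ((1 - γ) + (t + s) + (1 + γ) * (s * t)) := by ring
  have : 0 ≤ (t - s) * ((1 - γ) + (t + s) + (1 + γ) * (s * t)) := by
    have : 0 ≤ t := by linarith
    apply mul_nonneg (by linarith)
    have : 0 ≤ (1 + γ) * (s * t) := by positivity
    linarith
  linarith

theorem key_induction (α β p₁ p₂ : ℝ) (hα : 0 < α) (hαβ : α < β) (hβ : β ≤ 1)
    (X : ℕ → ℝ → ℝ) (hX : IsRandBackOrbit α β p₁ p₂ X) (m : ℕ) :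
    ∀ ω u v : ℝ, X (m + 1) ω < u → u ≤ v → v < X m ω →
      ∃ a b : ℝ, HasDerivAt (randIter α β p₁ p₂ m ω) a u ∧
        HasDerivAt (randIter α β p₁ p₂ m ω) b v ∧ 0 < a ∧ a ≤ b ∧
        1 / 2 < randIter α β p₁ p₂ m ω u ∧
        randIter α β p₁ p₂ m ω u ≤ randIter α β p₁ p₂ m ω v ∧
        randIter α β p₁ p₂ m ω v < 1 ∧
        b * v ^ 2 * randIter α β p₁ p₂ m ω u ^ 2 ≤
          a * u ^ 2 * randIter α β p₁ p₂ m ω v ^ 2 := by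
  obtain ⟨hX0, hX1, hX2⟩ := hX
  induction m with
  | zero =>
    intro ω u v hu huv hv
    rw [hX1] at hu
    rw [hX0] at hv
    refine ⟨1, 1, hasDerivAt_id u, hasDerivAt_id v, one_pos, le_rfl, hu, huv, hv, ?_⟩
    simp only [randIter]
    apply le_of_eq
    ring
  | succ m ih =>
    intro ω u v hu huv hv
    obtain ⟨hγ0, hγ1⟩ := sel_mem α β p₁ ω hα hαβ hβ
    have hv2 : X (m + 1) ω ≤ 1 / 2 := by
      rcases m with _ | k
      · exact (hX1 ω).le
      · exact (hX2 (k + 1 + 1) (by omega) ω).1.2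
    have hTX : lsv (sel α β p₁ ω) (X (m + 1) ω) = X m (phiMap p₁ p₂ ω) := by
      rcases m with _ | k
      · rw [hX1, hX0, lsv_half]
      · exact (hX2 (k + 1 + 1) (by omega) ω).2
    obtain ⟨⟨hw0, hw1⟩, hw2⟩ := hX2 (m + 1 + 1) (by omega) ω
    simp only [Nat.add_sub_cancel] at hw2
    have hu0 : 0 < u := hw0.trans hu
    have hv0 : 0 < v := by linarith
    have hT1 := lsv_lt _ _ _ hγ0 hw0 hu (by linarith)
    have hT2 := lsv_lt _ _ _ hγ0 hv0 hv hv2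
    rw [hw2] at hT1
    rw [hTX] at hT2
    have hT3 : lsv (sel α β p₁ ω) u ≤ lsv (sel α β p₁ ω) v := by
      rcases huv.eq_or_lt with h | h
      · rw [h]
      · exact (lsv_lt _ _ _ hγ0 hu0 h (by linarith)).le
    obtain ⟨a, b, ha, hb, ha0, hab, h1, h2, h3, h4⟩ := ih _ _ _ hT1 hT3 hT2
    have du := lsv_hasDerivAt (sel α β p₁ ω) u hu0 (by linarith)
    have dv := lsv_hasDerivAt (sel α β p₁ ω) v hv0 (by linarith)
    have eu := lsv_eq (sel α β p₁ ω) u hu0 (by linarith)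
    have ev := lsv_eq (sel α β p₁ ω) v hv0 (by linarith)
    have hs : 0 < (2 * u) ^ (sel α β p₁ ω) := Real.rpow_pos_of_pos (by linarith) _
    have hst : (2 * u) ^ (sel α β p₁ ω) ≤ (2 * v) ^ (sel α β p₁ ω) :=
      Real.rpow_le_rpow (by linarith) (by linarith) hγ0.le
    have hr := lsv_ratio _ _ _ hγ0 hγ1 hs hst
    refine ⟨_, _, HasDerivAt.comp u ha du, HasDerivAt.comp v hb dv, by positivity, ?_,
      h1, h2, h3, ?_⟩
    · have : 0 < b := by linarith
      gcongr
    · simp only [randIter]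
      generalize randIter α β p₁ p₂ m (phiMap p₁ p₂ ω) (lsv (sel α β p₁ ω) u) = Fu at *
      generalize randIter α β p₁ p₂ m (phiMap p₁ p₂ ω) (lsv (sel α β p₁ ω) v) = Fv at *
      rw [eu, ev] at h4
      generalize (2 * u) ^ (sel α β p₁ ω) = s at *
      generalize (2 * v) ^ (sel α β p₁ ω) = t at *
      generalize sel α β p₁ ω = γ at *
      have ht : 0 < t := by linarith
      have hb0 : 0 < b := by linarith
      have hpos : 0 < (1 + t) ^ 2 * (1 + s) ^ 2 := by positivity
      refine le_of_mul_le_mul_right ?_ hpos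
      calc b * (1 + (1 + γ) * t) * v ^ 2 * Fu ^ 2 * ((1 + t) ^ 2 * (1 + s) ^ 2)
          = (b * (v * (1 + t)) ^ 2 * Fu ^ 2) * ((1 + (1 + γ) * t) * (1 + s) ^ 2) := by ring
        _ ≤ (a * (u * (1 + s)) ^ 2 * Fv ^ 2) * ((1 + (1 + γ) * s) * (1 + t) ^ 2) := by
            apply mul_le_mul h4 hr <;> positivity
        _ = _ := by ring

theorem final_bound (a b u v F G : ℝ) (ha : 0 < a) (hab : a ≤ b) (hu : 0 < u) (huv : u ≤ v)
    (hF : 1 / 2 < F) (hFG : F ≤ G) (hG : G < 1)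
    (h : b * v ^ 2 * F ^ 2 ≤ a * u ^ 2 * G ^ 2) :
    |b / a - 1| ≤ 8 * |G - F| ∧ |a / b - 1| ≤ 8 * |F - G| := by
  have hb : 0 < b := by linarith
  have h1 : b * F ^ 2 ≤ a * G ^ 2 := by
    have hv : 0 < v ^ 2 := by have : 0 < v := by linarith
                              positivity
    refine le_of_mul_le_mul_right ?_ hv
    calc b * F ^ 2 * v ^ 2 = b * v ^ 2 * F ^ 2 := by ring
      _ ≤ a * u ^ 2 * G ^ 2 := h
      _ = a * G ^ 2 * u ^ 2 := by ring
      _ ≤ a * G ^ 2 * v ^ 2 := by gcongr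
  have h2 : b - a ≤ 8 * (G - F) * a := by
    have h3 : (b - a) * F ^ 2 ≤ a * ((G - F) * (G + F)) := by linarith
    have h4 : (b - a) * (1 / 4) ≤ (b - a) * F ^ 2 :=
      mul_le_mul_of_nonneg_left (by nlinarith) (by linarith)
    have h5 : a * ((G - F) * (G + F)) ≤ a * ((G - F) * 2) := by
      apply mul_le_mul_of_nonneg_left _ ha.le
      apply mul_le_mul_of_nonneg_left _ (by linarith)
      linarith
    linarith
  rw [abs_sub_comm F G, abs_of_nonneg (sub_nonneg.mpr hFG)]
  constructor
  · rw [abs_of_nonneg (by rw [sub_nonneg, one_le_div ha]; exact hab), div_sub_one ha.ne',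
      div_le_iff₀ ha]
    exact h2
  · rw [abs_sub_comm, abs_of_nonneg (by rw [sub_nonneg, div_le_one hb]; exact hab),
      one_sub_div hb.ne', div_le_iff₀ hb]
    refine h2.trans ?_
    apply mul_le_mul_of_nonneg_left hab
    linarith

/-- For `0 < α < β ≤ 1` and `p₁, p₂ > 0` with `p₁ + p₂ = 1`, there is
`C > 0` such that for every `n ≥ 1`, `ω ∈ [0,1]`, and `x, y` in the interior of `J_n(ω)`,
the map `T_ω^n` is differentiable at `x` and `y` with positive derivatives and
`|(T_ω^n)'(x)/(T_ω^n)'(y) − 1| ≤ C·|T_ω^n(x) − T_ω^n(y)|`. -/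
theorem ratio_distortion (α β p₁ p₂ : ℝ) (hα : 0 < α) (hαβ : α < β) (hβ : β ≤ 1)
    (hp₁ : 0 < p₁) (hp₂ : 0 < p₂) (hp : p₁ + p₂ = 1)
    (X X' : ℕ → ℝ → ℝ) (hX : IsRandBackOrbit α β p₁ p₂ X)
    (hX' : IsRandBackOrbitPrime p₁ p₂ X X') :
    ∃ C : ℝ, 0 < C ∧ ∀ n : ℕ, 1 ≤ n → ∀ ω ∈ Set.Icc (0 : ℝ) 1,
      ∀ x ∈ Set.Ioo (X' n ω) (X' (n - 1) ω), ∀ y ∈ Set.Ioo (X' n ω) (X' (n - 1) ω),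
        DifferentiableAt ℝ (randIter α β p₁ p₂ n ω) x ∧
        DifferentiableAt ℝ (randIter α β p₁ p₂ n ω) y ∧
        0 < deriv (randIter α β p₁ p₂ n ω) x ∧
        0 < deriv (randIter α β p₁ p₂ n ω) y ∧
        |deriv (randIter α β p₁ p₂ n ω) x / deriv (randIter α β p₁ p₂ n ω) y - 1| ≤
          C * |randIter α β p₁ p₂ n ω x - randIter α β p₁ p₂ n ω y| := by
  refine ⟨8, by norm_num, ?_⟩
  intro n hn ω _
  obtain ⟨m, rfl⟩ : ∃ m, n = m + 1 := ⟨n - 1, by omega⟩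
  simp only [Nat.add_sub_cancel]
  have hXX : ∀ k, X' k ω = (X k (phiMap p₁ p₂ ω) + 1) / 2 := by
    intro k
    rcases k with _ | _ | k
    · rw [hX'.1, hX.1]; norm_num
    · rw [hX'.2.1, hX.2.1]; norm_num
    · exact hX'.2.2 _ (by omega) ω
  have hpos : 0 < X (m + 1) (phiMap p₁ p₂ ω) := by
    rcases m with _ | m
    · rw [hX.2.1]; norm_num
    · exact (hX.2.2 (m + 1 + 1) (by omega) _).1.1
  rw [hXX, hXX]
  have main : ∀ x y : ℝ, (X (m + 1) (phiMap p₁ p₂ ω) + 1) / 2 < x → x ≤ y →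
      y < (X m (phiMap p₁ p₂ ω) + 1) / 2 →
      ∃ a b : ℝ, HasDerivAt (randIter α β p₁ p₂ (m + 1) ω) a x ∧
        HasDerivAt (randIter α β p₁ p₂ (m + 1) ω) b y ∧ 0 < a ∧ 0 < b ∧
        |b / a - 1| ≤ 8 *
          |randIter α β p₁ p₂ (m + 1) ω y - randIter α β p₁ p₂ (m + 1) ω x| ∧
        |a / b - 1| ≤ 8 *
          |randIter α β p₁ p₂ (m + 1) ω x - randIter α β p₁ p₂ (m + 1) ω y| := by
    intro x y hx hxy hy
    have hx2 : 1 / 2 < x := by linarith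
    have hy2 : 1 / 2 < y := by linarith
    have ex : lsv (sel α β p₁ ω) x = 2 * x - 1 := by
      unfold lsv; rw [if_neg (not_le.mpr hx2)]
    have ey : lsv (sel α β p₁ ω) y = 2 * y - 1 := by
      unfold lsv; rw [if_neg (not_le.mpr hy2)]
    obtain ⟨a, b, ha, hb, ha0, hab, h1, h2, h3, h4⟩ :=
      key_induction α β p₁ p₂ hα hαβ hβ X hX m (phiMap p₁ p₂ ω)
        (lsv (sel α β p₁ ω) x) (lsv (sel α β p₁ ω) y)
        (by rw [ex]; linarith) (by rw [ex, ey]; linarith) (by rw [ey]; linarith)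
    have hfin := final_bound a b _ _ _ _ ha0 hab (by rw [ex]; linarith)
      (by rw [ex, ey]; linarith) h1 h2 h3 h4
    have hb0 : 0 < b := by linarith
    refine ⟨_, _, HasDerivAt.comp x ha (lsv_hasDerivAt_right _ x hx2),
      HasDerivAt.comp y hb (lsv_hasDerivAt_right _ y hy2), by positivity, by positivity, ?_⟩
    rw [mul_div_mul_right _ _ (two_ne_zero), mul_div_mul_right _ _ (two_ne_zero)]
    exact hfin
  intro x hx y hy
  rcases le_total x y with hxy | hxy
  · obtain ⟨a, b, ha, hb, ha0, hb0, h1, h2⟩ := main x y hx.1 hxy hy.2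
    rw [ha.deriv, hb.deriv]
    exact ⟨ha.differentiableAt, hb.differentiableAt, ha0, hb0, h2⟩
  · obtain ⟨a, b, ha, hb, ha0, hb0, h1, h2⟩ := main y x hy.1 hxy hx.2
    rw [ha.deriv, hb.deriv]
    exact ⟨hb.differentiableAt, ha.differentiableAt, hb0, ha0, h1⟩
end
end
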